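/- Let Γ_(n) be the Gelfand–Graev character of the finite unitary group U_n = U(n, F_{q^2}). Then Γ_(n) vanishes on all non-unipotent conjugacy classes, and its value on a unipotent class of type μ ⊢ n equals (−1)^{⌊n/2⌋ − ℓ(μ)} · Π_{i=1}^{ℓ(μ)} ((−q)^i − 1). -/

import Mathlib

/-!
Common framework for a formalization of statements from
"Gelfand–Graev characters of the finite unitary groups" (Thiem–Vinroot).
-/

open scoped Classical

noncomputable section

namespace GGU

/-! ### Partitions -/

/-- A partition, encoded as a weakly decreasing, finitely supported sequence of
natural numbers; `parts i` is the `i`-th part `λ_i` for `i ≥ 1`, and `parts 0 = 0`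
by convention. -/
structure Partn where
  parts : ℕ → ℕ
  parts_zero : parts 0 = 0
  parts_antitone : ∀ ⦃i j : ℕ⦄, 1 ≤ i → i ≤ j → parts j ≤ parts i
  parts_finite : {i : ℕ | parts i ≠ 0}.Finite

/-- The size `|λ|` of a partition. -/
def Partn.size (l : Partn) : ℕ := ∑ᶠ i, l.parts i

/-- The length `ℓ(λ)` (number of nonzero parts) of a partition. -/
def Partn.len (l : Partn) : ℕ := {i : ℕ | l.parts i ≠ 0}.ncard

/-- The statistic `n(λ) = ∑ (i-1)·λ_i`. -/
def Partn.nstat (l : Partn) : ℕ := ∑ᶠ i, (i - 1) * l.parts i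

/-- The multiplicity `m_k(λ)` of the part `k ≥ 1` in `λ`. -/
def Partn.mult (l : Partn) (k : ℕ) : ℕ := {i : ℕ | 1 ≤ i ∧ l.parts i = k}.ncard

/-- `z_λ = ∏_k k^{m_k} m_k!`. -/
def Partn.zee (l : Partn) : ℕ := ∏ᶠ k, k ^ l.mult k * (l.mult k).factorial

/-- The cell `(i,j)` (row `i ≥ 1`, column `j ≥ 1`) lies in the Young diagram of `λ`. -/
def Partn.cell (l : Partn) (c : ℕ × ℕ) : Prop := 1 ≤ c.1 ∧ 1 ≤ c.2 ∧ c.2 ≤ l.parts c.1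

/-- The empty partition. -/
def Partn.empty : Partn where
  parts := fun _ => 0
  parts_zero := rfl
  parts_antitone := fun _ _ _ _ => le_rfl
  parts_finite := by simp

/-- The one-row partition `(m)`. -/
def Partn.ofRow (m : ℕ) : Partn where
  parts := fun i => if i = 1 then m else 0
  parts_zero := by simp
  parts_antitone := by
    intro i j hi hij
    by_cases hj : j = 1
    · have hi1 : i = 1 := by omega
      simp [hj, hi1]
    · simp [hj]
  parts_finite := Set.Finite.subset (Set.finite_singleton 1) (by
    intro i hi
    by_cases h : i = 1 <;> simp_all)

/-- Partial sums `λ_1 + ⋯ + λ_k`. -/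
def Partn.cumul (l : Partn) (k : ℕ) : ℕ := ∑ t ∈ Finset.range k, l.parts (t + 1)

/-- Strict dominance order on partitions of the same size. -/
def DomLt (l m : Partn) : Prop :=
  l.size = m.size ∧ l ≠ m ∧ ∀ k, l.cumul k ≤ m.cumul k

/-- The set `{ν_{≤ 1}, ν_{≤ 2}, …}` of partial sums of a partition `ν`. -/
def cumSet (nu : Partn) : Set ℕ := {m : ℕ | ∃ j, 1 ≤ j ∧ m = nu.cumul j}

/-- Lexicographic order on weight sequences. -/
def LexLE (f g : ℕ → ℕ) : Prop := f = g ∨ ∃ k, f k < g k ∧ ∀ j < k, f j = g j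

/-! ### Dominoes, 2-cores and 2-quotients -/

/-- Two cells are adjacent (horizontally or vertically). -/
def adjCell (c d : ℕ × ℕ) : Prop :=
  (c.1 = d.1 ∧ (c.2 + 1 = d.2 ∨ d.2 + 1 = c.2)) ∨
  (c.2 = d.2 ∧ (c.1 + 1 = d.1 ∨ d.1 + 1 = c.1))

/-- `DomStep μ ρ` : the partition `ρ` is obtained from `μ` by removing one domino. -/
def DomStep (mu rho : Partn) : Prop :=
  (∀ i, rho.parts i ≤ mu.parts i) ∧
  ∃ c d : ℕ × ℕ, c ≠ d ∧ adjCell c d ∧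
    mu.cell c ∧ mu.cell d ∧ ¬ rho.cell c ∧ ¬ rho.cell d ∧
    ∀ e : ℕ × ℕ, mu.cell e → ¬ rho.cell e → e = c ∨ e = d

/-- `γ` is the 2-core of `λ`: it is obtained from `λ` by successively removing
dominoes, and admits no further domino removal. -/
def TwoCore (lam gam : Partn) : Prop :=
  Relation.ReflTransGen DomStep lam gam ∧ ∀ rho, ¬ DomStep gam rho

/-- `core₂(λ) ∈ {∅, (1)}`. -/
def core2small (lam : Partn) : Prop := ∃ gam, TwoCore lam gam ∧ gam.size ≤ 1

/-- The size `|core₂(λ)|` of the 2-core of `λ`. -/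
def core2size (lam : Partn) : ℕ := sInf {s | ∃ gam, TwoCore lam gam ∧ gam.size = s}

/-- The `j`-th part of one member (`ε ∈ {0,1}`) of the 2-quotient of `λ`,
computed from the β-set `{λ_t + N - t : 1 ≤ t ≤ N}` with `N = 2(|λ|+1)`. -/
def quot2part (lam : Partn) (ε : ℕ) (j : ℕ) : ℕ :=
  let N := 2 * (lam.size + 1)
  let B := (Finset.range N).image fun t => lam.parts (t + 1) + (N - (t + 1))
  let L := (B.filter fun b => b % 2 = ε).sort (· ≤ ·)
  if 1 ≤ j ∧ j ≤ L.length then (L.getD (L.length - j) 0) / 2 - (L.length - j) else 0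

/-- `quot₂(λ)_j`, the sum of the `j`-th parts of the two members of the 2-quotient. -/
def quot2sum (lam : Partn) (j : ℕ) : ℕ := quot2part lam 0 j + quot2part lam 1 j

/-! ### Tableaux -/

/-- A semistandard (column-strict) Young tableau of shape `λ` with entries in `{1,2,…}`. -/
structure SSYT (lam : Partn) where
  entry : ℕ × ℕ → ℕ
  entry_pos : ∀ c, lam.cell c → 1 ≤ entry c
  entry_outside : ∀ c, ¬ lam.cell c → entry c = 0
  row_weak : ∀ i j : ℕ, lam.cell (i, j + 1) → entry (i, j) ≤ entry (i, j + 1)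
  col_strict : ∀ i j : ℕ, 1 ≤ i → lam.cell (i + 1, j) → entry (i, j) < entry (i + 1, j)

/-- The number of entries equal to `k` in a semistandard tableau. -/
def SSYT.wt {lam : Partn} (T : SSYT lam) (k : ℕ) : ℕ :=
  {c : ℕ × ℕ | lam.cell c ∧ T.entry c = k}.ncard

/-- A symplectic tableau: a column strict filling of `λ` by the symbols
`0 < 1̄ < 1 < 2̄ < 2 < ⋯`, where the symbol `0` is encoded by `0`, `k̄` by `2k-1`
and `k` by `2k`. -/
structure SympTab (lam : Partn) where
  entry : ℕ × ℕ → ℕ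
  entry_outside : ∀ c, ¬ lam.cell c → entry c = 0
  row_weak : ∀ i j : ℕ, lam.cell (i, j + 1) → entry (i, j) ≤ entry (i, j + 1)
  col_strict : ∀ i j : ℕ, 1 ≤ i → lam.cell (i + 1, j) → entry (i, j) < entry (i + 1, j)

/-- The weight of a symplectic tableau: `wt 0` is the number of `0`'s, and for
`k ≥ 1`, `wt k` is the number of `k̄`'s plus the number of `k`'s. -/
def SympTab.wt {lam : Partn} (T : SympTab lam) (k : ℕ) : ℕ :=
  if k = 0 then {c : ℕ × ℕ | lam.cell c ∧ T.entry c = 0}.ncard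
  else {c : ℕ × ℕ | lam.cell c ∧ (T.entry c = 2 * k - 1 ∨ T.entry c = 2 * k)}.ncard

/-- The cells of `λ/(m₀)`: cells of `λ` other than the `m₀` leftmost cells of the
first row. -/
def Partn.tiled (lam : Partn) (m0 : ℕ) (c : ℕ × ℕ) : Prop :=
  lam.cell c ∧ ¬ (c.1 = 1 ∧ c.2 ≤ m0)

/-- A (semistandard) domino tableau of shape `λ/(m₀)`: a column strict filling of a
tiling of `λ/(m₀)` by dominoes, with `0`'s in the `m₀` non-tiled boxes.  The tiling is
recorded by the involution `mate` matching each tiled cell with the other cell of its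
domino. -/
structure DomTab (lam : Partn) (m0 : ℕ) where
  m0_le : m0 ≤ lam.parts 1
  entry : ℕ × ℕ → ℕ
  mate : ℕ × ℕ → ℕ × ℕ
  entry_pos : ∀ c, lam.tiled m0 c → 1 ≤ entry c
  entry_zero : ∀ c, ¬ lam.tiled m0 c → entry c = 0
  mate_tiled : ∀ c, lam.tiled m0 c → lam.tiled m0 (mate c)
  mate_id : ∀ c, ¬ lam.tiled m0 c → mate c = c
  mate_invol : ∀ c, mate (mate c) = c
  mate_adj : ∀ c, lam.tiled m0 c → adjCell c (mate c)
  mate_entry : ∀ c, entry (mate c) = entry c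
  row_weak : ∀ i j : ℕ, lam.cell (i, j + 1) → entry (i, j) ≤ entry (i, j + 1)
  col_strict : ∀ i j : ℕ, 1 ≤ i → lam.cell (i + 1, j) → mate (i, j) ≠ (i + 1, j) →
    entry (i, j) < entry (i + 1, j)

/-- The weight of a domino tableau: `wt k` is the number of dominoes labelled `k`. -/
def DomTab.wt {lam : Partn} {m0 : ℕ} (T : DomTab lam m0) (k : ℕ) : ℕ :=
  {c : ℕ × ℕ | lam.tiled m0 c ∧ T.entry c = k}.ncard / 2

/-! ### Θ-partitions and battery tableaux -/

/-- A `Θ`-partition: an assignment of a partition to each element of the index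
type `Th` (the set of Frobenius orbits), with finite support. -/
structure TPartn (Th : Type) where
  lam : Th → Partn
  finite : {φ : Th | lam φ ≠ Partn.empty}.Finite

/-- The size `|λ| = ∑_φ |φ|·|λ^{(φ)}|` of a `Θ`-partition, where `deg φ` is the
orbit size `|φ|`. -/
def TPartn.size {Th : Type} (deg : Th → ℕ) (l : TPartn Th) : ℕ :=
  ∑ᶠ φ, deg φ * (l.lam φ).size

/-- `n(λ) = ∑_φ |φ|·n(λ^{(φ)})` for a `Θ`-partition. -/
def TPartn.nstat {Th : Type} (deg : Th → ℕ) (l : TPartn Th) : ℕ :=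
  ∑ᶠ φ, deg φ * (l.lam φ).nstat

/-- A battery `Θ`-tableau of shape `λ/γ` (with `hgt(γ) ≤ 1`, so that `γ^{(φ)}` is the
one-row partition `(γ^{(φ)}_1)`): a domino tableau of shape `λ^{(φ)}/(γ^{(φ)}_1)` for each
`φ` with `|φ|` odd, and a symplectic tableau of shape `λ^{(φ)}/(γ^{(φ)}_1)` for each `φ`
with `|φ|` even. -/
structure BatteryTab {Th : Type} (deg : Th → ℕ) (lam gam : Th → Partn) where
  dom : ∀ φ, Odd (deg φ) → DomTab (lam φ) ((gam φ).parts 1)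
  symp : ∀ φ, ¬ Odd (deg φ) → SympTab (lam φ)
  symp_wt0 : ∀ φ (h : ¬ Odd (deg φ)), (symp φ h).wt 0 = (gam φ).parts 1

/-- The weight of a battery tableau:
`wt(Q)_i = ∑_{|φ| odd} |φ|·wt(Q^{(φ)})_i + ∑_{|φ| even} (|φ|/2)·wt(Q^{(φ)})_i`. -/
def BatteryTab.wt {Th : Type} {deg : Th → ℕ} {lam gam : Th → Partn}
    (T : BatteryTab deg lam gam) (i : ℕ) : ℕ :=
  ∑ᶠ φ : Th, if h : Odd (deg φ) then deg φ * (T.dom φ h).wt i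
    else (deg φ / 2) * (T.symp φ h).wt i

/-- The set `B^λ_{(k,ν)}` of battery tableaux of shape `λ/γ`, for some `Θ`-partition
`γ` of size `k` with `hgt(γ) ≤ 1`, and of weight `ν`. -/
structure Battery {Th : Type} (deg : Th → ℕ) (lam : TPartn Th) (k : ℕ) (nu : Partn) where
  gam : TPartn Th
  gam_size : TPartn.size deg gam = k
  gam_hgt : ∀ φ, (gam.lam φ).len ≤ 1
  gam_le : ∀ φ, (gam.lam φ).parts 1 ≤ (lam.lam φ).parts 1
  tab : BatteryTab deg lam.lam gam.lam
  tab_wt : ∀ i, 1 ≤ i → tab.wt i = nu.parts i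

/-! ### Symmetric functions as formal power series -/

/-- The Schur function `s_λ` in the variables `X_0, X_1, X_2, …`, defined
combinatorially: the coefficient of a monomial is the number of semistandard Young
tableaux of shape `λ` with the corresponding content. -/
def sSchur (lam : Partn) : MvPowerSeries ℕ ℂ :=
  fun d => (Nat.card {T : SSYT lam // ∀ k, 1 ≤ k → T.wt k = d (k - 1)} : ℂ)

/-- The Schur function `s_λ(Y^{(φ)})` in the variable family `Y^{(φ)}`, inside the ring
of symmetric functions in the variables `{Y^{(φ)}_j : φ ∈ Θ, j ∈ ℕ}`. -/
def sSchurAt {Th : Type} (φ : Th) (lam : Partn) : MvPowerSeries (Th × ℕ) ℂ :=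
  fun d => if ∀ x ∈ d.support, x.1 = φ then
    (Nat.card {T : SSYT lam // ∀ k, 1 ≤ k → T.wt k = d (φ, k - 1)} : ℂ) else 0

/-- `s_λ = ∏_φ s_{λ^{(φ)}}(Y^{(φ)})` for a `Θ`-partition `λ`. -/
def sTheta {Th : Type} (l : TPartn Th) : MvPowerSeries (Th × ℕ) ℂ :=
  ∏ᶠ φ, sSchurAt φ (l.lam φ)

/-- The monomial symmetric function `m_λ`. -/
def msym (l : Partn) : MvPowerSeries ℕ ℂ :=
  fun d => if d.support.val.map (fun i => d i) = l.parts_finite.toFinset.val.map l.parts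
    then 1 else 0

/-- The power sum `p_k = ∑_i X_i^k` (with `p_0 = 1` by convention). -/
def ppow (k : ℕ) : MvPowerSeries ℕ ℂ :=
  if k = 0 then 1
  else fun d => if ∃ i : ℕ, d = Finsupp.single i k then 1 else 0

/-- The power sum symmetric function `p_ν = p_{ν_1} p_{ν_2} ⋯`. -/
def psym (l : Partn) : MvPowerSeries ℕ ℂ := ∏ᶠ i, ppow (l.parts i)

/-- Plethysm with the power sum `p_2`: `(f ∘ p_2)(X_0, X_1, …) = f(X_0^2, X_1^2, …)`. -/
def plet2 (F : MvPowerSeries ℕ ℂ) : MvPowerSeries ℕ ℂ :=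
  fun d => if ∀ i, 2 ∣ d i
    then F (Finsupp.mapRange (· / 2) (Nat.zero_div 2) d) else 0



/-! ### The finite groups: `GL(n, F_{p^r})` and `U(n, F_{q²})` inside `GL(n, F̄_p)` -/

/-- An algebraic closure `F̄_p` of the prime field. -/
abbrev Fbar (p : ℕ) [Fact p.Prime] : Type := AlgebraicClosure (ZMod p)

/-- The field endomorphism `x ↦ x^{p^r}` of `F̄_p`. -/
def frobPow (p : ℕ) [Fact p.Prime] (r : ℕ) : Fbar p →+* Fbar p :=
  haveI : CharP (Fbar p) p :=
    charP_of_injective_algebraMap (algebraMap (ZMod p) (Fbar p)).injective p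
  haveI : ExpChar (Fbar p) p := ExpChar.prime Fact.out
  iterateFrobenius (Fbar p) p r

/-- The entrywise Frobenius `(a_{ij}) ↦ (a_{ij}^{p^r})` on `GL(n, F̄_p)`. -/
def entryFrobGL (p : ℕ) [Fact p.Prime] (r n : ℕ) :
    (Matrix (Fin n) (Fin n) (Fbar p))ˣ →* (Matrix (Fin n) (Fin n) (Fbar p))ˣ :=
  Units.map ((frobPow p r).mapMatrix.toMonoidHom)

/-- `GL(n, F_{p^r})`, realized as the fixed points of the entrywise Frobenius
`(a_{ij}) ↦ (a_{ij}^{p^r})` on `GL(n, F̄_p)`. -/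
def GLfix (p : ℕ) [Fact p.Prime] (r n : ℕ) : Subgroup (Matrix (Fin n) (Fin n) (Fbar p))ˣ where
  carrier := {A | entryFrobGL p r n A = A}
  one_mem' := by simp
  mul_mem' := by
    intro a b ha hb
    simp only [Set.mem_setOf_eq, map_mul] at *
    rw [ha, hb]
  inv_mem' := by
    intro a ha
    simp only [Set.mem_setOf_eq, map_inv] at *
    rw [ha]

/-- The anti-transpose `(M^{at})_{ij} = M_{n+1-j, n+1-i}` of a matrix. -/
def atrans {n : ℕ} {K : Type*} (M : Matrix (Fin n) (Fin n) K) : Matrix (Fin n) (Fin n) K :=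
  Matrix.of fun i j => M (Fin.rev j) (Fin.rev i)

lemma atrans_one {n : ℕ} {K : Type*} [NonAssocSemiring K] :
    atrans (1 : Matrix (Fin n) (Fin n) K) = 1 := by
  ext i j
  simp only [atrans, Matrix.of_apply, Matrix.one_apply, Fin.rev_inj]
  by_cases h : i = j
  · simp [h]
  · simp [h, Ne.symm h]

lemma atrans_mul {n : ℕ} {K : Type*} [CommSemiring K] (M N : Matrix (Fin n) (Fin n) K) :
    atrans (M * N) = atrans N * atrans M := by
  ext i j
  simp only [atrans, Matrix.of_apply, Matrix.mul_apply]
  exact Fintype.sum_equiv Fin.revPerm _ _ (fun k => by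
    simp [Fin.rev_rev, mul_comm])

/-- The twisted Frobenius `F'(A) = (ᵃ(A^{p^f}))⁻¹` (entrywise `q = p^f` power, followed by
anti-transpose-inverse) on `GL(n, F̄_p)`, whose fixed point group is the finite unitary
group `U(n, F_{q²})`. -/
def unitaryFrob (p : ℕ) [Fact p.Prime] (fexp n : ℕ) :
    (Matrix (Fin n) (Fin n) (Fbar p))ˣ →* (Matrix (Fin n) (Fin n) (Fbar p))ˣ where
  toFun A :=
    { val := atrans ((frobPow p fexp).mapMatrix A.inv)
      inv := atrans ((frobPow p fexp).mapMatrix A.val)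
      val_inv := by
        rw [← atrans_mul, ← map_mul, A.val_inv, map_one, atrans_one]
      inv_val := by
        rw [← atrans_mul, ← map_mul, A.inv_val, map_one, atrans_one] }
  map_one' := by
    apply Units.ext
    show atrans ((frobPow p fexp).mapMatrix (1 : Matrix (Fin n) (Fin n) (Fbar p))) = _
    rw [map_one, atrans_one]
    rfl
  map_mul' := by
    intro A B
    apply Units.ext
    show atrans ((frobPow p fexp).mapMatrix (B.inv * A.inv)) = _
    rw [map_mul, atrans_mul]
    rfl

/-- The finite unitary group `U(n, F_{q²})` (with `q = p^fexp`), realized as the fixed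
points of the twisted Frobenius `F'` on `GL(n, F̄_p)`. -/
def Uprime (p : ℕ) [Fact p.Prime] (fexp n : ℕ) :
    Subgroup (Matrix (Fin n) (Fin n) (Fbar p))ˣ where
  carrier := {A | unitaryFrob p fexp n A = A}
  one_mem' := by simp
  mul_mem' := by
    intro a b ha hb
    simp only [Set.mem_setOf_eq, map_mul] at *
    rw [ha, hb]
  inv_mem' := by
    intro a ha
    simp only [Set.mem_setOf_eq, map_inv] at *
    rw [ha]

/-- The underlying matrix of an element of a subgroup of `GL(n, F̄_p)`. -/
def matOf {p : ℕ} [Fact p.Prime] {n : ℕ} {H : Subgroup (Matrix (Fin n) (Fin n) (Fbar p))ˣ}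
    (u : ↥H) : Matrix (Fin n) (Fin n) (Fbar p) :=
  ((u : (Matrix (Fin n) (Fin n) (Fbar p))ˣ) : Matrix (Fin n) (Fin n) (Fbar p))

/-- The subgroup (as a subset) of unipotent upper-triangular matrices in `H`. -/
def unitri {p : ℕ} [Fact p.Prime] {n : ℕ} (H : Subgroup (Matrix (Fin n) (Fin n) (Fbar p))ˣ) :
    Set ↥H :=
  {u | (∀ i j : Fin n, j < i → matOf u i j = 0) ∧ ∀ i : Fin n, matOf u i i = 1}

/-! ### Class function machinery -/

/-- The induced class function `Ind_B^G ψ (g) = |B|⁻¹ ∑_{x ∈ G, x⁻¹gx ∈ B} ψ(x⁻¹gx)`,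
for a subset `B` of `G` and `ψ : G → ℂ` (only the values of `ψ` on `B` matter). -/
def indChar {G : Type} [Group G] (B : Set G) (ψ : G → ℂ) : G → ℂ :=
  fun g => (Nat.card B : ℂ)⁻¹ * ∑ᶠ x : G, if x⁻¹ * g * x ∈ B then ψ (x⁻¹ * g * x) else 0

/-- The inner product `⟨f, h⟩ = |G|⁻¹ ∑_g f(g) \overline{h(g)}` of complex class
functions on a finite group. -/
def charInner {G : Type} (f h : G → ℂ) : ℂ :=
  (Nat.card G : ℂ)⁻¹ * ∑ᶠ g : G, f g * (starRingEnd ℂ) (h g)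

/-- `θ : G → ℂ` is the character of an irreducible (complex) representation of `G`. -/
def IsIrredChar (G : Type) [Group G] (θ : G → ℂ) : Prop :=
  ∃ V : FDRep ℂ G, CategoryTheory.Simple V ∧ θ = fun g => V.character g

/-- `M` is a unipotent matrix whose Jordan type is the partition `μ`, expressed through
the ranks of the powers of `M - 1`:  `rank((M-1)^k) = ∑_i max(μ_i - k, 0)` for all `k`. -/
def unipOfType {n : ℕ} {K : Type*} [Field K] (M : Matrix (Fin n) (Fin n) K)
    (mu : Partn) : Prop :=
  ∀ k : ℕ, ((M - 1) ^ k).rank = ∑ᶠ i, (mu.parts i - k)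

/-! ### Gelfand–Graev and degenerate Gelfand–Graev characters -/

/-- The sum of the superdiagonal entries `u_{i,i+1}`, `1 ≤ i ≤ ⌊n/2⌋`, `i ∉ S`,
of an element of the unitary group (in the `F'`-fixed, upper-triangular realization). -/
def sdSumU (p : ℕ) [Fact p.Prime] (fexp n : ℕ) (S : Set ℕ)
    (u : ↥(Uprime p fexp n)) : Fbar p :=
  ∑ i : Fin n, ∑ j : Fin n,
    if (j : ℕ) = (i : ℕ) + 1 ∧ (j : ℕ) ≤ n / 2 ∧ (j : ℕ) ∉ S then matOf u i j else 0

/-- The degenerate Gelfand–Graev character `Γ_{(k,ν)}` of `U(n, F_{q²})` (it depends only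
on `ν`; `k = n - 2|ν|`).  It is induced from the linear character
`u ↦ ψ₀(∑_{i ≤ ⌊n/2⌋, i ∉ ν_≤} u_{i,i+1})` of the unipotent upper-triangular subgroup,
where `ν_≤` is the set of partial sums of `ν`.  Taking `ν = ∅` gives the Gelfand–Graev
character `Γ_{(n)}`. -/
def GammaDGG (p : ℕ) [Fact p.Prime] (fexp n : ℕ) (ψ0 : Fbar p → ℂ) (nu : Partn) :
    ↥(Uprime p fexp n) → ℂ :=
  indChar (unitri (Uprime p fexp n)) (fun u => ψ0 (sdSumU p fexp n (cumSet nu) u))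

/-- The sum of all superdiagonal entries of an element of `GL(n, F_{p^r})`. -/
def sdSumGL (p : ℕ) [Fact p.Prime] (r n : ℕ) (u : ↥(GLfix p r n)) : Fbar p :=
  ∑ i : Fin n, ∑ j : Fin n, if (j : ℕ) = (i : ℕ) + 1 then matOf u i j else 0

/-- The Gelfand–Graev character of `GL(n, F_{p^r})`, induced from the generic linear
character `u ↦ ψ₀(u_{1,2} + u_{2,3} + ⋯ + u_{n-1,n})` of the unipotent upper-triangular
subgroup. -/
def GammaGL (p : ℕ) [Fact p.Prime] (r n : ℕ) (ψ0 : Fbar p → ℂ) : ↥(GLfix p r n) → ℂ :=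
  indChar (unitri (GLfix p r n)) (fun u => ψ0 (sdSumGL p r n u))

/-! ### Harish-Chandra induction from `GL(n, F_{q²})` to `U(2n, F_{q²})` -/

/-- The (maximally split) parabolic subgroup of `U(2n, F_{q²})` with Levi
`GL(n, F_{q²})`: block upper-triangular matrices. -/
def PsetGLU (p : ℕ) [Fact p.Prime] (fexp n : ℕ) : Set ↥(Uprime p fexp (2 * n)) :=
  {g | ∀ i j : Fin (2 * n), (j : ℕ) < n → n ≤ (i : ℕ) → matOf g i j = 0}

/-- Harish-Chandra induction `R_{GL(n,F_{q²})}^{U(2n,F_{q²})}` of a class function `θ` of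
`GL(n, F_{q²})`: inflate `θ` to the parabolic `P` through the Levi projection (upper-left
`n × n` block) and induce to `U(2n, F_{q²})`. -/
def HCIndGLtoU (p : ℕ) [Fact p.Prime] (fexp n : ℕ)
    (θ : ↥(GLfix p (2 * fexp) n) → ℂ) : ↥(Uprime p fexp (2 * n)) → ℂ :=
  fun g =>
    (Nat.card (PsetGLU p fexp n) : ℂ)⁻¹ *
      ∑ᶠ x : ↥(Uprime p fexp (2 * n)), ∑ᶠ l : ↥(GLfix p (2 * fexp) n),
        if x⁻¹ * g * x ∈ PsetGLU p fexp n ∧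
            (∀ i j : Fin n,
              matOf (x⁻¹ * g * x) (Fin.castLE (by omega) i) (Fin.castLE (by omega) j) =
                matOf l i j)
        then θ l else 0

noncomputable section
set_option linter.unusedSectionVars false

/-! part 1 -/
structure Ctx (K : Type) [Field K] [Fintype K] where
  σ : K →+* K
  invol : ∀ x, σ (σ x) = x
  q : ℕ
  hq : 2 ≤ q
  card : Fintype.card K = q ^ 2
  ψ : K → ℂ
  ψzero : ψ 0 = 1
  ψadd : ∀ a b, ψ (a + b) = ψ a * ψ b
  ψnt : ∃ a, σ a = a ∧ ψ a ≠ 1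
  cardFix : (Finset.univ.filter fun t : K => σ t = t).card = q
  trFib : ∀ s, σ s = s → (Finset.univ.filter fun x : K => x + σ x = s).card = q
  nmFib : ∀ s, σ s = s → s ≠ 0 → (Finset.univ.filter fun x : K => x * σ x = s).card = q + 1

theorem sum_char_zero {G : Type} [AddCommGroup G] [Fintype G] (χ : G → ℂ)
    (hadd : ∀ a b, χ (a + b) = χ a * χ b) (b : G) (hb : χ b ≠ 1) : ∑ x, χ x = 0 := by
  have h1 : ∑ x, χ (x + b) = ∑ x, χ x := Equiv.sum_comp (Equiv.addRight b) χ
  simp only [hadd] at h1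
  rw [← Finset.sum_mul] at h1
  have h2 : (∑ x, χ x) * (χ b - 1) = 0 := by linear_combination h1
  rcases mul_eq_zero.1 h2 with h | h
  · exact h
  · exact absurd (sub_eq_zero.1 h) hb

namespace Ctx
variable {K : Type} [Field K] [Fintype K] (C : Ctx K)

def Q : ℂ := -(C.q : ℂ)
def tr (x : K) : K := x + C.σ x
def nm (x : K) : K := x * C.σ x
def Fs : Finset K := Finset.univ.filter fun t => C.σ t = t ∧ t ≠ 0

theorem mem_Fs {t : K} : t ∈ C.Fs ↔ C.σ t = t ∧ t ≠ 0 := by simp [Fs]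

theorem tr_add (a b : K) : C.tr (a + b) = C.tr a + C.tr b := by simp [tr]; ring
theorem tr_zero : C.tr 0 = 0 := by simp [tr]
theorem tr_fix (a : K) : C.σ (C.tr a) = C.tr a := by simp [tr, C.invol]; ring
theorem tr_σ (a : K) : C.tr (C.σ a) = C.tr a := by simp [tr, C.invol]; ring
theorem nm_fix (a : K) : C.σ (C.nm a) = C.nm a := by simp [nm, C.invol]; ring
theorem nm_ne {a : K} (h : a ≠ 0) : C.nm a ≠ 0 := by
  simp [nm, h]

theorem tr_surj (s : K) (hs : C.σ s = s) : ∃ x, C.tr x = s := by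
  have h := C.trFib s hs
  have h2 : (Finset.univ.filter fun x : K => x + C.σ x = s).Nonempty := by
    rw [← Finset.card_pos, h]; have := C.hq; omega
  obtain ⟨x, hx⟩ := h2
  exact ⟨x, (Finset.mem_filter.1 hx).2⟩

theorem nm_surj (s : K) (hs : C.σ s = s) (h0 : s ≠ 0) : ∃ x, C.nm x = s := by
  have h := C.nmFib s hs h0
  have h2 : (Finset.univ.filter fun x : K => x * C.σ x = s).Nonempty := by
    rw [← Finset.card_pos, h]; omega
  obtain ⟨x, hx⟩ := h2
  exact ⟨x, (Finset.mem_filter.1 hx).2⟩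

theorem q_ne : (C.q : ℂ) ≠ 0 := by
  have := C.hq; exact_mod_cast (by omega : C.q ≠ 0)
theorem Q_ne : C.Q ≠ 0 := by simp [Q, C.q_ne]
theorem q_eq : (C.q : ℂ) = - C.Q := by simp [Q]
theorem Q_sq : C.Q ^ 2 = (C.q : ℂ) ^ 2 := by simp [Q]
theorem cardK : (Fintype.card K : ℂ) = C.Q ^ 2 := by rw [C.card, Q_sq]; push_cast; rfl
theorem Q2_ne_one : C.Q ^ 2 - 1 ≠ 0 := by
  rw [Q_sq, sub_ne_zero]
  have := C.hq
  have : C.q ^ 2 ≠ 1 := by nlinarith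
  exact_mod_cast this

theorem Q_pow_inj {a b : ℕ} (h : C.Q ^ a = C.Q ^ b) : a = b := by
  have h2 : ‖C.Q ^ a‖ = ‖C.Q ^ b‖ := by rw [h]
  simp only [norm_pow, Q, norm_neg, Complex.norm_natCast] at h2
  have h3 : C.q ^ a = C.q ^ b := by exact_mod_cast h2
  exact Nat.pow_right_injective C.hq h3

theorem ψsum (a : ι → K) (s : Finset ι) : C.ψ (∑ i ∈ s, a i) = ∏ i ∈ s, C.ψ (a i) := by
  induction s using Finset.induction_on with
  | empty => simp [C.ψzero]
  | insert i s hi ih => rw [Finset.sum_insert hi, Finset.prod_insert hi, C.ψadd, ih]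

/-- sum over nonzero fixed elements -/
theorem sum_Fs (c : K) (hc : C.σ c = c) :
    ∑ t ∈ C.Fs, C.ψ (t * c) = if c = 0 then (C.q : ℂ) - 1 else -1 := by
  have e : (Finset.univ.filter fun t : K => C.σ t = t) = insert 0 C.Fs := by
    ext t; simp only [Finset.mem_filter, Finset.mem_univ, true_and, Finset.mem_insert, mem_Fs]
    by_cases h : t = 0 <;> simp [h]
  have h0 : (0 : K) ∉ C.Fs := by simp [mem_Fs]
  split_ifs with h
  · subst h
    have := C.cardFix
    rw [e, Finset.card_insert_of_notMem h0] at this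
    simp [C.ψzero, ← this]
  · obtain ⟨a, ha, hna⟩ := C.ψnt
    let F : Subfield K := C.σ.eqLocusField (RingHom.id K)
    have hF : ∀ t, t ∈ F ↔ C.σ t = t := fun t => Iff.rfl
    have := sum_char_zero (G := F) (fun t => C.ψ (t * c)) (fun x y => by
      simp only [Subfield.coe_add, add_mul, C.ψadd]) ⟨a / c, by rw [hF]; simp [ha, hc]⟩
      (by simpa [div_mul_cancel₀ _ h] using hna)
    rw [← Finset.sum_subtype (Finset.univ.filter fun t : K => C.σ t = t)
      (by intro x; simp [hF]) (fun t => C.ψ (t * c)), e, Finset.sum_insert h0] at this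
    simp only [zero_mul, C.ψzero] at this
    linear_combination this

theorem sum_tr (a : K) : ∑ l : K, C.ψ (C.tr (l * a)) = if a = 0 then C.Q ^ 2 else 0 := by
  split_ifs with h
  · simp [h, tr_zero, C.ψzero, C.cardK]
  · obtain ⟨b, hb, hnb⟩ := C.ψnt
    obtain ⟨x, hx⟩ := C.tr_surj b hb
    refine sum_char_zero _ (fun x y => by rw [add_mul, tr_add, C.ψadd]) (x / a) ?_
    rwa [div_mul_cancel₀ _ h, hx]

theorem sum_all (a : K) : ∑ l : K, C.ψ (l * a) = if a = 0 then C.Q ^ 2 else 0 := by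
  split_ifs with h
  · simp [h, C.ψzero, C.cardK]
  · obtain ⟨b, hb, hnb⟩ := C.ψnt
    refine sum_char_zero _ (fun x y => by rw [add_mul, C.ψadd]) (b / a) ?_
    rwa [div_mul_cancel₀ _ h]

theorem sum_ne (f : K → ℂ) :
    ∑ l ∈ Finset.univ.filter (fun l : K => l ≠ 0), f l = ∑ l, f l - f 0 := by
  have := Finset.sum_erase_eq_sub (f := f) (Finset.mem_univ (0 : K))
  rw [← this]
  congr 1; ext; simp

theorem sum_nm (G : K → ℂ) : ∑ l ∈ Finset.univ.filter (fun l : K => l ≠ 0), G (C.nm l)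
    = (C.q + 1) * ∑ t ∈ C.Fs, G t := by
  rw [← Finset.sum_fiberwise_of_maps_to (t := C.Fs) (g := C.nm)
    (fun l hl => by rw [mem_Fs]; exact ⟨C.nm_fix l, C.nm_ne (by simpa using hl)⟩), Finset.mul_sum]
  refine Finset.sum_congr rfl fun t ht => ?_
  rw [mem_Fs] at ht
  rw [Finset.sum_congr rfl (g := fun _ => G t)
    (fun x hx => by rw [(Finset.mem_filter.1 hx).2]), Finset.sum_const, nsmul_eq_mul]
  congr 1
  rw [← Nat.cast_succ, Nat.succ_eq_add_one, ← C.nmFib t ht.1 ht.2]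
  congr 1
  refine congrArg Finset.card ?_
  ext x
  simp only [Finset.mem_filter, Finset.mem_univ, true_and]
  constructor
  · exact fun h => h.2
  · intro h; refine ⟨?_, h⟩
    rintro rfl
    simp at h; exact ht.2 h.symm

theorem sum_nmψ (c : K) (hc : C.σ c = c) :
    ∑ l : K, C.ψ (C.nm l * c) = if c = 0 then C.Q ^ 2 else C.Q := by
  split_ifs with h
  · simp [h, C.ψzero, C.cardK]
  · have h1 := sum_ne (fun l => C.ψ (C.nm l * c))
    rw [C.sum_nm (fun x => C.ψ (x * c)), C.sum_Fs c hc, if_neg h] at h1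
    simp only [nm, zero_mul, C.ψzero] at h1
    simp only [nm, Q]
    linear_combination -h1

def w (a : K) : ℂ := if a = 0 then C.Q ^ 2 - 1 else -1

theorem w_eq_all (a : K) : ∑ l ∈ Finset.univ.filter (fun l : K => l ≠ 0), C.ψ (l * a) = C.w a := by
  rw [sum_ne, C.sum_all, w]; simp only [zero_mul, C.ψzero]
  split_ifs <;> ring
theorem w_eq_tr (a : K) :
    ∑ l ∈ Finset.univ.filter (fun l : K => l ≠ 0), C.ψ (C.tr (l * a)) = C.w a := by
  rw [sum_ne, C.sum_tr, w]; simp only [zero_mul, C.tr_zero, C.ψzero]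
  split_ifs <;> ring
theorem w_smul {l : K} (hl : l ≠ 0) (a : K) : C.w (l * a) = C.w a := by
  simp [w, hl]

end Ctx
end

noncomputable section
set_option linter.unusedSectionVars false
/-! part 2 -/
structure IsHerm {K : Type} [Field K] [Fintype K] (C : Ctx K) {V : Type} [AddCommGroup V]
    [Module K V] (h : V → V → K) : Prop where
  add_left : ∀ x y z, h (x + y) z = h x z + h y z
  smul_left : ∀ (a : K) x y, h (a • x) y = a * h x y
  symm : ∀ x y, h y x = C.σ (h x y)

def SAdj {K : Type} [Field K] {V : Type} [AddCommGroup V]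
    [Module K V] (h : V → V → K) (A : V →ₗ[K] V) : Prop := ∀ x y, h (A x) y = h x (A y)

def NonDeg {K : Type} [Field K] {V : Type} [AddCommGroup V]
    [Module K V] (h : V → V → K) : Prop := ∀ x, (∀ y, h x y = 0) → x = 0

namespace IsHerm
variable {K : Type} [Field K] [Fintype K] {C : Ctx K} {V : Type} [AddCommGroup V] [Module K V]
  {h : V → V → K} (H : IsHerm C h)
include H

theorem add_right (x y z : V) : h x (y + z) = h x y + h x z := by
  rw [H.symm, H.add_left, map_add, ← H.symm, ← H.symm]
theorem smul_right (a : K) (x y : V) : h x (a • y) = C.σ a * h x y := by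
  rw [H.symm, H.smul_left, map_mul, ← H.symm]
theorem zero_left (y : V) : h 0 y = 0 := by simpa using H.smul_left 0 0 y
theorem zero_right (y : V) : h y 0 = 0 := by simpa using H.smul_right 0 y 0
theorem neg_left (x y : V) : h (-x) y = - h x y := by simpa using H.smul_left (-1) x y
theorem neg_right (x y : V) : h x (-y) = - h x y := by simpa using H.smul_right (-1) x y
theorem sub_left (x y z : V) : h (x - y) z = h x z - h y z := by
  rw [sub_eq_add_neg, H.add_left, H.neg_left, sub_eq_add_neg]
theorem sub_right (x y z : V) : h x (y - z) = h x y - h x z := by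
  rw [sub_eq_add_neg, H.add_right, H.neg_right, sub_eq_add_neg]
theorem self_fix (x : V) : C.σ (h x x) = h x x := (H.symm x x).symm
theorem sum_left {ι : Type} (s : Finset ι) (f : ι → V) (y : V) :
    h (∑ i ∈ s, f i) y = ∑ i ∈ s, h (f i) y := by
  induction s using Finset.induction_on with
  | empty => simp [H.zero_left]
  | insert i s hi ih => rw [Finset.sum_insert hi, Finset.sum_insert hi, H.add_left, ih]
theorem sum_right {ι : Type} (s : Finset ι) (f : ι → V) (y : V) :
    h y (∑ i ∈ s, f i) = ∑ i ∈ s, h y (f i) := by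
  induction s using Finset.induction_on with
  | empty => simp [H.zero_right]
  | insert i s hi ih => rw [Finset.sum_insert hi, Finset.sum_insert hi, H.add_right, ih]
theorem eq_zero_symm {x y : V} (e : h x y = 0) : h y x = 0 := by rw [H.symm, e, map_zero]

/-- `h · z` as a linear functional. -/
def lin (z : V) : V →ₗ[K] K where
  toFun x := h x z
  map_add' x y := H.add_left x y z
  map_smul' a x := H.smul_left a x z

theorem lin_apply (z x : V) : H.lin z x = h x z := rfl

theorem polar (hz : ∀ y, h y y = 0) (x y : V) : h x y = 0 := by
  by_contra hne
  obtain ⟨a, ha, hna⟩ := C.ψnt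
  have h1 : ∀ l : K, C.tr (l * h x y) = 0 := by
    intro l
    have := hz (l • x + y)
    simp only [H.add_left, H.add_right, H.smul_left, H.smul_right, hz, mul_zero, zero_add,
      add_zero] at this
    rw [Ctx.tr, map_mul, ← H.symm]
    linear_combination this
  have h2 := C.sum_tr (h x y)
  simp only [h1, C.ψzero, if_neg hne] at h2
  simp [C.cardK, C.Q_ne] at h2

end IsHerm

section
variable {K : Type} [Field K] [Fintype K] (C : Ctx K)

theorem card_pow (V : Type) [AddCommGroup V] [Module K V] [Fintype V] :
    (Fintype.card V : ℂ) = C.Q ^ (2 * Module.finrank K V) := by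
  rw [Module.card_eq_pow_finrank (K := K) (V := V), Nat.cast_pow, C.cardK, pow_mul]

theorem gauss (n : ℕ) : ∀ (V : Type) [AddCommGroup V] [Module K V] [Fintype V] (b : V → V → K),
    IsHerm C b → Module.finrank K V = n → ∀ R : Submodule K V,
    (∀ x, x ∈ R ↔ ∀ y, b x y = 0) → ∑ y, C.ψ (b y y) = C.Q ^ (n + Module.finrank K R) := by
  induction n with
  | zero =>
    intro V _ _ _ b H hn R hR
    have : Subsingleton V := Module.finrank_zero_iff.1 hn
    have hR : Module.finrank K R = 0 := Module.finrank_zero_of_subsingleton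
    rw [hR, Fintype.sum_subsingleton _ (0 : V), H.zero_left, C.ψzero]; simp
  | succ n ih =>
    intro V _ _ _ b H hn R hR
    by_cases hz : ∀ y, b y y = 0
    · have hRt : R = ⊤ := by
        rw [eq_top_iff]; intro x _; rw [hR]; exact H.polar hz x
      simp only [hz, C.ψzero, Finset.sum_const, Finset.card_univ, nsmul_eq_mul, mul_one]
      rw [card_pow C V, hRt, finrank_top, hn, two_mul]
    · push Not at hz
      obtain ⟨v, hv⟩ := hz
      set c := b v v with hc
      have hcf : C.σ c = c := H.self_fix v
      let W : Submodule K V := LinearMap.ker (H.lin v)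
      have hW : ∀ x, x ∈ W ↔ b x v = 0 := fun x => LinearMap.mem_ker
      let E : V ≃ₗ[K] K × W :=
        { toFun := fun x => (b x v / c, ⟨x - (b x v / c) • v, by
            rw [hW, H.sub_left, H.smul_left, div_mul_cancel₀ _ hv, sub_self]⟩)
          map_add' := fun x y => by
            ext1
            · simp [H.add_left, add_div]
            · ext1; simp only [H.add_left, add_div, add_smul, Prod.snd_add, Submodule.coe_add]
              abel
          map_smul' := fun a x => by
            ext1
            · simp [H.smul_left, mul_div_assoc]
            · ext1; simp [H.smul_left, mul_div_assoc, smul_sub, mul_smul]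
          invFun := fun z => z.1 • v + z.2
          left_inv := fun x => by simp
          right_inv := fun z => by
            have : b z.2 v = 0 := (hW _).1 z.2.2
            ext1
            · simp only [H.add_left, H.smul_left, this, add_zero]; exact mul_div_cancel_right₀ _ hv
            · ext1; simp only [H.add_left, H.smul_left, this, add_zero]; rw [mul_div_cancel_right₀ _ hv]; simp }
      have hE : ∀ z, E.symm z = z.1 • v + (z.2 : V) := fun z => rfl
      have hWn : Module.finrank K W = n := by
        have := E.finrank_eq
        rw [Module.finrank_prod, Module.finrank_self, hn] at this
        omega
      have key := ih W (fun x y => b x y)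
        ⟨fun x y z => H.add_left _ _ _, fun a x y => H.smul_left _ _ _, fun x y => H.symm _ _⟩ hWn
        (R.comap W.subtype) (by
          intro x
          rw [Submodule.mem_comap, hR]
          constructor
          · intro hx y; exact hx y
          · intro hx y
            have hy : E.symm (E y) = y := E.symm_apply_apply y
            rw [← hy, hE]
            simp only [H.add_right, H.smul_right, Submodule.subtype_apply]
            rw [(hW _).1 x.2, hx]; simp)
      have hle : R ≤ W := fun x hx => (hW x).2 ((hR x).1 hx v)
      rw [(Submodule.comapSubtypeEquivOfLe hle).finrank_eq] at key
      rw [← Equiv.sum_comp E.symm.toEquiv, Fintype.sum_prod_type]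
      have h2 : ∀ (l : K) (x : W), C.ψ (b (E.symm.toEquiv (l, x)) (E.symm.toEquiv (l, x)))
          = C.ψ (C.nm l * c) * C.ψ (b x x) := by
        intro l x
        have hx : b x v = 0 := (hW x).1 x.2
        rw [← C.ψadd]
        congr 1
        change b (l • v + x) (l • v + x) = _
        simp only [H.add_left, H.add_right, H.smul_left, H.smul_right, hx, H.eq_zero_symm hx,
          Ctx.nm, hc]
        ring
      simp only [h2]
      rw [← Finset.sum_mul_sum, key, C.sum_nmψ c hcf, if_neg hv]
      ring

variable {V : Type} [AddCommGroup V] [Module K V] [Fintype V] {h : V → V → K}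

theorem riesz (H : IsHerm C h) (nd : NonDeg h) (f : V →ₗ[K] K) : ∃ z, ∀ x, f x = h x z := by
  have hinj : Function.Injective (fun z => H.lin z) := by
    intro z z' e
    have : z - z' = 0 := nd _ (fun y => by
      apply H.eq_zero_symm
      rw [H.sub_right, sub_eq_zero]
      exact LinearMap.congr_fun e y)
    exact sub_eq_zero.1 this
  have : Finite (V →ₗ[K] K) := Module.finite_of_finite K
  have : Fintype (V →ₗ[K] K) := Fintype.ofFinite _
  have hb := (Fintype.bijective_iff_injective_and_card (fun z => H.lin z)).2 ⟨hinj, by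
    rw [Module.card_eq_pow_finrank (K := K) (V := V),
      Module.card_eq_pow_finrank (K := K) (V := V →ₗ[K] K)]
    congr 1
    exact (Subspace.dual_finrank_eq).symm⟩
  obtain ⟨z, hz⟩ := hb.2 f
  exact ⟨z, fun x => by rw [← hz]; rfl⟩

theorem mem_range_of_orth (H : IsHerm C h) (nd : NonDeg h) {B : V →ₗ[K] V} (hB : SAdj h B)
    (v : V) (hv : ∀ z, B z = 0 → h z v = 0) : ∃ w, B w = v := by
  by_contra hne
  have hv' : v ∉ LinearMap.range B := by simpa using hne
  obtain ⟨f, hf, hf2⟩ := Submodule.exists_le_ker_of_notMem hv'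
  obtain ⟨z, hz⟩ := riesz C H nd f
  have hBz : B z = 0 := by
    apply nd
    intro x
    apply H.eq_zero_symm
    rw [← hB, ← hz]
    exact hf2 (LinearMap.mem_range_self B x)
  exact hf (by rw [hz]; exact H.eq_zero_symm (hv z hBz))

def ES (h : V → V → K) (B : V →ₗ[K] V) (t : K) (v : V) : ℂ :=
  ∑ y, C.ψ (t * h (B y) y + C.tr (h y v))

theorem ES_zero (H : IsHerm C h) (nd : NonDeg h) {B : V →ₗ[K] V} (hB : SAdj h B)
    {t : K} (ht : t ∈ C.Fs) :
    ES C h B t 0 = C.Q ^ (Module.finrank K V + Module.finrank K (LinearMap.ker B)) := by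
  rw [C.mem_Fs] at ht
  rw [← gauss C _ V (fun x y => t * h (B x) y) ⟨fun x y z => by simp [H.add_left, mul_add],
    fun a x y => by simp [H.smul_left]; ring, fun x y => by
      simp only [map_mul, ht.1]; rw [hB, ← H.symm]⟩ rfl (LinearMap.ker B) (by
      intro x
      rw [LinearMap.mem_ker]
      constructor
      · intro e y; simp [e, H.zero_left]
      · intro e; exact nd _ (fun y => (mul_eq_zero.1 (e y)).resolve_left ht.2))]
  simp [ES, H.zero_right, C.tr_zero]

theorem ES_range (H : IsHerm C h) {B : V →ₗ[K] V} (hB : SAdj h B)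
    {t : K} (ht : t ∈ C.Fs) {v w : V} (hw : B w = v) :
    ES C h B t v = C.ψ (- (t⁻¹ * h w v)) * ES C h B t 0 := by
  rw [C.mem_Fs] at ht
  rw [ES, ES, Finset.mul_sum, ← Equiv.sum_comp (Equiv.subRight (t⁻¹ • w))]
  refine Finset.sum_congr rfl fun y _ => ?_
  rw [← C.ψadd]
  congr 1
  have e1 : h (B y) w = h y v := by rw [hB, hw]
  have e2 : h v y = C.σ (h y v) := H.symm _ _
  have e3 : h v w = h w v := by rw [← hw, hB]
  have e4 : C.σ (h w v) = h w v := by rw [← H.symm, e3]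
  simp only [Equiv.subRight_apply, map_sub, map_smul, H.sub_left, H.sub_right, H.smul_left,
    H.smul_right, H.zero_right, Ctx.tr, hw, e1, e2, e3, map_mul, map_inv₀, ht.1, e4, map_zero]
  have := ht.2
  field_simp
  ring

theorem ES_not_range (H : IsHerm C h) (nd : NonDeg h) {B : V →ₗ[K] V} (hB : SAdj h B)
    {t : K} {v : V} (hv : ¬ ∃ w, B w = v) : ES C h B t v = 0 := by
  have : ∃ z, B z = 0 ∧ h z v ≠ 0 := by
    by_contra hne
    push Not at hne
    exact hv (mem_range_of_orth C H nd hB v hne)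
  obtain ⟨z, hz, hzv⟩ := this
  obtain ⟨a, ha, hna⟩ := C.ψnt
  obtain ⟨x, hx⟩ := C.tr_surj a ha
  have h1 : ES C h B t v = ES C h B t v * C.ψ a := by
    conv_lhs => rw [ES, ← Equiv.sum_comp (Equiv.addRight ((x / h z v) • z))]
    rw [ES, Finset.sum_mul]
    refine Finset.sum_congr rfl fun y _ => ?_
    rw [← C.ψadd]
    congr 1
    have e : h (B y) z = 0 := by rw [hB, hz, H.zero_right]
    simp only [Equiv.coe_addRight, map_add, map_smul, hz, smul_zero, add_zero, H.add_right,
      H.add_left, H.smul_right, e, mul_zero, H.smul_left, div_mul_cancel₀ _ hzv, C.tr_add, hx]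
    ring
  have h2 : ES C h B t v * (C.ψ a - 1) = 0 := by linear_combination -h1
  exact (mul_eq_zero.1 h2).resolve_right (sub_ne_zero.2 hna)

omit [Fintype K] [Fintype V] in
theorem SAdj.pow {A : V →ₗ[K] V} (hA : SAdj h A) (i : ℕ) : SAdj h (A ^ i) := by
  induction i with
  | zero => intro x y; simp
  | succ i ih => intro x y; rw [pow_succ, Module.End.mul_apply, ih, hA, ← Module.End.mul_apply, ← pow_succ']; rw [pow_succ]

/-- the sums `S_i(A, v)` -/
def SS (h : V → V → K) (A : V →ₗ[K] V) (i : ℕ) (v : V) : ℂ := ∑ t ∈ C.Fs, ES C h (A ^ i) t v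

theorem card_Fs : (C.Fs.card : ℂ) = C.q - 1 := by
  have := C.sum_Fs 0 (map_zero _)
  simpa [C.ψzero] using this

theorem sum_Fs_inv (c : K) (hc : C.σ c = c) :
    ∑ t ∈ C.Fs, C.ψ (-(t⁻¹ * c)) = if c = 0 then (C.q : ℂ) - 1 else -1 := by
  have := C.sum_Fs (-c) (by rw [map_neg, hc])
  simp only [neg_eq_zero] at this
  rw [← this]
  refine Finset.sum_nbij' (fun t => t⁻¹) (fun t => t⁻¹) ?_ ?_ ?_ ?_ ?_
  · intro t ht; rw [C.mem_Fs] at *; simpa using ht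
  · intro t ht; rw [C.mem_Fs] at *; simpa using ht
  · intro t _; simp
  · intro t _; simp
  · intro t _; simp

theorem SS_range (H : IsHerm C h) (nd : NonDeg h) {A : V →ₗ[K] V} (hA : SAdj h A) (i : ℕ)
    {v w : V} (hw : (A ^ i) w = v) : SS C h A i v = (if h w v = 0 then (C.q : ℂ) - 1 else -1) *
      C.Q ^ (Module.finrank K V + Module.finrank K (LinearMap.ker (A ^ i))) := by
  have e3 : h v w = h w v := by rw [← hw, hA.pow]
  rw [← sum_Fs_inv C (h w v) (by rw [← H.symm, e3]), Finset.sum_mul, SS]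
  refine Finset.sum_congr rfl fun t ht => ?_
  rw [ES_range C H (hA.pow i) ht hw, ES_zero C H nd (hA.pow i) ht]

theorem SS_not_range (H : IsHerm C h) (nd : NonDeg h) {A : V →ₗ[K] V} (hA : SAdj h A) (i : ℕ)
    {v : V} (hv : ¬ ∃ w, (A ^ i) w = v) : SS C h A i v = 0 :=
  Finset.sum_eq_zero fun _ _ => ES_not_range C H nd (hA.pow i) hv

def kerF (A : V →ₗ[K] V) : Finset V := Finset.univ.filter (fun u => A u = 0)
def kerS (A : V →ₗ[K] V) : Finset V := Finset.univ.filter (fun u => A u = 0 ∧ u ≠ 0)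
omit [Fintype K] in
theorem mem_kerF {A : V →ₗ[K] V} {u : V} : u ∈ kerF A ↔ A u = 0 := by simp [kerF]
omit [Fintype K] in
theorem mem_kerS {A : V →ₗ[K] V} {u : V} : u ∈ kerS A ↔ A u = 0 ∧ u ≠ 0 := by simp [kerS]

/-- L4 -/
theorem SS_sum_ker (H : IsHerm C h) (nd : NonDeg h) {A : V →ₗ[K] V} (hA : SAdj h A) (i : ℕ)
    (a : V) : ∑ u ∈ kerF A, C.ψ (C.tr (h u a)) * SS C h A i u
    = ∑ t ∈ C.Fs, ∑ x, C.ψ (t * h ((A ^ i) (A x - a)) (A x - a)) := by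
  have h1 : ∀ y, ∑ u ∈ kerF A, C.ψ (C.tr (h u (y + a)))
      = ∑ x, if A x - a = y then 1 else 0 := by
    intro y
    by_cases hy : ∃ w, A w = y + a
    · obtain ⟨w, hw⟩ := hy
      rw [Finset.sum_congr rfl (g := fun _ => (1 : ℂ)) (fun u hu => by
        rw [← hw, ← hA, mem_kerF.1 hu, H.zero_left, C.tr_zero, C.ψzero])]
      rw [← Finset.sum_filter, Finset.sum_const, Finset.sum_const]
      congr 1
      refine Finset.card_bij' (fun u _ => u + w) (fun x _ => x - w) ?_ ?_ ?_ ?_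
      · intro u hu; simp only [mem_kerF, Finset.mem_filter, Finset.mem_univ, true_and] at *
        rw [map_add, hu, hw]; abel
      · intro x hu; simp only [mem_kerF, Finset.mem_filter, Finset.mem_univ, true_and] at *
        rw [map_sub, hw, ← hu]; abel
      · intro u _; abel
      · intro u _; abel
    · rw [Finset.sum_eq_zero (f := fun x => if A x - a = y then (1 : ℂ) else 0)
        (fun x _ => if_neg (fun e => hy ⟨x, by rw [← e]; abel⟩))]
      have : ∃ z, A z = 0 ∧ h z (y + a) ≠ 0 := by
        by_contra hne
        push Not at hne
        exact hy (mem_range_of_orth C H nd hA _ hne)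
      obtain ⟨z, hz, hzv⟩ := this
      obtain ⟨b, hb, hnb⟩ := C.ψnt
      obtain ⟨x, hx⟩ := C.tr_surj b hb
      rw [Finset.sum_subtype (p := fun u => u ∈ LinearMap.ker A) _ (by intro u; simp [mem_kerF])]
      refine sum_char_zero (G := LinearMap.ker A) _ (fun u u' => by
        rw [Submodule.coe_add, H.add_left, C.tr_add, C.ψadd]) ⟨(x / h z (y + a)) • z, by
          simp [hz]⟩ ?_
      rwa [H.smul_left, div_mul_cancel₀ _ hzv, hx]
  simp only [SS, ES, Finset.mul_sum]
  rw [Finset.sum_comm]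
  refine Finset.sum_congr rfl fun t _ => ?_
  rw [Finset.sum_comm]
  have h2 : ∀ y, ∑ u ∈ kerF A,
      C.ψ (C.tr (h u a)) * C.ψ (t * h ((A ^ i) y) y + C.tr (h y u))
      = ∑ x, if A x - a = y then C.ψ (t * h ((A ^ i) y) y) else 0 := by
    intro y
    have : ∀ x, (if A x - a = y then C.ψ (t * h ((A ^ i) y) y) else 0)
      = C.ψ (t * h ((A ^ i) y) y) * (if A x - a = y then 1 else 0) := by
      intro x; split_ifs <;> simp
    simp only [this]
    rw [← Finset.mul_sum, ← h1, Finset.mul_sum]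
    refine Finset.sum_congr rfl fun u _ => ?_
    rw [H.add_right, C.tr_add, C.ψadd, C.ψadd, ← C.tr_σ (h u y), ← H.symm]
    ring
  simp only [h2]
  rw [Finset.sum_comm]
  simp

theorem SS_sum_ker0 (H : IsHerm C h) (nd : NonDeg h) {A : V →ₗ[K] V} (hA : SAdj h A) (i : ℕ) :
    ∑ u ∈ kerF A, SS C h A i u = SS C h A (i + 2) 0 := by
  have := SS_sum_ker C H nd hA i 0
  simp only [H.zero_right, C.tr_zero, C.ψzero, one_mul, sub_zero] at this
  rw [this, SS]
  refine Finset.sum_congr rfl fun t _ => ?_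
  rw [ES]
  refine Finset.sum_congr rfl fun y _ => ?_
  rw [H.zero_right, C.tr_zero, add_zero, ← hA, pow_succ', pow_succ]; rfl

end
end

noncomputable section
set_option linter.unusedSectionVars false
/-! part 3 -/
section
variable {K : Type} [Field K] [Fintype K] (C : Ctx K)
variable {V : Type} [AddCommGroup V] [Module K V] [Fintype V] {h : V → V → K}

def eta (h : V → V → K) (A : V →ₗ[K] V) (M : ℕ) (v : V) : ℂ :=
  - C.Q⁻¹ - (C.Q ^ (Module.finrank K V + 1))⁻¹ * ∑ i ∈ Finset.range M, (-1) ^ i * SS C h A i v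

theorem eta_succ (H : IsHerm C h) (nd : NonDeg h) {A : V →ₗ[K] V} (hA : SAdj h A) {M : ℕ}
    (hM : A ^ M = 0) {v : V} (hv : v ≠ 0) : eta C h A (M + 1) v = eta C h A M v := by
  rw [eta, eta, Finset.sum_range_succ, SS_not_range C H nd hA M (v := v)]
  · simp
  · rintro ⟨w, hw⟩; rw [hM] at hw; exact hv hw.symm

theorem finrank_ker_pow_zero (A : V →ₗ[K] V) :
    Module.finrank K (LinearMap.ker (A ^ 0)) = 0 := by
  rw [pow_zero, Module.End.one_eq_id, LinearMap.ker_id, finrank_bot]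

theorem SS_zero_idx (H : IsHerm C h) (nd : NonDeg h) {A : V →ₗ[K] V} (hA : SAdj h A) (v : V) :
    SS C h A 0 v = (if h v v = 0 then (C.q : ℂ) - 1 else -1) * C.Q ^ (Module.finrank K V) := by
  rw [SS_range C H nd hA 0 (w := v) (by simp), finrank_ker_pow_zero]; rfl

theorem eta_not_range (H : IsHerm C h) (nd : NonDeg h) {A : V →ₗ[K] V} (hA : SAdj h A) (M : ℕ)
    {v : V} (hv : ¬ ∃ w, A w = v) : eta C h A (M + 1) v = if h v v = 0 then 1 else 0 := by
  rw [eta, Finset.sum_range_succ', SS_zero_idx C H nd hA, Finset.sum_eq_zero]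
  · have := C.Q_ne
    rw [C.q_eq]
    split_ifs <;> field_simp <;> ring
  · intro i _
    rw [SS_not_range C H nd hA, mul_zero]
    rintro ⟨w, hw⟩
    rw [pow_succ'] at hw
    exact hv ⟨_, hw⟩

theorem eta_range_ne (H : IsHerm C h) (nd : NonDeg h) {A : V →ₗ[K] V} (hA : SAdj h A) (M : ℕ)
    {v w : V} (hw : A w = v) (hv : A v = 0) (hne : h w v ≠ 0) : eta C h A (M + 2) v =
    1 - C.Q⁻¹ * C.Q ^ (Module.finrank K (LinearMap.ker A)) := by
  have hvv : h v v = 0 := by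
    nth_rewrite 1 [← hw]; rw [hA, hv, H.zero_right]
  rw [eta, Finset.sum_range_succ', Finset.sum_range_succ', SS_zero_idx C H nd hA,
    SS_range C H nd hA (0 + 1) (w := w) (by simpa using hw), if_pos hvv, if_neg hne,
    Finset.sum_eq_zero]
  · have := C.Q_ne
    rw [C.q_eq]
    rw [show A ^ (0 + 1) = A by simp]
    simp only [pow_add]
    field_simp
    ring
  · intro i _
    rw [SS_not_range C H nd hA, mul_zero]
    rintro ⟨u, hu⟩
    rw [pow_succ', pow_succ'] at hu
    apply hne
    set x := (A ^ i) u
    have hu : A (A x) = v := hu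
    have h1 : A (w - A x) = 0 := by rw [map_sub, hu, hw, sub_self]
    have h2 : h w v = h (w - A x) v + h (A x) v := by rw [H.sub_left]; ring
    rw [h2]
    nth_rewrite 1 [← hw]
    rw [← hA, h1, H.zero_left, hA, hv, H.zero_right, add_zero]

theorem sum_ker_ne (A : V →ₗ[K] V) (G : V → ℂ) :
    ∑ v ∈ kerS A, G v
      = ∑ v ∈ kerF A, G v - G 0 := by
  rw [← Finset.sum_erase_eq_sub (by simp [mem_kerF])]
  congr 1; ext; simp [and_comm, mem_kerF, mem_kerS]

theorem card_ker (A : V →ₗ[K] V) : ((kerF A).card : ℂ)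
    = C.Q ^ (2 * Module.finrank K (LinearMap.ker A)) := by
  rw [← card_pow C (LinearMap.ker A), Fintype.card_subtype]
  congr 2

theorem telescope (S : ℕ → ℂ) (M : ℕ) : ∑ i ∈ Finset.range M, (-1 : ℂ) ^ i * (S (i + 2) - S i)
    = S 1 - S 0 + (-1) ^ M * (S M - S (M + 1)) := by
  induction M with
  | zero => simp
  | succ M ih => rw [Finset.sum_range_succ, ih]; ring

theorem SS_pow_zero {A : V →ₗ[K] V} {M : ℕ} (hM : A ^ M = 0) (v : V) :
    SS C h A M v = SS C h A (M + 1) v := by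
  rw [SS, SS, pow_succ, hM, zero_mul]

theorem SS00 (H : IsHerm C h) (nd : NonDeg h) {A : V →ₗ[K] V} (hA : SAdj h A) :
    SS C h A 0 0 = ((C.q : ℂ) - 1) * C.Q ^ (Module.finrank K V) := by
  rw [SS_zero_idx C H nd hA, if_pos (H.zero_left _)]

theorem SS10 (H : IsHerm C h) (nd : NonDeg h) {A : V →ₗ[K] V} (hA : SAdj h A) :
    SS C h A 1 0 = ((C.q : ℂ) - 1) *
      C.Q ^ (Module.finrank K V + Module.finrank K (LinearMap.ker A)) := by
  rw [SS_range C H nd hA 1 (w := 0) (by simp), if_pos (H.zero_left _), pow_one]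

theorem eta_sum (H : IsHerm C h) (nd : NonDeg h) {A : V →ₗ[K] V} (hA : SAdj h A) {M : ℕ}
    (hM : A ^ M = 0) :
    ∑ v ∈ kerS A, eta C h A M v =
    - (1 - C.Q⁻¹ * C.Q ^ (Module.finrank K (LinearMap.ker A))) *
      (1 - C.Q ^ (Module.finrank K (LinearMap.ker A))) := by
  have h1 := telescope (fun i => SS C h A i 0) M
  simp only [SS_pow_zero C hM, sub_self, mul_zero, add_zero, SS00 C H nd hA, SS10 C H nd hA] at h1
  rw [sum_ker_ne]
  simp only [eta, Finset.sum_sub_distrib, Finset.sum_const, nsmul_eq_mul, card_ker C,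
    ← Finset.mul_sum]
  rw [Finset.sum_comm]
  simp only [← Finset.mul_sum, SS_sum_ker0 C H nd hA]
  have h2 : ∑ i ∈ Finset.range M, (-1 : ℂ) ^ i * SS C h A (i + 2) 0
    = ∑ i ∈ Finset.range M, (-1 : ℂ) ^ i * SS C h A i 0 + (((C.q : ℂ) - 1) *
      C.Q ^ (Module.finrank K V + Module.finrank K (LinearMap.ker A)) -
      ((C.q : ℂ) - 1) * C.Q ^ (Module.finrank K V)) := by
    rw [← h1, ← Finset.sum_add_distrib]
    exact Finset.sum_congr rfl fun i _ => by ring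
  rw [h2, C.q_eq]
  have := C.Q_ne
  simp only [pow_add, two_mul]
  field_simp
  ring

/-! hyperbolic splitting -/
structure HS (h : V → V → K) (A : V →ₗ[K] V) (v v' : V) : Prop where
  H : IsHerm C h
  nd : NonDeg h
  sa : SAdj h A
  Av : A v = 0
  vv : h v v = 0
  v'v : h v' v = 1
  v'v' : h v' v' = 0

namespace HS
variable {C} {A : V →ₗ[K] V} {v v' : V} (S : HS C h A v v')
include S

theorem vv' : h v v' = 1 := by rw [S.H.symm, S.v'v, map_one]
theorem ne : v ≠ 0 := by
  rintro rfl; simpa [S.H.zero_right] using S.v'v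

def W : Submodule K V := LinearMap.ker (S.H.lin v) ⊓ LinearMap.ker (S.H.lin v')
theorem mem_W {x : V} : x ∈ S.W ↔ h x v = 0 ∧ h x v' = 0 := Iff.rfl
theorem Wv (x : S.W) : h x v = 0 := (S.mem_W.1 x.2).1
theorem Wv' (x : S.W) : h x v' = 0 := (S.mem_W.1 x.2).2
theorem vW (x : S.W) : h v x = 0 := S.H.eq_zero_symm (S.Wv x)
theorem v'W (x : S.W) : h v' x = 0 := S.H.eq_zero_symm (S.Wv' x)

def E : V ≃ₗ[K] (K × K) × S.W where
  toFun x := ((h x v, h x v'), ⟨x - h x v • v' - h x v' • v, by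
    rw [S.mem_W]; simp [S.H.sub_left, S.H.smul_left, S.vv, S.v'v, S.v'v', S.vv']⟩)
  map_add' x y := by
    ext1
    · simp [S.H.add_left]
    · ext1; simp only [S.H.add_left, add_smul, Prod.snd_add, Submodule.coe_add]; abel
  map_smul' a x := by
    ext1
    · simp [S.H.smul_left]
    · ext1; simp [S.H.smul_left, smul_sub, mul_smul]
  invFun z := z.1.1 • v' + z.1.2 • v + z.2
  left_inv x := by simp
  right_inv z := by
    ext1
    · ext1 <;>
      simp [S.H.add_left, S.H.smul_left, S.vv, S.v'v, S.v'v', S.vv', S.Wv, S.Wv']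
    · ext1
      simp only [S.H.add_left, S.H.smul_left, S.vv, S.v'v, S.v'v', S.vv', S.Wv, S.Wv', mul_zero,
        mul_one, add_zero, zero_add]
      abel

theorem E_symm (a b : K) (x : S.W) : S.E.symm.toEquiv ((a, b), x) = a • v' + b • v + x := rfl
theorem exists_split (y : V) : ∃ (a b : K) (x : S.W), y = a • v' + b • v + x :=
  ⟨(S.E y).1.1, (S.E y).1.2, (S.E y).2, (S.E.symm_apply_apply y).symm⟩

theorem finrank_W : Module.finrank K V = Module.finrank K S.W + 2 := by
  rw [S.E.finrank_eq]; simp; ring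

def h1 : S.W → S.W → K := fun x y => h x y
theorem h1_def (x y : S.W) : S.h1 x y = h x y := rfl

theorem H1 : IsHerm C S.h1 :=
  ⟨fun _ _ _ => S.H.add_left _ _ _, fun _ _ _ => S.H.smul_left _ _ _, fun _ _ => S.H.symm _ _⟩

theorem nd1 : NonDeg S.h1 := by
  intro x hx
  ext1
  apply S.nd
  intro y
  obtain ⟨a, b, z, rfl⟩ := S.exists_split y
  have : h x z = 0 := hx z
  simp [S.H.add_right, S.H.smul_right, S.Wv, S.Wv', this]

def PA : V →ₗ[K] S.W where
  toFun x := ⟨A x - h (A x) v' • v, by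
    rw [S.mem_W]
    simp [S.H.sub_left, S.H.smul_left, S.vv, S.vv', S.sa x v, S.Av, S.H.zero_right]⟩
  map_add' x y := by
    ext1; simp only [map_add, S.H.add_left, add_smul, Submodule.coe_add]; abel
  map_smul' a x := by
    ext1; simp [S.H.smul_left, smul_sub, mul_smul]

theorem PA_apply (x : V) : (S.PA x : V) = A x - h (A x) v' • v := rfl
def A1 : S.W →ₗ[K] S.W := S.PA ∘ₗ S.W.subtype
theorem A1_apply (x : S.W) : (S.A1 x : V) = A x - h (A x) v' • v := rfl
def a1 : S.W := S.PA v'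
theorem a1_def : (S.a1 : V) = A v' - h (A v') v' • v := rfl
theorem A_eq (x : S.W) : A x = S.A1 x + h (A x) v' • v := by rw [A1_apply]; abel
theorem Av'_eq : A v' = S.a1 + h (A v') v' • v := by rw [a1_def]; abel
theorem phi_eq (x : S.W) : h (A x) v' = S.h1 x S.a1 := by
  rw [S.sa, S.Av'_eq, S.H.add_right, S.H.smul_right, S.Wv]; simp [h1_def]

theorem sa1 : SAdj S.h1 S.A1 := by
  intro x y
  simp only [h1_def, A1_apply, S.H.sub_left, S.H.sub_right, S.H.smul_left, S.H.smul_right,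
    S.vW, S.Wv, mul_zero, sub_zero, S.sa x.1 y.1]

theorem A_pow (i : ℕ) (x : S.W) (c : K) :
    ∃ c' : K, (A ^ i) (x + c • v) = ((S.A1 ^ i) x : S.W) + c' • v := by
  induction i with
  | zero => exact ⟨c, by simp⟩
  | succ i ih =>
    obtain ⟨c', hc⟩ := ih
    refine ⟨h (A ((S.A1 ^ i) x : S.W)) v', ?_⟩
    rw [pow_succ', Module.End.mul_apply, hc, map_add, map_smul, S.Av, smul_zero, add_zero,
      pow_succ', Module.End.mul_apply, A1_apply]
    abel

theorem h_pow (i : ℕ) (x : S.W) (c : K) :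
    h ((A ^ i) (x + c • v)) (x + c • v) = S.h1 ((S.A1 ^ i) x) x := by
  obtain ⟨c', hc⟩ := S.A_pow i x c
  rw [hc]
  simp [S.H.add_left, S.H.add_right, S.H.smul_left, S.H.smul_right, S.vv, S.vW, S.Wv, h1_def]

theorem nil1 {M : ℕ} (hM : A ^ M = 0) : S.A1 ^ M = 0 := by
  ext x
  obtain ⟨c', hc⟩ := S.A_pow M x 0
  rw [hM] at hc
  have h2 : h ((0 : V)) v' = h (((S.A1 ^ M) x : S.W) + c' • v) v' := by rw [← hc]; simp
  rw [S.H.zero_left, S.H.add_left, S.Wv', S.H.smul_left, S.vv'] at h2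
  have : c' = 0 := by simpa using h2.symm
  rw [this] at hc
  simpa using hc.symm

def PP (i : ℕ) (a : K) : ℂ := ∑ t ∈ C.Fs, ∑ x : S.W,
  C.ψ (t * S.h1 ((S.A1 ^ i) (S.A1 x + a • S.a1)) (S.A1 x + a • S.a1))

theorem A_split (a b : K) (x : S.W) : ∃ c : K,
    A (a • v' + b • v + x) = ((S.A1 x + a • S.a1 : S.W) : V) + c • v := by
  refine ⟨a * h (A v') v' + h (A x) v', ?_⟩
  rw [map_add, map_add, map_smul, map_smul, S.Av, smul_zero, add_zero, S.A_eq x]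
  conv_lhs => rw [S.Av'_eq]
  simp only [Submodule.coe_add, Submodule.coe_smul, smul_add, add_smul, mul_smul]
  rw [← S.A_eq x, A1_apply]
  abel

theorem SS_split (i : ℕ) : SS C h A (i + 2) v = C.Q ^ 2 * ∑ a, C.ψ (C.tr a) * S.PP i a := by
  have e : ∀ t : K, ES C h (A ^ (i + 2)) t v = C.Q ^ 2 * ∑ a, C.ψ (C.tr a) * ∑ x : S.W,
      C.ψ (t * S.h1 ((S.A1 ^ i) (S.A1 x + a • S.a1)) (S.A1 x + a • S.a1)) := by
    intro t
    rw [ES, ← Equiv.sum_comp S.E.symm.toEquiv, Fintype.sum_prod_type, Fintype.sum_prod_type,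
      Finset.mul_sum]
    refine Finset.sum_congr rfl fun a _ => ?_
    rw [← C.cardK, Finset.mul_sum, Finset.mul_sum, Finset.sum_comm]
    refine Finset.sum_congr rfl fun x _ => ?_
    rw [Finset.sum_congr rfl (g := fun _ => C.ψ (C.tr a) *
      C.ψ (t * S.h1 ((S.A1 ^ i) (S.A1 x + a • S.a1)) (S.A1 x + a • S.a1)))]
    · simp [Finset.card_univ]
    intro b _
    rw [S.E_symm, ← C.ψadd, add_comm]
    congr 2
    · congr 1
      simp [S.H.add_left, S.H.smul_left, S.vv, S.v'v, S.Wv]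
    · congr 1
      rw [pow_succ', pow_succ, Module.End.mul_apply, Module.End.mul_apply, S.sa]
      obtain ⟨c, hc⟩ := S.A_split a b x
      rw [hc, S.h_pow]
  rw [SS, Finset.sum_congr rfl (fun t _ => e t), ← Finset.mul_sum, Finset.sum_comm]
  simp only [PP, Finset.mul_sum]

theorem PP_zero (i : ℕ) : S.PP i 0 = SS C S.h1 S.A1 (i + 2) 0 := by
  rw [PP, SS]
  refine Finset.sum_congr rfl fun t _ => ?_
  rw [ES]
  refine Finset.sum_congr rfl fun x _ => ?_
  rw [zero_smul, add_zero, S.H1.zero_right, C.tr_zero, add_zero, ← S.sa1, pow_succ', pow_succ]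
  rfl

theorem PP_ne (i : ℕ) {a : K} (ha : a ≠ 0) : S.PP i a = S.PP i 1 := by
  have hn := C.nm_ne ha
  have hnf := C.nm_fix a
  rw [PP, PP]
  refine Finset.sum_nbij' (fun t => t * C.nm a) (fun t => t / C.nm a) ?_ ?_ ?_ ?_ ?_
  · intro t ht; rw [C.mem_Fs] at *; simp [ht, hn, hnf]
  · intro t ht; rw [C.mem_Fs] at *; simp [ht, hn, hnf]
  · intro t _; field_simp
  · intro t _; field_simp
  intro t _
  rw [← Equiv.sum_comp (LinearEquiv.smulOfNeZero K S.W a ha).toEquiv]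
  refine Finset.sum_congr rfl fun x _ => ?_
  congr 1
  change t * S.h1 ((S.A1 ^ i) (S.A1 (a • x) + a • S.a1)) (S.A1 (a • x) + a • S.a1) = _
  rw [map_smul, ← smul_add, map_smul, S.H1.smul_left, S.H1.smul_right, one_smul, Ctx.nm]
  ring

theorem SS_split' (i : ℕ) :
    SS C h A (i + 2) v = C.Q ^ 2 * (SS C S.h1 S.A1 (i + 2) 0 - S.PP i 1) := by
  rw [S.SS_split]
  congr 1
  have h1 := Ctx.sum_ne (fun a => C.ψ (C.tr a) * S.PP i a)
  rw [Finset.sum_congr rfl (g := fun a => C.ψ (C.tr (a * 1)) * S.PP i 1) (by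
    intro a ha; rw [S.PP_ne i (by simpa using ha), mul_one]), ← Finset.sum_mul, C.w_eq_tr] at h1
  simp only [Ctx.w, C.tr_zero, C.ψzero, S.PP_zero] at h1
  simp only [one_ne_zero, if_false] at h1
  linear_combination -h1

theorem SS1_sum (i : ℕ) {l : K} (hl : l ≠ 0) :
    ∑ u ∈ kerF S.A1,
      C.ψ (C.tr (l * S.h1 u S.a1)) * SS C S.h1 S.A1 i u = S.PP i 1 := by
  have := SS_sum_ker C S.H1 S.nd1 S.sa1 i (C.σ l • S.a1)
  simp only [S.H1.smul_right, C.invol] at this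
  rw [this, ← S.PP_ne i (a := - C.σ l) (by simpa using hl), PP]
  simp only [neg_smul, sub_eq_add_neg]

/-- Gauss sum in the split form -/
theorem gauss_split : C.Q ^ (Module.finrank K V + Module.finrank K (LinearMap.ker A))
    = C.Q ^ 2 * ∑ a, C.ψ (C.nm a * h (A v') v') * ES C S.h1 S.A1 1 (a • S.a1) := by
  rw [← ES_zero C S.H S.nd S.sa (t := 1) (by simp [C.mem_Fs]), ES,
    ← Equiv.sum_comp S.E.symm.toEquiv, Fintype.sum_prod_type, Fintype.sum_prod_type,
    Finset.mul_sum]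
  refine Finset.sum_congr rfl fun a _ => ?_
  rw [ES, ← C.cardK, Finset.mul_sum, Finset.mul_sum, Finset.sum_comm]
  refine Finset.sum_congr rfl fun x _ => ?_
  rw [← C.ψadd]
  rw [Finset.sum_congr rfl (g := fun _ =>
    C.ψ (C.nm a * h (A v') v' + (1 * S.h1 (S.A1 x) x + C.tr (S.h1 x (a • S.a1)))))]
  · simp [Finset.card_univ]
  intro b _
  rw [S.E_symm]
  congr 1
  rw [S.H.zero_right, C.tr_zero, Ctx.tr, Ctx.nm, ← S.H1.symm]
  have e0 : h (A v') v = 0 := by rw [S.sa, S.Av, S.H.zero_right]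
  have e1 : h (A x) v = 0 := by rw [S.sa, S.Av, S.H.zero_right]
  have e2 : h (A v') x = S.h1 S.a1 x := by
    rw [S.Av'_eq, S.H.add_left, S.H.smul_left, S.vW]; simp [h1_def]
  have e3 : h (A x) x = S.h1 (S.A1 x) x := by
    rw [S.A_eq, S.H.add_left, S.H.smul_left, S.vW]; simp [h1_def]
  simp only [map_add, map_smul, S.Av, smul_zero, add_zero, S.H.add_left, S.H.add_right,
    S.H.smul_left, S.H.smul_right, S.H1.smul_left, S.H1.smul_right, e0, e1, e2, e3, S.phi_eq]
  ring

/-- dimension of kernels and eta, case 1 -/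
theorem case1 {x0 : S.W} (hx : S.A1 x0 = S.a1) (M : ℕ) :
    (Module.finrank K (LinearMap.ker A) = Module.finrank K (LinearMap.ker S.A1) + 2 ∧
      eta C h A (M + 2) v = 1 ∧ h (A v') v' = S.h1 x0 S.a1) ∨
    (Module.finrank K (LinearMap.ker A) = Module.finrank K (LinearMap.ker S.A1) + 1 ∧
      eta C h A (M + 2) v = 1 - C.Q⁻¹ * C.Q ^ (Module.finrank K (LinearMap.ker A)) ∧
      h (A v') v' ≠ S.h1 x0 S.a1) := by
  have hg := S.gauss_split
  have one_mem : (1 : K) ∈ C.Fs := by simp [C.mem_Fs]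
  have f1 : C.σ (h (A v') v') = h (A v') v' := by rw [← S.H.symm, S.sa]
  have f2 : C.σ (S.h1 x0 S.a1) = S.h1 x0 S.a1 := by rw [← S.H1.symm, ← hx, S.sa1]
  have e : ∀ a, C.ψ (C.nm a * h (A v') v') * ES C S.h1 S.A1 1 (a • S.a1)
      = C.ψ (C.nm a * (h (A v') v' - S.h1 x0 S.a1)) *
        C.Q ^ (Module.finrank K S.W + Module.finrank K (LinearMap.ker S.A1)) := by
    intro a
    rw [ES_range C S.H1 S.sa1 one_mem (w := a • x0) (by rw [map_smul, hx]),
      ES_zero C S.H1 S.nd1 S.sa1 one_mem, ← mul_assoc, ← C.ψadd]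
    congr 2
    rw [S.H1.smul_left, S.H1.smul_right, Ctx.nm, inv_one]; ring
  simp only [e] at hg
  rw [← Finset.sum_mul, C.sum_nmψ _ (by rw [map_sub, f1, f2]), S.finrank_W] at hg
  have hphi : ∀ x : S.W, ∀ a : K, S.A1 x + a • S.a1 = 0 → S.h1 x S.a1 = - a * S.h1 x0 S.a1 := by
    intro x a hxa
    have hz : S.A1 (x + a • x0) = 0 := by rw [map_add, map_smul, hx, hxa]
    have : S.h1 (x + a • x0) S.a1 = 0 := by
      rw [← hx, ← S.sa1, hz, S.H1.zero_left]
    rw [S.H1.add_left, S.H1.smul_left] at this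
    linear_combination this
  by_cases hb : h (A v') v' = S.h1 x0 S.a1
  · left
    rw [if_pos (sub_eq_zero.2 hb), ← pow_add, ← pow_add] at hg
    have := C.Q_pow_inj hg
    refine ⟨by omega, ?_, hb⟩
    rw [eta_not_range C S.H S.nd S.sa (M + 1), if_pos S.vv]
    rintro ⟨w, hw⟩
    obtain ⟨a, b, x, rfl⟩ := S.exists_split w
    obtain ⟨c, hc⟩ := S.A_split a b x
    have hv2 : h (A (a • v' + b • v + x)) v' = 1 := by rw [hw, S.vv']
    have h0 : S.A1 x + a • S.a1 = 0 := by
      rw [hw] at hc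
      have : c = 1 := by
        have := congrArg (fun y => h y v') hc
        simpa [S.H.add_left, S.H.smul_left, S.vv', S.Wv', S.v'v', S.A1_apply, S.vv,
          S.H.sub_left, S.a1_def] using this.symm
      rw [this, one_smul] at hc
      ext1
      simpa using hc.symm
    have := hphi x a h0
    simp only [map_add, map_smul, S.Av, smul_zero, add_zero, S.H.add_left, S.H.smul_left,
      S.phi_eq, this, hb] at hv2
    have h3 : (0 : K) = 1 := by linear_combination hv2
    exact zero_ne_one h3
  · right
    have hb' := sub_ne_zero.2 hb
    rw [if_neg hb', ← pow_succ', ← pow_add] at hg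
    have := C.Q_pow_inj hg
    refine ⟨by omega, ?_, hb⟩
    set d := (h (A v') v' - S.h1 x0 S.a1) with hd
    refine eta_range_ne C S.H S.nd S.sa M (w := d⁻¹ • (v' - x0)) ?_ S.Av ?_
    · rw [map_smul, map_sub, S.Av'_eq, S.A_eq x0, hx, S.phi_eq]
      rw [add_sub_add_left_eq_sub, ← sub_smul, ← hd, smul_smul, inv_mul_cancel₀ hb', one_smul]
    · simp [S.H.smul_left, S.H.sub_left, S.v'v, S.Wv, hb']

theorem case2_dim (hx : ¬ ∃ x0, S.A1 x0 = S.a1) :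
    Module.finrank K (LinearMap.ker A) = Module.finrank K (LinearMap.ker S.A1) := by
  have hg := S.gauss_split
  rw [Finset.sum_eq_single 0 ?_ (by simp)] at hg
  · rw [zero_smul, ES_zero C S.H1 S.nd1 S.sa1 (by simp [C.mem_Fs]), S.finrank_W] at hg
    simp only [Ctx.nm, zero_mul, C.ψzero, one_mul] at hg
    rw [← pow_add] at hg
    have := C.Q_pow_inj hg
    omega
  · intro a _ ha
    rw [ES_not_range C S.H1 S.nd1 S.sa1, mul_zero]
    rintro ⟨w, hw⟩
    exact hx ⟨a⁻¹ • w, by rw [map_smul, hw, smul_smul, inv_mul_cancel₀ ha, one_smul]⟩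

theorem case2_z (hx : ¬ ∃ x0, S.A1 x0 = S.a1) : ∃ z, S.A1 z = 0 ∧ S.h1 z S.a1 = 1 := by
  have : ∃ z, S.A1 z = 0 ∧ S.h1 z S.a1 ≠ 0 := by
    by_contra hne
    push Not at hne
    exact hx (mem_range_of_orth C S.H1 S.nd1 S.sa1 _ hne)
  obtain ⟨z, hz, hne⟩ := this
  exact ⟨(S.h1 z S.a1)⁻¹ • z, by rw [map_smul, hz, smul_zero],
    by rw [S.H1.smul_left, inv_mul_cancel₀ hne]⟩

theorem case2_eta (hx : ¬ ∃ x0, S.A1 x0 = S.a1) {M : ℕ} (hM : A ^ M = 0) {l : K} (hl : l ≠ 0) :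
    ∑ u ∈ kerS S.A1,
      C.ψ (C.tr (l * S.h1 u S.a1)) * eta C S.h1 S.A1 M u = - eta C h A M v := by
  obtain ⟨z, hz, hz1⟩ := S.case2_z hx
  have hdim := S.case2_dim hx
  have hAz : A z = v := by rw [S.A_eq, hz, S.phi_eq, hz1]; simp
  have hM2 : A ^ (M + 1) = 0 := by rw [pow_succ, hM, zero_mul]
  rw [← eta_succ C S.H S.nd S.sa hM S.ne, ← eta_succ C S.H S.nd S.sa hM2 S.ne]
  have hchar : ∑ u ∈ kerF S.A1,
      C.ψ (C.tr (l * S.h1 u S.a1)) = 0 := by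
    obtain ⟨b, hb, hnb⟩ := C.ψnt
    obtain ⟨x, hx⟩ := C.tr_surj b hb
    rw [Finset.sum_subtype (p := fun u => u ∈ LinearMap.ker S.A1) _ (by intro u; simp [mem_kerF])]
    refine sum_char_zero (G := LinearMap.ker S.A1) _ (fun u u' => by
      rw [Submodule.coe_add, S.H1.add_left, mul_add, C.tr_add, C.ψadd]) ⟨(x / l) • z, by
        simp [hz]⟩ ?_
    rwa [S.H1.smul_left, hz1, mul_one, mul_div_cancel₀ _ hl, hx]
  have ht := telescope (fun i => SS C S.h1 S.A1 i 0) M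
  simp only [SS_pow_zero C (S.nil1 hM), sub_self, mul_zero, add_zero, SS00 C S.H1 S.nd1 S.sa1,
    SS10 C S.H1 S.nd1 S.sa1] at ht
  rw [sum_ker_ne, S.H1.zero_left, mul_zero, C.tr_zero, C.ψzero, one_mul]
  simp only [eta, mul_sub, Finset.sum_sub_distrib, ← Finset.sum_mul, hchar]
  have e1 : ∑ u ∈ kerF S.A1, C.ψ (C.tr (l * S.h1 u S.a1)) *
      ((C.Q ^ (Module.finrank K S.W + 1))⁻¹ *
        ∑ i ∈ Finset.range M, (-1) ^ i * SS C S.h1 S.A1 i u)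
      = (C.Q ^ (Module.finrank K S.W + 1))⁻¹ *
        ∑ i ∈ Finset.range M, (-1) ^ i * S.PP i 1 := by
    rw [Finset.mul_sum]
    simp only [← S.SS1_sum _ hl, Finset.mul_sum]
    rw [Finset.sum_comm]
    exact Finset.sum_congr rfl fun i _ => Finset.sum_congr rfl fun u _ => by ring
  rw [e1]
  have e2 : ∑ i ∈ Finset.range (M + 1 + 1), (-1) ^ i * SS C h A i v
      = C.Q ^ 2 * (∑ i ∈ Finset.range M, (-1) ^ i * SS C S.h1 S.A1 (i + 2) 0
        - ∑ i ∈ Finset.range M, (-1) ^ i * S.PP i 1) + SS C h A 0 v - SS C h A 1 v := by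
    rw [Finset.sum_range_succ', Finset.sum_range_succ', ← Finset.sum_sub_distrib, Finset.mul_sum]
    rw [Finset.sum_congr rfl (g := fun i => C.Q ^ 2 * ((-1) ^ i * SS C S.h1 S.A1 (i + 2) 0
      - (-1) ^ i * S.PP i 1)) (fun i _ => by rw [S.SS_split']; ring)]
    ring
  have e3 : ∑ i ∈ Finset.range M, (-1 : ℂ) ^ i * SS C S.h1 S.A1 (i + 2) 0
    = ∑ i ∈ Finset.range M, (-1 : ℂ) ^ i * SS C S.h1 S.A1 i 0 + (((C.q : ℂ) - 1) *
      C.Q ^ (Module.finrank K S.W + Module.finrank K (LinearMap.ker S.A1)) -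
      ((C.q : ℂ) - 1) * C.Q ^ (Module.finrank K S.W)) := by
    rw [← ht, ← Finset.sum_add_distrib]
    exact Finset.sum_congr rfl fun i _ => by ring
  have e4 : SS C h A 1 v = ((C.q : ℂ) - 1) *
      C.Q ^ (Module.finrank K V + Module.finrank K (LinearMap.ker A)) := by
    rw [SS_range C S.H S.nd S.sa 1 (w := z) (by simpa using hAz), if_pos (S.Wv z), pow_one]
  rw [e2, e3, e4, SS_zero_idx C S.H S.nd S.sa, if_pos S.vv, hdim, S.finrank_W, C.q_eq]
  have := C.Q_ne
  simp only [pow_add]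
  field_simp
  ring

end HS
end
end

noncomputable section
set_option linter.unusedSectionVars false
/-! part 4 -/
section
variable {V : Type}
def mi {k : ℕ} (i : Fin k) : Fin (k + 2) := i.castSucc.succ
theorem mi_val {k : ℕ} (i : Fin k) : (mi i : ℕ) = i + 1 := rfl
theorem mi_inj {k : ℕ} (i j : Fin k) : mi i = mi j ↔ i = j := by
  simp [Fin.ext_iff, mi_val]
theorem mi_ne_zero {k : ℕ} (i : Fin k) : mi i ≠ 0 := by simp [Fin.ext_iff, mi_val]
theorem zero_ne_mi {k : ℕ} (i : Fin k) : 0 ≠ mi i := (mi_ne_zero i).symm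
theorem mi_ne_last {k : ℕ} (i : Fin k) : mi i ≠ Fin.last (k + 1) := by
  simp [Fin.ext_iff, mi_val]; omega
theorem last_ne_mi {k : ℕ} (i : Fin k) : Fin.last (k + 1) ≠ mi i := (mi_ne_last i).symm
theorem rev_mi {k : ℕ} (i : Fin k) : (mi i).rev = mi i.rev := by
  simp [Fin.ext_iff, mi_val, Fin.val_rev]; omega
theorem rev_zero' {k : ℕ} : (0 : Fin (k + 2)).rev = Fin.last (k + 1) := by simp
theorem rev_last' {k : ℕ} : (Fin.last (k + 1)).rev = 0 := by simp
theorem mi_le {k : ℕ} (i j : Fin k) : mi i ≤ mi j ↔ i ≤ j := by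
  rw [Fin.le_def, Fin.le_def, mi_val, mi_val]; omega
theorem forall_mi {k : ℕ} {P : Fin (k + 2) → Prop} :
    (∀ i, P i) ↔ P 0 ∧ (∀ i, P (mi i)) ∧ P (Fin.last (k + 1)) := by
  constructor
  · exact fun h => ⟨h _, fun _ => h _, h _⟩
  · rintro ⟨h0, h1, h2⟩ i
    refine Fin.cases h0 (fun j => ?_) i
    exact Fin.lastCases (motive := fun j => P j.succ) h2 (fun j => h1 j) j
theorem sum_mi {M : Type} [AddCommMonoid M] {k : ℕ} (f : Fin (k + 2) → M) :
    ∑ i, f i = f 0 + (∑ i, f (mi i) + f (Fin.last (k + 1))) := by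
  rw [Fin.sum_univ_succ, Fin.sum_univ_castSucc]; rfl

def e3 {k : ℕ} (a : V) (m : Fin k → V) (b : V) : Fin (k + 2) → V := Fin.cons a (Fin.snoc m b)
theorem e3_zero {k : ℕ} (a : V) (m : Fin k → V) (b : V) : e3 a m b 0 = a := rfl
theorem e3_mi {k : ℕ} (a : V) (m : Fin k → V) (b : V) (i : Fin k) : e3 a m b (mi i) = m i := by
  simp [e3, mi]
theorem e3_last {k : ℕ} (a : V) (m : Fin k → V) (b : V) : e3 a m b (Fin.last (k + 1)) = b := by
  rw [e3, ← Fin.succ_last, Fin.cons_succ, Fin.snoc_last]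
theorem e3_eta {k : ℕ} (e : Fin (k + 2) → V) :
    e3 (e 0) (fun i => e (mi i)) (e (Fin.last (k + 1))) = e := by
  funext i
  revert i
  rw [forall_mi]
  exact ⟨rfl, fun i => e3_mi _ _ _ i, e3_last _ _ _⟩
end

section
variable {K : Type} [Field K] [Fintype K] (C : Ctx K)
variable {V : Type} [AddCommGroup V] [Module K V] [Fintype V] {h : V → V → K}

def Frame {n : ℕ} (h : V → V → K) (e : Fin n → V) : Prop :=
  ∀ i j, h (e i) (e j) = if j = i.rev then 1 else 0
def UpF {n : ℕ} (h : V → V → K) (A : V →ₗ[K] V) (e : Fin n → V) : Prop :=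
  ∀ i j, j ≤ i → h (A (e j)) (e i.rev) = 0
def sdF {n : ℕ} (h : V → V → K) (A : V →ₗ[K] V) (e : Fin n → V) : K :=
  ∑ i : Fin n, ∑ j : Fin n, if (j : ℕ) = (i : ℕ) + 1 ∧ (j : ℕ) ≤ n / 2 then h (A (e j)) (e i.rev) else 0
def FG {n : ℕ} (h : V → V → K) (A : V →ₗ[K] V) (e : Fin n → V) : ℂ :=
  if Frame h e ∧ UpF h A e then C.ψ (sdF h A e) else 0
def ff (n : ℕ) (h : V → V → K) (A : V →ₗ[K] V) : ℂ := ∑ e : Fin n → V, FG C h A e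
def XX (k : ℕ) (h : V → V → K) (A : V →ₗ[K] V) (v : V) : ℂ :=
  ∑ e : Fin (k + 2) → V, if e 0 = v then FG C h A e else 0
def UU (k : ℕ) (h : V → V → K) (A : V →ₗ[K] V) (v : V) : ℂ :=
  ∑ l ∈ Finset.univ.filter (fun l : K => l ≠ 0), XX C k h A (l • v)
def DD (k : ℕ) (h : V → V → K) (A : V →ₗ[K] V) (φ : V → K) : ℂ :=
  ∑ e : Fin (k + 1) → V, FG C h A e * C.w (φ (e 0))

theorem frame_expand {n : ℕ} (H : IsHerm C h) (hn : Module.finrank K V = n) {e : Fin n → V}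
    (he : Frame h e) (x : V) : x = ∑ i, h x (e i.rev) • e i := by
  have key : ∀ c : Fin n → K, ∀ j, h (∑ i, c i • e i) (e j.rev) = c j := by
    intro c j
    rw [H.sum_left]
    simp only [H.smul_left, he _ _, Fin.rev_inj]
    simp
  have li : LinearIndependent K e := by
    rw [Fintype.linearIndependent_iff]
    intro c hc j
    rw [← key c j, hc, H.zero_left]
  have hsp := li.span_eq_top_of_card_eq_finrank' (by simp [hn])
  have hx : x ∈ Submodule.span K (Set.range e) := by rw [hsp]; trivial
  rw [Submodule.mem_span_range_iff_exists_fun] at hx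
  obtain ⟨c, rfl⟩ := hx
  refine Finset.sum_congr rfl fun i _ => ?_
  rw [key]

theorem frame_up_zero {n : ℕ} (H : IsHerm C h) (hn : Module.finrank K V = n + 1)
    {A : V →ₗ[K] V} {e : Fin (n + 1) → V} (he : Frame h e) (hu : UpF h A e) : A (e 0) = 0 := by
  rw [frame_expand C H hn he (A (e 0))]
  exact Finset.sum_eq_zero fun i _ => by rw [hu i 0 (Fin.zero_le _), zero_smul]

theorem frame_ne_zero {n : ℕ} (H : IsHerm C h) {e : Fin n → V} (he : Frame h e) (i : Fin n) :
    e i ≠ 0 := by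
  intro h0
  have := he i i.rev
  simp [h0, H.zero_left] at this

theorem frame_e3 {k : ℕ} (H : IsHerm C h) (a b : V) (m : Fin k → V) :
    Frame h (e3 a m b) ↔ h a a = 0 ∧ h a b = 1 ∧ (∀ i, h a (m i) = 0) ∧ Frame h m ∧
      (∀ i, h b (m i) = 0) ∧ h b b = 0 := by
  have hz : ∀ x y, h x y = 0 ↔ h y x = 0 := fun x y => ⟨H.eq_zero_symm, H.eq_zero_symm⟩
  have ho : h b a = 1 ↔ h a b = 1 := by
    rw [H.symm a b]; exact ⟨fun e => by rw [← C.invol (h a b), e, map_one], fun e => by rw [e, map_one]⟩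
  unfold Frame
  simp only [forall_mi, e3_zero, e3_mi, e3_last, rev_zero', rev_last', rev_mi, mi_inj,
    (Fin.last_pos).ne, (Fin.last_pos).ne', if_false, if_true, zero_ne_mi, mi_ne_zero, mi_ne_last, last_ne_mi,
    ho]
  constructor
  · rintro ⟨⟨h1, h2, h3⟩, h4, h5, h6, h7⟩
    exact ⟨h1, h3, h2, fun i => (h4 i).2.1, h6, h7⟩
  · rintro ⟨h1, h2, h3, h4, h5, h6⟩
    exact ⟨⟨h1, h3, h2⟩, fun i => ⟨(hz _ _).1 (h3 i), h4 i, (hz _ _).1 (h5 i)⟩, h2, h5, h6⟩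

theorem up_e3 {k : ℕ} (H : IsHerm C h) {A : V →ₗ[K] V} (hA : SAdj h A) (a b : V) (m : Fin k → V)
    (ha : A a = 0) : UpF h A (e3 a m b) ↔ UpF h A m := by
  have h1 : ∀ x, h (A x) a = 0 := fun x => by rw [hA, ha, H.zero_right]
  unfold UpF
  simp only [forall_mi, e3_zero, e3_mi, e3_last, rev_zero', rev_last', rev_mi, mi_le, ha,
    H.zero_left, h1, implies_true, true_and, and_true]
  constructor
  · rintro ⟨_, h2⟩ i; exact (h2 i).1
  · intro h2
    refine ⟨⟨fun i hi => absurd (Fin.le_zero_iff.1 hi) (mi_ne_zero i), fun hi => ?_⟩, fun i => ⟨h2 i, fun hi => ?_⟩⟩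
    · exact absurd hi (by simp)
    · exact absurd (Fin.last_le_iff.1 hi) (mi_ne_last i)

theorem sd_e3 {k : ℕ} {A : V →ₗ[K] V} (a b : V) (m : Fin k → V) :
    sdF h A (e3 a m b) = (∑ j : Fin k, if (j : ℕ) = 0 then h (A (m j)) b else 0) +
      (if k = 0 then h (A b) b else 0) + sdF h A m := by
  unfold sdF
  rw [sum_mi]
  simp only [sum_mi (k := k), e3_zero, e3_mi, e3_last, rev_zero', rev_last', rev_mi, mi_val,
    Fin.val_last, Fin.val_zero]
  have c1 : ∀ j : Fin k, ((j : ℕ) + 1 = 0 + 1 ∧ (j : ℕ) + 1 ≤ (k + 2) / 2) ↔ (j : ℕ) = 0 := by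
    intro j; omega
  have c2 : (k + 1 = 0 + 1 ∧ k + 1 ≤ (k + 2) / 2) ↔ k = 0 := by omega
  have c3 : ∀ i j : Fin k, ((j : ℕ) + 1 = i + 1 + 1 ∧ (j : ℕ) + 1 ≤ (k + 2) / 2) ↔
    ((j : ℕ) = i + 1 ∧ (j : ℕ) ≤ k / 2) := by intro i j; omega
  have c4 : ∀ i : Fin k, ¬ (k + 1 = (i : ℕ) + 1 + 1 ∧ k + 1 ≤ (k + 2) / 2) := by intro i; omega
  have c5 : ∀ j : Fin k, ¬ ((j : ℕ) + 1 = k + 1 + 1 ∧ (j : ℕ) + 1 ≤ (k + 2) / 2) := by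
    intro j; omega
  have c6 : ¬ (k + 1 = k + 1 + 1 ∧ k + 1 ≤ (k + 2) / 2) := by omega
  have c7 : ∀ x : ℕ, ¬ (0 = x + 1 ∧ 0 ≤ (k + 2) / 2) := by intro x; omega
  simp only [c1, c2, c3, c4, c5, c6, c7, if_false, Finset.sum_const_zero, add_zero, zero_add]

theorem ff_eq_sum {k : ℕ} (H : IsHerm C h) (hn : Module.finrank K V = k + 2) (A : V →ₗ[K] V) :
    ff C (k + 2) h A = ∑ v ∈ kerS A, XX C k h A v := by
  simp only [ff, XX]
  rw [Finset.sum_comm]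
  refine Finset.sum_congr rfl fun e _ => ?_
  by_cases he : Frame h e ∧ UpF h A e
  · rw [Finset.sum_ite_eq, if_pos]
    rw [mem_kerS]
    exact ⟨frame_up_zero C H hn he.1 he.2, frame_ne_zero C H he.1 0⟩
  · simp [FG, he]

theorem DD_eq_sum {k : ℕ} (H : IsHerm C h) (hn : Module.finrank K V = k + 2) (A : V →ₗ[K] V)
    (φ : V → K) : DD C (k + 1) h A φ = ∑ v ∈ kerS A, C.w (φ v) * XX C k h A v := by
  simp only [DD, XX, Finset.mul_sum]
  rw [Finset.sum_comm]
  refine Finset.sum_congr rfl fun e _ => ?_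
  by_cases he : Frame h e ∧ UpF h A e
  · simp only [mul_ite, mul_zero]
    rw [Finset.sum_ite_eq, if_pos, mul_comm]
    rw [mem_kerS]
    exact ⟨frame_up_zero C H hn he.1 he.2, frame_ne_zero C H he.1 0⟩
  · simp [FG, he]

theorem sum_UU {k : ℕ} (A : V →ₗ[K] V) (g : V → ℂ) (hg : ∀ (l : K) v, l ≠ 0 → g (l • v) = g v) :
    ∑ v ∈ kerS A, g v * UU C k h A v = (C.Q ^ 2 - 1) * ∑ v ∈ kerS A, g v * XX C k h A v := by
  simp only [UU, Finset.mul_sum]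
  rw [Finset.sum_comm]
  rw [Finset.sum_congr rfl (g := fun _ => ∑ v ∈ kerS A, g v * XX C k h A v)]
  · rw [Finset.sum_const, nsmul_eq_mul]
    rw [← Finset.mul_sum]
    congr 1
    have := Ctx.sum_ne (K := K) (fun _ => 1)
    simp only [Finset.sum_const, nsmul_eq_mul, mul_one, Finset.card_univ, C.cardK] at this
    exact this
  · intro l hl
    have hl : l ≠ 0 := by simpa using hl
    refine Finset.sum_nbij' (fun v => l • v) (fun v => l⁻¹ • v) ?_ ?_ ?_ ?_ ?_
    · intro v hv; rw [mem_kerS] at *; simp [hv, hl]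
    · intro v hv; rw [mem_kerS] at *; simp [hv, hl]
    · intro v _; simp [hl]
    · intro v _; simp [hl]
    · intro v _; rw [hg _ _ hl]

theorem UU_aniso {k : ℕ} (H : IsHerm C h) (A : V →ₗ[K] V) {v : V} (hv : h v v ≠ 0) :
    UU C k h A v = 0 := by
  refine Finset.sum_eq_zero fun l hl => Finset.sum_eq_zero fun e _ => ?_
  have hl : l ≠ 0 := by simpa using hl
  split_ifs with he
  · rw [FG, if_neg]
    rintro ⟨hf, _⟩
    have := hf 0 0
    rw [he, H.smul_left, H.smul_right, rev_zero', if_neg Fin.last_pos.ne] at this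
    simp [hl, hv] at this
  · rfl

end
end

noncomputable section
set_option linter.unusedSectionVars false
/-! part 5 -/
section
variable {K : Type} [Field K] [Fintype K] {C : Ctx K}
variable {V : Type} [AddCommGroup V] [Module K V] [Fintype V] {h : V → V → K}
namespace HS
variable {A : V →ₗ[K] V} {v v' : V} (S : HS C h A v v')
include S

theorem exists_c0 : ∃ c, C.tr c = 1 := C.tr_surj 1 (map_one _)

def yy {k : ℕ} (T : (Fin k → S.W) × (Fin k → K)) : S.W := ∑ j, C.σ (T.2 j) • T.1 j.rev

def c0 : K := Classical.choose S.exists_c0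
theorem c0_spec : C.tr S.c0 = 1 := Classical.choose_spec S.exists_c0

def bld {k : ℕ} (l : K) (T : ((Fin k → S.W) × (Fin k → K)) × K) : Fin (k + 2) → V :=
  e3 (l • v) (fun i => T.1.1 i + T.1.2 i • v)
    ((C.σ l)⁻¹ • (v' - S.yy T.1 + (T.2 - S.c0 * S.h1 (S.yy T.1) (S.yy T.1)) • v))

def xt1 {k : ℕ} (e : Fin (k + 2) → V) : (Fin k → S.W) × (Fin k → K) :=
  (fun i => (S.E (e (mi i))).2, fun i => h (e (mi i)) v')
def xtr {k : ℕ} (l : K) (e : Fin (k + 2) → V) : ((Fin k → S.W) × (Fin k → K)) × K :=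
  (S.xt1 e, C.σ l * h (e (Fin.last (k + 1))) v' + S.c0 * S.h1 (S.yy (S.xt1 e)) (S.yy (S.xt1 e)))

theorem E_mid (x : S.W) (s : K) : S.E (x + s • v) = ((0, s), x) := by
  have := S.E.apply_symm_apply ((0, s), x)
  have h2 : S.E.symm ((0, s), x) = x + s • v := by
    have := S.E_symm 0 s x
    change S.E.symm ((0, s), x) = _ at this
    rw [this]; simp [add_comm]
  rwa [h2] at this

theorem xt1_bld {k : ℕ} (l : K) (T : ((Fin k → S.W) × (Fin k → K)) × K) :
    S.xt1 (S.bld l T) = T.1 := by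
  ext1
  · funext i
    simp only [xt1, bld, e3_mi, S.E_mid]
  · funext i
    simp [xt1, bld, e3_mi, S.H.add_left, S.H.smul_left, S.Wv', S.vv']

theorem xtr_bld {k : ℕ} {l : K} (hl : l ≠ 0) (T : ((Fin k → S.W) × (Fin k → K)) × K) :
    S.xtr l (S.bld l T) = T := by
  have hs : C.σ l ≠ 0 := by simpa using hl
  rw [xtr, S.xt1_bld]
  ext1
  · rfl
  · simp only [bld, e3_last, S.H.smul_left, S.H.add_left, S.H.sub_left, S.v'v', S.Wv', S.vv']
    field_simp
    ring

theorem frame_h1 {k : ℕ} (s : Fin k → K) (e : Fin k → S.W) :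
    Frame h (fun i => (e i : V) + s i • v) ↔ Frame S.h1 e := by
  unfold Frame
  simp [S.H.add_left, S.H.add_right, S.H.smul_left, S.H.smul_right, S.vv, S.Wv, S.vW, h1_def]

theorem up_h1 {k : ℕ} (s : Fin k → K) (e : Fin k → S.W) :
    UpF h A (fun i => (e i : V) + s i • v) ↔ UpF S.h1 S.A1 e := by
  have key : ∀ (x y : S.W) (a b : K), h (A (x + a • v)) (y + b • v) = S.h1 (S.A1 x) y := by
    intro x y a b
    rw [map_add, map_smul, S.Av, smul_zero, add_zero, S.A_eq]
    simp [S.H.add_left, S.H.add_right, S.H.smul_left, S.H.smul_right, S.vv, S.Wv, S.vW, h1_def]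
  unfold UpF
  simp only [key]

theorem sd_h1 {k : ℕ} (s : Fin k → K) (e : Fin k → S.W) :
    sdF h A (fun i => (e i : V) + s i • v) = sdF S.h1 S.A1 e := by
  have key : ∀ (x y : S.W) (a b : K), h (A (x + a • v)) (y + b • v) = S.h1 (S.A1 x) y := by
    intro x y a b
    rw [map_add, map_smul, S.Av, smul_zero, add_zero, S.A_eq]
    simp [S.H.add_left, S.H.add_right, S.H.smul_left, S.H.smul_right, S.vv, S.Wv, S.vW, h1_def]
  unfold sdF
  simp only [key]

theorem h_yy {k : ℕ} {T : (Fin k → S.W) × (Fin k → K)} (hT : Frame S.h1 T.1) (i : Fin k) :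
    S.h1 (S.yy T) (T.1 i) = C.σ (T.2 i) := by
  rw [yy, S.H1.sum_left]
  simp only [S.H1.smul_left, hT _ _, Fin.rev_rev]
  simp

theorem frame_bld {k : ℕ} {l : K} (hl : l ≠ 0) (T : ((Fin k → S.W) × (Fin k → K)) × K) :
    Frame h (S.bld l T) ↔ Frame S.h1 T.1.1 ∧ C.tr T.2 = 0 := by
  have hs : C.σ l ≠ 0 := by simpa using hl
  rw [bld, frame_e3 C S.H, S.frame_h1]
  constructor
  · rintro ⟨_, _, _, hf, _, hb⟩
    refine ⟨hf, ?_⟩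
    have h1 : C.tr (S.c0) = 1 := S.c0_spec
    have h2 := S.H1.self_fix (S.yy T.1)
    simp only [S.H.smul_left, S.H.smul_right, S.H.add_left, S.H.add_right, S.H.sub_left,
      S.H.sub_right, S.vv, S.v'v', S.vv', S.v'v, S.Wv, S.Wv', S.vW, S.v'W, map_sub, map_mul,
      h2] at hb
    simp only [Ctx.tr] at *
    have h3 := (mul_eq_zero.1 ((mul_eq_zero.1 hb).resolve_left (inv_ne_zero hs))).resolve_left (by simpa using hl)
    rw [h1_def] at h3
    linear_combination h3 + h (S.yy T.1) (S.yy T.1) * h1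
  · rintro ⟨hf, ht⟩
    refine ⟨?_, ?_, ?_, hf, ?_, ?_⟩
    · simp [S.H.smul_left, S.H.smul_right, S.vv]
    · simp [S.H.smul_left, S.H.smul_right, S.H.add_right, S.H.sub_right, S.vv, S.vv', S.vW,
        C.invol, hl]
    · intro i
      simp [S.H.smul_left, S.H.smul_right, S.H.add_right, S.vv, S.vW]
    · intro i
      have := S.h_yy hf i
      rw [h1_def] at this
      simp [S.H.smul_left, S.H.smul_right, S.H.add_right, S.H.add_left, S.H.sub_left, S.vv, S.vW,
        S.v'W, S.v'v, S.Wv, this]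
      ring
    · have h1 : C.tr (S.c0) = 1 := S.c0_spec
      have h2 := S.H1.self_fix (S.yy T.1)
      simp only [S.H.smul_left, S.H.smul_right, S.H.add_left, S.H.add_right, S.H.sub_left,
        S.H.sub_right, S.vv, S.v'v', S.vv', S.v'v, S.Wv, S.Wv', S.vW, S.v'W, map_sub, map_mul,
        h2]
      simp only [Ctx.tr] at *
      rw [h1_def]
      linear_combination (C.σ l)⁻¹ * C.σ (C.σ l)⁻¹ * (ht - h (S.yy T.1) (S.yy T.1) * h1)

theorem bld_xtr {k : ℕ} (hn : Module.finrank K V = k + 2) {l : K} (hl : l ≠ 0)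
    {e : Fin (k + 2) → V} (he : Frame h e) (h0 : e 0 = l • v) : S.bld l (S.xtr l e) = e := by
  have hs : C.σ l ≠ 0 := by simpa using hl
  have hnW : Module.finrank K S.W = k := by have := S.finrank_W; omega
  rw [← e3_eta e] at he
  rw [frame_e3 C S.H, h0] at he
  obtain ⟨_, hlast, hmid, hfm, hlm, hll⟩ := he
  have hv0 : ∀ i, h v (e (mi i)) = 0 := fun i => by
    have := hmid i
    rw [S.H.smul_left] at this
    exact (mul_eq_zero.1 this).resolve_left hl
  have em : ∀ i, ((S.E (e (mi i))).2 : V) + h (e (mi i)) v' • v = e (mi i) := by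
    intro i
    have h1 : ((S.E (e (mi i))).2 : V) = e (mi i) - h (e (mi i)) v • v' - h (e (mi i)) v' • v := rfl
    rw [h1, S.H.eq_zero_symm (hv0 i)]; simp
  have hfm1 : Frame S.h1 (S.xt1 e).1 := by
    rw [← S.frame_h1 (S.xt1 e).2]
    simp only [xt1, em]
    exact hfm
  rw [← e3_eta e]
  conv_lhs => rw [e3_eta]
  rw [bld]
  congr 1
  · exact h0.symm
  · funext i
    exact em i
  · simp only [xtr]
    set z := C.σ l • e (Fin.last (k + 1)) with hz
    set y := S.yy (S.xt1 e) with hy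
    have hvl : h v (e (Fin.last (k + 1))) = l⁻¹ := by
      rw [S.H.smul_left] at hlast
      exact eq_inv_of_mul_eq_one_right hlast
    have hzv : h z v = 1 := by
      rw [hz, S.H.smul_left, S.H.symm v, hvl, map_inv₀, mul_inv_cancel₀ hs]
    have hzv' : h z v' = C.σ l * h (e (Fin.last (k + 1))) v' := by rw [hz, S.H.smul_left]
    let u : S.W := (S.E z).2
    have hu : (u : V) = z - h z v • v' - h z v' • v := rfl
    have hu2 : u = - y := by
      rw [frame_expand C S.H1 hnW hfm1 u, hy, yy, ← Finset.sum_neg_distrib,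
        ← Equiv.sum_comp Fin.revPerm]
      refine Finset.sum_congr rfl fun i _ => ?_
      rw [Fin.revPerm_apply, Fin.rev_rev, ← neg_smul]
      congr 1
      have h1 : ((S.xt1 e).1 i : V) = e (mi i) - h (e (mi i)) v' • v := by
        rw [← em i]; simp only [xt1]; rw [em i]; rw [eq_sub_iff_add_eq]; exact em i
      have h2 : h z (e (mi i)) = 0 := by rw [hz, S.H.smul_left, hlm, mul_zero]
      have h3 : h u ((S.xt1 e).1 i) = - C.σ (h (e (mi i)) v') := by
        have h4 : h u ((S.xt1 e).1 i) = h z ((S.xt1 e).1 i) := by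
          rw [hu]; simp [S.H.sub_left, S.H.smul_left, S.v'W, S.vW]
        rw [h4, h1, S.H.sub_right, h2, S.H.smul_right, hzv]; simp
      exact h3
    have hz2 : z = v' - y + h z v' • v := by
      have h5 : (u : V) = - y := by rw [hu2]; rfl
      rw [hu, hzv] at h5
      have : z = (z - (1 : K) • v' - h z v' • v) + v' + h z v' • v := by rw [one_smul]; abel
      rw [this, h5]
      simp only [S.H.add_left, S.H.neg_left, S.H.smul_left, S.Wv', S.v'v', S.vv']
      simp only [neg_zero, add_zero, zero_add, mul_one]
      abel
    have hfin : e (Fin.last (k + 1)) = (C.σ l)⁻¹ • z := by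
      rw [hz, smul_smul, inv_mul_cancel₀ hs, one_smul]
    rw [hfin, add_sub_cancel_right]
    congr 1
    conv_rhs => rw [hz2, hzv']
    rw [hfin]

theorem fib_sum {k : ℕ} (hn : Module.finrank K V = k + 2) {l : K} (hl : l ≠ 0)
    (G : (Fin (k + 2) → V) → ℂ) :
    ∑ e, (if e 0 = l • v ∧ Frame h e then G e else 0) =
    ∑ T : ((Fin k → S.W) × (Fin k → K)) × K,
      if Frame S.h1 T.1.1 ∧ C.tr T.2 = 0 then G (S.bld l T) else 0 := by
  rw [← Finset.sum_filter, ← Finset.sum_filter]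
  symm
  refine Finset.sum_nbij' (S.bld l) (S.xtr l) ?_ ?_ ?_ ?_ ?_
  · intro T hT
    simp only [Finset.mem_filter, Finset.mem_univ, true_and] at *
    exact ⟨rfl, (S.frame_bld hl T).2 hT⟩
  · intro e he
    simp only [Finset.mem_filter, Finset.mem_univ, true_and] at *
    rw [← S.frame_bld hl, S.bld_xtr hn hl he.2 he.1]
    exact he.2
  · intro T _; exact S.xtr_bld hl T
  · intro e he
    simp only [Finset.mem_filter, Finset.mem_univ, true_and] at *
    exact S.bld_xtr hn hl he.2 he.1
  · intro T _; rfl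

theorem sum_tr0 (x : ℂ) : ∑ c : K, (if C.tr c = 0 then x else 0) = C.q * x := by
  rw [← Finset.sum_filter, Finset.sum_const, nsmul_eq_mul]
  congr 2
  exact C.trFib 0 (map_zero _)

theorem card_fun (k : ℕ) : (Fintype.card (Fin k → K) : ℂ) = C.Q ^ (2 * k) := by
  rw [Fintype.card_fun, Nat.cast_pow, C.cardK, Fintype.card_fin, pow_mul]

theorem fib_sum' {k : ℕ} (hn : Module.finrank K V = k + 2) {l : K} (hl : l ≠ 0)
    (G : (Fin (k + 2) → V) → ℂ) (G1 : (Fin k → S.W) → ℂ)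
    (hG : ∀ T, Frame S.h1 T.1.1 → G (S.bld l T) = G1 T.1.1) :
    ∑ e, (if e 0 = l • v ∧ Frame h e then G e else 0) =
    C.q * C.Q ^ (2 * k) * ∑ e, if Frame S.h1 e then G1 e else 0 := by
  rw [S.fib_sum hn hl, Fintype.sum_prod_type, Fintype.sum_prod_type, Finset.mul_sum]
  refine Finset.sum_congr rfl fun e _ => ?_
  rw [Finset.sum_congr rfl (g := fun _ => C.q * (if Frame S.h1 e then G1 e else 0))]
  · rw [Finset.sum_const, nsmul_eq_mul, Finset.card_univ, S.card_fun]; ring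
  · intro s _
    rw [← S.sum_tr0]
    refine Finset.sum_congr rfl fun c _ => ?_
    by_cases h1 : Frame S.h1 e <;> by_cases h2 : C.tr c = 0 <;> simp [h1, h2]
    exact hG ((e, s), c) h1

theorem XX_fib (k : ℕ) (x : V) : XX C k h A x = ∑ e : Fin (k + 2) → V,
    if e 0 = x ∧ Frame h e then (if UpF h A e then C.ψ (sdF h A e) else 0) else 0 := by
  rw [XX]
  refine Finset.sum_congr rfl fun e _ => ?_
  rw [FG]
  split_ifs <;> simp_all

theorem up_bld {k : ℕ} (l : K) (T : ((Fin k → S.W) × (Fin k → K)) × K) :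
    UpF h A (S.bld l T) ↔ UpF S.h1 S.A1 T.1.1 := by
  rw [bld, up_e3 C S.H S.sa _ _ _ (by rw [map_smul, S.Av, smul_zero]), S.up_h1]

theorem XX_zero (hn : Module.finrank K V = 2) {l : K} (hl : l ≠ 0) :
    XX C 0 h A (l • v) = C.q * C.ψ ((C.nm l)⁻¹ * h (A v') v') := by
  rw [S.XX_fib, S.fib_sum' hn hl _ (fun _ => C.ψ ((C.nm l)⁻¹ * h (A v') v'))]
  · have : ∀ e : Fin 0 → S.W, Frame S.h1 e := fun e i => i.elim0
    simp [this]
  · intro T _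
    rw [if_pos ((S.up_bld l T).2 (fun i => i.elim0)), bld, sd_e3]
    congr 1
    have e0 : h (A v') v = 0 := by rw [S.sa, S.Av, S.H.zero_right]
    have hy : S.yy T.1 = 0 := by simp [yy]
    simp only [sdF, Finset.univ_eq_empty, Finset.sum_empty, hy, if_true, zero_add, add_zero,
      Submodule.coe_zero, sub_zero, map_add, map_smul, S.Av, smul_zero, S.H.smul_left,
      S.H.smul_right, S.H.add_right, e0, mul_zero, map_inv₀, C.invol, Ctx.nm]
    rw [mul_inv]; ring

theorem XX_succ {k : ℕ} (hn : Module.finrank K V = k + 1 + 2) {l : K} (hl : l ≠ 0) :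
    XX C (k + 1) h A (l • v) = C.q * C.Q ^ (2 * (k + 1)) *
      ∑ e : Fin (k + 1) → S.W, FG C S.h1 S.A1 e * C.ψ (l⁻¹ * S.h1 (e 0) S.a1) := by
  have hnW : Module.finrank K S.W = k + 1 := by have := S.finrank_W; omega
  rw [S.XX_fib, S.fib_sum' hn hl _ (fun e => (if UpF S.h1 S.A1 e then
    C.ψ (sdF S.h1 S.A1 e) * C.ψ (l⁻¹ * S.h1 (e 0) S.a1) else 0))]
  · congr 1
    refine Finset.sum_congr rfl fun e _ => ?_
    rw [FG]
    split_ifs <;> simp_all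
  · intro T hT
    by_cases hu : UpF S.h1 S.A1 T.1.1
    · rw [if_pos ((S.up_bld l T).2 hu), if_pos hu, ← C.ψadd, bld, sd_e3, S.sd_h1, add_comm]
      congr 2
      have hA0 := frame_up_zero C S.H1 hnW hT hu
      have hA1 : A (T.1.1 0) = S.h1 (T.1.1 0) S.a1 • v := by
        rw [S.A_eq, hA0, S.phi_eq]; simp
      rw [if_neg (by omega), add_zero, Finset.sum_eq_single 0]
      · rw [if_pos (by simp), map_add, map_smul, S.Av, smul_zero, add_zero, hA1]
        simp only [S.H.smul_left, S.H.smul_right, S.H.add_right, S.H.sub_right, S.vv', S.vW, S.vv,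
          map_inv₀, C.invol]
        ring
      · intro j _ hj
        rw [if_neg (by intro h0; exact hj (Fin.ext h0))]
      · simp
    · rw [if_neg (fun hh => hu ((S.up_bld l T).1 hh)), if_neg hu]

theorem UU_succ {k : ℕ} (hn : Module.finrank K V = k + 1 + 2) :
    UU C (k + 1) h A v = C.q * C.Q ^ (2 * (k + 1)) *
      DD C k S.h1 S.A1 (fun x => S.h1 x S.a1) := by
  rw [UU, Finset.sum_congr rfl (fun l hl => S.XX_succ hn (by simpa using hl)), ← Finset.mul_sum,
    DD, Finset.sum_comm]
  congr 1
  refine Finset.sum_congr rfl fun e _ => ?_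
  rw [← Finset.mul_sum, ← C.w_eq_all]
  congr 1
  refine Finset.sum_nbij' (fun l => l⁻¹) (fun l => l⁻¹) ?_ ?_ ?_ ?_ ?_ <;> simp

theorem UU_zero (hn : Module.finrank K V = 2) : UU C 0 h A v =
    C.q * (if h (A v') v' = 0 then C.Q ^ 2 - 1 else - ((C.q : ℂ) + 1)) := by
  rw [UU, Finset.sum_congr rfl (fun l hl => S.XX_zero hn (by simpa using hl)), ← Finset.mul_sum]
  congr 1
  have f1 : C.σ (h (A v') v') = h (A v') v' := by rw [← S.H.symm, S.sa]
  rw [C.sum_nm (fun x => C.ψ (x⁻¹ * h (A v') v'))]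
  have := sum_Fs_inv C (-h (A v') v') (by rw [map_neg, f1])
  simp only [mul_neg, neg_neg, neg_eq_zero] at this
  rw [this, C.q_eq]
  split_ifs <;> ring

end HS
end
end

noncomputable section
set_option linter.unusedSectionVars false
/-! part 6 -/
section
variable {K : Type} [Field K] [Fintype K] (C : Ctx K)

def bb : ℕ → ℂ
  | 0 => 1
  | 1 => 1
  | (k + 2) => C.q * C.Q ^ (2 * k) * bb k

theorem bb_two (k : ℕ) : bb C (k + 2) = C.q * C.Q ^ (2 * k) * bb C k := by rw [bb]
theorem bb_ne (n : ℕ) : bb C n ≠ 0 := by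
  induction n using Nat.twoStepInduction with
  | zero => simp [bb]
  | one => simp [bb]
  | more n h1 h2 =>
    rw [bb_two]
    exact mul_ne_zero (mul_ne_zero C.q_ne (pow_ne_zero _ C.Q_ne)) h1

def cc (n l : ℕ) : ℂ := (-1) ^ (n / 2) * ∏ i ∈ Finset.range l, (1 - C.Q ^ (i + 1))
theorem cc_succ (n l : ℕ) : cc C n (l + 1) = cc C n l * (1 - C.Q ^ (l + 1)) := by
  rw [cc, cc, Finset.prod_range_succ]; ring
theorem cc_two (n l : ℕ) : cc C (n + 2) l = - cc C n l := by
  rw [cc, cc, Nat.add_div_right _ (by norm_num), pow_succ]; ring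

section
variable {V : Type} [AddCommGroup V] [Module K V] [Fintype V] {h : V → V → K}

theorem eta_add2 (H : IsHerm C h) (nd : NonDeg h) {A : V →ₗ[K] V} (hA : SAdj h A) {M : ℕ}
    (hM : A ^ M = 0) {v : V} (hv : v ≠ 0) : eta C h A (M + 2) v = eta C h A M v := by
  rw [eta_succ C H nd hA (by rw [pow_succ, hM, zero_mul]) hv, eta_succ C H nd hA hM hv]

theorem exists_partner (H : IsHerm C h) (nd : NonDeg h) {A : V →ₗ[K] V} (hA : SAdj h A)
    {v : V} (hv : v ≠ 0) (hAv : A v = 0) (hvv : h v v = 0) : ∃ v', HS C h A v v' := by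
  have : ∃ y, h v y ≠ 0 := by
    by_contra hne; push Not at hne; exact hv (nd v hne)
  obtain ⟨y, hy⟩ := this
  have hy' : h y v ≠ 0 := fun e => hy (H.eq_zero_symm e)
  obtain ⟨z, hz⟩ : ∃ z, z = (h y v)⁻¹ • y := ⟨_, rfl⟩
  have hzv : h z v = 1 := by rw [hz, H.smul_left, inv_mul_cancel₀ hy']
  have hvz : h v z = 1 := by rw [H.symm, hzv, map_one]
  obtain ⟨c, hc⟩ := C.tr_surj (h z z) (H.self_fix z)
  refine ⟨z - c • v, ⟨H, nd, hA, hAv, hvv, ?_, ?_⟩⟩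
  · rw [H.sub_left, H.smul_left, hzv, hvv]; simp
  · simp only [H.sub_left, H.sub_right, H.smul_left, H.smul_right, hzv, hvz, hvv]
    rw [← hc, Ctx.tr]; ring

theorem nilp_inj {A : V →ₗ[K] V} {M : ℕ} (hM : A ^ M = 0)
    (h0 : Module.finrank K (LinearMap.ker A) = 0) (x : V) : x = 0 := by
  have hk : LinearMap.ker A = ⊥ := Submodule.finrank_eq_zero.1 h0
  have hi : Function.Injective A := LinearMap.ker_eq_bot.1 hk
  have : Function.Injective (A ^ M) := by
    rw [Module.End.coe_pow]; exact hi.iterate M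
  apply this
  simp [hM]

theorem ker_one {A : V →ₗ[K] V} (h1 : Module.finrank K (LinearMap.ker A) = 1) {v u : V}
    (hv : A v = 0) (hv0 : v ≠ 0) (hu : A u = 0) : ∃ c : K, u = c • v := by
  have := (finrank_eq_one_iff_of_nonzero' (⟨v, hv⟩ : LinearMap.ker A)
    (by intro e; exact hv0 (congrArg Subtype.val e))).1 h1 ⟨u, hu⟩
  obtain ⟨c, hc⟩ := this
  exact ⟨c, (congrArg Subtype.val hc).symm⟩

theorem iso_of_one (H : IsHerm C h) {A : V →ₗ[K] V} (hA : SAdj h A)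
    {M : ℕ} (hM : A ^ M = 0) (hn : 2 ≤ Module.finrank K V)
    (h1 : Module.finrank K (LinearMap.ker A) = 1) {v : V} (hv : A v = 0) (hv0 : v ≠ 0) :
    h v v = 0 := by
  by_contra hvv
  have hy : ∃ y : V, y ≠ 0 ∧ h y v = 0 := by
    have h2 := (H.lin v).finrank_range_add_finrank_ker
    have h3 : Module.finrank K (LinearMap.range (H.lin v)) ≤ 1 := by
      have := (LinearMap.range (H.lin v)).finrank_le
      simpa using this
    have h4 : 0 < Module.finrank K (LinearMap.ker (H.lin v)) := by omega
    have := Module.finrank_pos_iff_exists_ne_zero.1 h4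
    obtain ⟨y, hy⟩ := this
    exact ⟨y, fun e => hy (Subtype.ext e), y.2⟩
  obtain ⟨y, hy0, hyv⟩ := hy
  have ex : ∃ m, (A ^ m) y = 0 := ⟨M, by rw [hM]; rfl⟩
  have hf := Nat.find_spec ex
  obtain ⟨m, hm⟩ : ∃ m, Nat.find ex = m + 1 := by
    refine Nat.exists_eq_succ_of_ne_zero fun e => ?_
    rw [e] at hf; exact hy0 (by simpa using hf)
  have hm' : (A ^ m) y ≠ 0 := Nat.find_min ex (by omega)
  rw [hm, pow_succ'] at hf
  obtain ⟨c, hc⟩ := ker_one h1 hv hv0 (u := (A ^ m) y) hf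
  have h5 : h ((A ^ m) y) v = 0 := by
    cases m with
    | zero => simpa using hyv
    | succ m =>
      rw [pow_succ']
      change h (A ((A ^ m) y)) v = 0
      rw [hA, hv, H.zero_right]
  rw [hc, H.smul_left] at h5
  have : c = 0 := (mul_eq_zero.1 h5).resolve_right hvv
  exact hm' (by rw [hc, this, zero_smul])

theorem card_kerS (A : V →ₗ[K] V) : ((kerS A).card : ℂ)
    = C.Q ^ (2 * Module.finrank K (LinearMap.ker A)) - 1 := by
  have := sum_ker_ne A (fun _ => 1)
  simpa [card_ker C] using this

theorem ff_mul {k : ℕ} (H : IsHerm C h) (hn : Module.finrank K V = k + 2) (A : V →ₗ[K] V) :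
    (C.Q ^ 2 - 1) * ff C (k + 2) h A = ∑ v ∈ kerS A, UU C k h A v := by
  have := sum_UU (k := k) (h := h) C A (fun _ => 1) (fun _ _ _ => rfl)
  simp only [one_mul] at this
  rw [this, ff_eq_sum C H hn]
end

def PA (n : ℕ) : Prop := ∀ (V : Type) [AddCommGroup V] [Module K V] [Fintype V] (h : V → V → K)
  (A : V →ₗ[K] V) (M : ℕ), IsHerm C h → NonDeg h → SAdj h A → A ^ M = 0 →
  Module.finrank K V = n →
  ff C n h A = bb C n * cc C n (Module.finrank K (LinearMap.ker A))

def PZ (k : ℕ) : Prop := ∀ (V : Type) [AddCommGroup V] [Module K V] [Fintype V] (h : V → V → K)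
  (A : V →ₗ[K] V) (M : ℕ), IsHerm C h → NonDeg h → SAdj h A → A ^ M = 0 →
  Module.finrank K V = k + 2 → ∀ l, Module.finrank K (LinearMap.ker A) = l + 2 →
  ∀ v, A v = 0 → v ≠ 0 →
  UU C k h A v = (C.Q ^ 2 - 1) * bb C (k + 2) * cc C k l * eta C h A M v

theorem DD_const {V : Type} [AddCommGroup V] [Module K V] [Fintype V] {h : V → V → K} {k : ℕ}
    (H : IsHerm C h) (hn : Module.finrank K V = k + 1) (A : V →ₗ[K] V) (φ : V → K) (x : ℂ)
    (hx : ∀ v, A v = 0 → v ≠ 0 → C.w (φ v) = x) : DD C k h A φ = x * ff C (k + 1) h A := by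
  rw [DD, ff, Finset.mul_sum]
  refine Finset.sum_congr rfl fun e _ => ?_
  by_cases he : Frame h e ∧ UpF h A e
  · rw [hx _ (frame_up_zero C H hn he.1 he.2) (frame_ne_zero C H he.1 0), mul_comm]
  · simp [FG, he]

theorem PZ_zero : PZ C 0 := by
  intro V _ _ _ h A M H nd hA hM hn l hl v hv hv0
  have h1 : LinearMap.ker A = ⊤ := by
    apply Submodule.eq_top_of_finrank_eq
    have := (LinearMap.ker A).finrank_le
    omega
  have hA0 : ∀ x, A x = 0 := fun x => by
    have : x ∈ LinearMap.ker A := by rw [h1]; trivial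
    exact this
  have hl0 : l = 0 := by
    have := (LinearMap.ker A).finrank_le
    omega
  have he : eta C h A M v = if h v v = 0 then 1 else 0 := by
    rw [← eta_add2 C H nd hA hM hv0, eta_not_range C H nd hA (M + 1)]
    rintro ⟨w, hw⟩; exact hv0 (by rw [← hw, hA0])
  rw [he]
  split_ifs with hvv
  · obtain ⟨v', S⟩ := exists_partner C H nd hA hv0 hv hvv
    rw [S.UU_zero hn, hA0, H.zero_left, if_pos rfl, bb_two, hl0]
    simp [bb, cc]; ring
  · rw [UU_aniso C H A hvv, mul_zero]

theorem eta_aniso {V : Type} [AddCommGroup V] [Module K V] [Fintype V] {h : V → V → K}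
    (H : IsHerm C h) (nd : NonDeg h) {A : V →ₗ[K] V} (hA : SAdj h A) {M : ℕ}
    (hM : A ^ M = 0) {v : V} (hv : A v = 0) (hvv : h v v ≠ 0) : eta C h A M v = 0 := by
  have hv0 : v ≠ 0 := by rintro rfl; exact hvv (H.zero_left _)
  rw [← eta_add2 C H nd hA hM hv0, eta_not_range C H nd hA (M + 1), if_neg hvv]
  rintro ⟨w, hw⟩
  apply hvv
  nth_rewrite 1 [← hw]
  rw [hA, hv, H.zero_right]

theorem PZ_succ (k : ℕ) (ha : PA C (k + 1)) (hz : ∀ j, k = j + 1 → PZ C j) : PZ C (k + 1) := by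
  intro V _ _ _ h A M H nd hA hM hn l hl v hv hv0
  by_cases hvv : h v v = 0
  swap
  · rw [UU_aniso C H A hvv, eta_aniso C H nd hA hM hv hvv, mul_zero]
  obtain ⟨v', S⟩ := exists_partner C H nd hA hv0 hv hvv
  have hnW : Module.finrank K S.W = k + 1 := by have := S.finrank_W; omega
  rw [S.UU_succ hn, bb_two]
  by_cases hx : ∃ x0, S.A1 x0 = S.a1
  · obtain ⟨x0, hx⟩ := hx
    rw [DD_const C S.H1 hnW S.A1 _ (C.Q ^ 2 - 1), ha S.W S.h1 S.A1 M S.H1 S.nd1 S.sa1 (S.nil1 hM) hnW]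
    · have : cc C (k + 1) (Module.finrank K (LinearMap.ker S.A1)) = cc C (k + 1) l * eta C h A M v := by
        rw [← eta_add2 C H nd hA hM hv0]
        rcases S.case1 hx M with ⟨h1, h2, _⟩ | ⟨h1, h2, _⟩
        · have : Module.finrank K (LinearMap.ker S.A1) = l := by omega
          rw [h2, this, mul_one]
        · have : Module.finrank K (LinearMap.ker S.A1) = l + 1 := by omega
          rw [h2, this, cc_succ, hl, show l + 2 = (l + 1) + 1 from rfl, pow_succ _ (l + 1)]
          have := C.Q_ne
          field_simp
      rw [this]; ring
    · intro u hu _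
      have : S.h1 u S.a1 = 0 := by rw [← hx, ← S.sa1, hu, S.H1.zero_left]
      rw [this, Ctx.w, if_pos rfl]
  · have hd := S.case2_dim hx
    have hle := (LinearMap.ker S.A1).finrank_le
    obtain ⟨j, rfl⟩ : ∃ j, k = j + 1 := ⟨k - 1, by omega⟩
    have hzj := hz j rfl S.W S.h1 S.A1 M S.H1 S.nd1 S.sa1 (S.nil1 hM) hnW l (by omega)
    have h1 : (C.Q ^ 2 - 1) * DD C (j + 1) S.h1 S.A1 (fun x => S.h1 x S.a1) =
      ∑ u ∈ kerS S.A1, C.w (S.h1 u S.a1) * UU C j S.h1 S.A1 u := by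
      rw [DD_eq_sum C S.H1 hnW, sum_UU]
      intro c u hc
      rw [S.H1.smul_left, C.w_smul hc]
    have h2 : ∑ u ∈ kerS S.A1, C.w (S.h1 u S.a1) * UU C j S.h1 S.A1 u =
       (C.Q ^ 2 - 1) * bb C (j + 2) * cc C j l *
        ∑ u ∈ kerS S.A1, C.w (S.h1 u S.a1) * eta C S.h1 S.A1 M u := by
      rw [Finset.mul_sum]
      refine Finset.sum_congr rfl fun u hu => ?_
      rw [mem_kerS] at hu
      rw [hzj u hu.1 hu.2]; ring
    have h3 : ∑ u ∈ kerS S.A1, C.w (S.h1 u S.a1) * eta C S.h1 S.A1 M u =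
        - (C.Q ^ 2 - 1) * eta C h A M v := by
      simp only [← C.w_eq_tr, Finset.sum_mul]
      rw [Finset.sum_comm, Finset.sum_congr rfl (g := fun _ => - eta C h A M v)]
      · have := Ctx.sum_ne (K := K) (fun _ => 1)
        simp only [Finset.sum_const, nsmul_eq_mul, mul_one, Finset.card_univ, C.cardK] at this
        rw [Finset.sum_const, nsmul_eq_mul, this]; ring
      · intro a ha
        exact S.case2_eta hx hM (by simpa using ha)
    rw [h2, h3] at h1
    have h4 := mul_left_cancel₀ C.Q2_ne_one (h1.trans (by ring :
      _ = (C.Q ^ 2 - 1) * (-(C.Q ^ 2 - 1) * bb C (j + 2) * cc C j l * eta C h A M v)))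
    rw [h4, show j + 1 + 1 = j + 2 from rfl, cc_two]; ring

theorem PA_zero : PA C 0 := by
  intro V _ _ _ h A M H nd hA hM hn
  have h0 : Module.finrank K (LinearMap.ker A) = 0 := by
    have := (LinearMap.ker A).finrank_le; omega
  have : ∀ e : Fin 0 → V, FG C h A e = 1 := fun e => by
    rw [FG, if_pos ⟨fun i => i.elim0, fun i => i.elim0⟩, sdF]; simp [C.ψzero]
  simp [ff, this, h0, bb, cc]

theorem PA_one : PA C 1 := by
  intro V _ _ _ h A M H nd hA hM hn
  have h1 : Module.finrank K (LinearMap.ker A) = 1 := by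
    have := (LinearMap.ker A).finrank_le
    by_contra hne
    have h0 : Module.finrank K (LinearMap.ker A) = 0 := by omega
    have h2 := nilp_inj hM h0
    have : Subsingleton V := ⟨fun a b => by rw [h2 a, h2 b]⟩
    have := Module.finrank_zero_of_subsingleton (R := K) (M := V)
    omega
  have hk : LinearMap.ker A = ⊤ := Submodule.eq_top_of_finrank_eq (by rw [h1, hn])
  have hA0 : ∀ x, A x = 0 := fun x => by
    have : x ∈ LinearMap.ker A := by rw [hk]; trivial
    exact this
  obtain ⟨v, hv0⟩ := Module.finrank_pos_iff_exists_ne_zero.1 (by rw [hn]; norm_num : 0 < Module.finrank K V)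
  have hsp : ∀ u, ∃ c : K, u = c • v := fun u => ker_one h1 (hA0 v) hv0 (hA0 u)
  have hvv : h v v ≠ 0 := by
    intro e
    apply hv0
    apply nd
    intro y
    obtain ⟨c, rfl⟩ := hsp y
    rw [H.smul_right, e, mul_zero]
  have hF : ∀ e : Fin 1 → V, FG C h A e = if h (e 0) (e 0) = 1 then 1 else 0 := by
    intro e
    have : (Frame h e ∧ UpF h A e) ↔ h (e 0) (e 0) = 1 := by
      constructor
      · rintro ⟨hf, _⟩; simpa using hf 0 0
      · intro he
        refine ⟨fun i j => ?_, fun i j _ => by rw [hA0, H.zero_left]⟩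
        fin_cases i; fin_cases j; simpa using he
    rw [FG]
    simp only [this]
    congr 1
    simp [sdF, C.ψzero]
  have hb : Function.Bijective (fun c : K => (fun _ : Fin 1 => c • v)) := by
    constructor
    · intro a b hab
      have : a • v = b • v := congrFun hab 0
      exact smul_left_injective K hv0 this
    · intro e
      obtain ⟨c, hc⟩ := hsp (e 0)
      exact ⟨c, by funext i; fin_cases i; exact hc.symm⟩
  rw [ff, ← Equiv.sum_comp (Equiv.ofBijective _ hb), h1]
  simp only [hF, Equiv.ofBijective_apply, H.smul_left, H.smul_right]
  rw [← Finset.sum_filter, Finset.sum_const, nsmul_eq_mul]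
  have h3 := C.nmFib (h v v)⁻¹ (by rw [map_inv₀, H.self_fix]) (inv_ne_zero hvv)
  have h4 : (Finset.univ.filter fun x : K => x * (C.σ x * h v v) = 1) =
    Finset.univ.filter fun x : K => x * C.σ x = (h v v)⁻¹ := by
    ext x; simp only [Finset.mem_filter, Finset.mem_univ, true_and]
    rw [← mul_assoc]
    exact ⟨fun e => eq_inv_of_mul_eq_one_left e, fun e => by rw [e, inv_mul_cancel₀ hvv]⟩
  rw [h4, h3]
  simp [bb, cc, Ctx.Q]; ring

theorem PA_two (k : ℕ) (ha : PA C k) (hz : PZ C k) : PA C (k + 2) := by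
  intro V _ _ _ h A M H nd hA hM hn
  apply mul_left_cancel₀ C.Q2_ne_one
  rw [ff_mul C H hn]
  have hl0 : Module.finrank K (LinearMap.ker A) ≠ 0 := by
    intro h0
    have h2 := nilp_inj hM h0
    have : Subsingleton V := ⟨fun a b => by rw [h2 a, h2 b]⟩
    have := Module.finrank_zero_of_subsingleton (R := K) (M := V)
    omega
  obtain ⟨l, hl⟩ := Nat.exists_eq_succ_of_ne_zero hl0
  rcases l with _ | l
  · have hl : Module.finrank K (LinearMap.ker A) = 1 := hl
    rw [Finset.sum_congr rfl (g := fun _ => bb C (k + 2) * cc C (k + 2) 1)]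
    · rw [Finset.sum_const, nsmul_eq_mul, card_kerS C, hl]
    intro v hv
    rw [mem_kerS] at hv
    obtain ⟨hv, hv0⟩ := hv
    have hvv := iso_of_one C H hA hM (by omega) hl hv hv0
    obtain ⟨v', S⟩ := exists_partner C H nd hA hv0 hv hvv
    have hnW : Module.finrank K S.W = k := by have := S.finrank_W; omega
    rcases k with _ | k
    · rw [S.UU_zero hn, if_neg]
      · rw [bb_two]; simp [bb, cc, Ctx.Q]; left; ring
      · intro h0
        have hW : ∀ x : S.W, x = 0 := by
          have := Module.finrank_zero_iff.1 hnW
          intro x; exact Subsingleton.elim _ _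
        have hAv' : A v' = 0 := by
          rw [S.Av'_eq, h0, hW S.a1]; simp
        obtain ⟨c, hc⟩ := ker_one hl hv hv0 hAv'
        have := S.v'v
        rw [hc, H.smul_left, hvv] at this
        simp at this
    · have hx : ¬ ∃ x0, S.A1 x0 = S.a1 := by
        rintro ⟨x0, hx⟩
        rcases S.case1 hx M with ⟨h1, _, _⟩ | ⟨h1, h2, _⟩
        · omega
        · have h2 := nilp_inj (S.nil1 hM) (by omega)
          have : Subsingleton S.W := ⟨fun a b => by rw [h2 a, h2 b]⟩
          have := Module.finrank_zero_of_subsingleton (R := K) (M := S.W)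
          omega
      have hd := S.case2_dim hx
      obtain ⟨z, hz, hz1⟩ := S.case2_z hx
      have hz0 : z ≠ 0 := by rintro rfl; rw [S.H1.zero_left] at hz1; simp at hz1
      rw [S.UU_succ hn, DD_const C S.H1 hnW S.A1 _ (-1),
        ha S.W S.h1 S.A1 M S.H1 S.nd1 S.sa1 (S.nil1 hM) hnW, ← hd, hl, bb_two, cc_two]
      · ring
      · intro u hu hu0
        obtain ⟨c, rfl⟩ := ker_one (by omega) hz hz0 hu
        have : c ≠ 0 := by rintro rfl; simp at hu0
        rw [S.H1.smul_left, hz1, mul_one, Ctx.w, if_neg this]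
  · have hl : Module.finrank K (LinearMap.ker A) = l + 2 := hl
    rw [Finset.sum_congr rfl (g := fun v => (C.Q ^ 2 - 1) * bb C (k + 2) * cc C k l * eta C h A M v)]
    · rw [← Finset.mul_sum, eta_sum C H nd hA hM, hl, cc_two, cc_succ, cc_succ,
        show C.Q ^ (l + 2) = C.Q ^ (l + 1) * C.Q from pow_succ _ _]
      have := C.Q_ne
      field_simp
    · intro v hv
      rw [mem_kerS] at hv
      exact hz V h A M H nd hA hM hn l hl v hv.1 hv.2

theorem PAZ (n : ℕ) : PA C n ∧ PZ C n := by
  induction n using Nat.strong_induction_on with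
  | _ n ih =>
    match n with
    | 0 => exact ⟨PA_zero C, PZ_zero C⟩
    | 1 => exact ⟨PA_one C, PZ_succ C 0 (PA_one C) (fun j hj => by omega)⟩
    | (k + 2) =>
      have h1 := PA_two C k (ih k (by omega)).1 (ih k (by omega)).2
      exact ⟨h1, PZ_succ C (k + 1) h1 (fun j hj => (ih j (by omega)).2)⟩

end
end

noncomputable section
set_option linter.unusedSectionVars false
/-! part 7 -/
section
variable {K : Type} [Field K] [Fintype K] (C : Ctx K)

def TT {V : Type} {n : ℕ} (h : V → V → K) (s e : Fin n → V) : Prop :=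
  ∀ i j, j ≤ i → h (e j) (s i.rev) = if i = j then 1 else 0

def NN {V : Type} [Fintype V] {n : ℕ} (h : V → V → K) (s : Fin n → V) : ℂ :=
  ∑ e : Fin n → V, if Frame h e then (if TT h s e then 1 else 0) else 0

theorem TT_zero {V : Type} [AddCommGroup V] [Module K V] [Fintype V] {n : ℕ} {h : V → V → K}
    (H : IsHerm C h) (hn : Module.finrank K V = n + 1) {s e : Fin (n + 1) → V} (hs : Frame h s)
    (ht : TT h s e) : e 0 = s 0 := by
  rw [frame_expand C H hn hs (e 0)]
  simp [ht _ 0 (Fin.zero_le _)]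

theorem NN_eq (n : ℕ) : ∀ (V : Type) [AddCommGroup V] [Module K V] [Fintype V] (h : V → V → K)
    (s : Fin n → V), IsHerm C h → NonDeg h → Module.finrank K V = n → Frame h s →
    NN h s = bb C n := by
  induction n using Nat.twoStepInduction with
  | zero =>
    intro V _ _ _ h s H nd hn hs
    have h1 : ∀ e : Fin 0 → V, Frame h e := fun e i => i.elim0
    have h2 : ∀ e : Fin 0 → V, TT h s e := fun e i => i.elim0
    simp [NN, h1, h2, bb]
  | one =>
    intro V _ _ _ h s H nd hn hs
    rw [NN, Finset.sum_eq_single s]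
    · rw [if_pos hs, if_pos, bb]
      intro i j _
      fin_cases i; fin_cases j
      simpa using hs 0 0
    · intro e _ hne
      rw [if_neg (c := TT h s e)]
      · simp
      intro ht
      apply hne
      funext i
      fin_cases i
      exact TT_zero C H hn hs ht
    · simp
  | more k ih _ =>
    intro V _ _ _ h s H nd hn hs
    have e0 : h (s 0) (s 0) = 0 := by rw [hs, rev_zero', if_neg Fin.last_pos.ne]
    have e1 : h (s (Fin.last (k + 1))) (s 0) = 1 := by rw [hs, rev_last', if_pos rfl]
    have e2 : h (s (Fin.last (k + 1))) (s (Fin.last (k + 1))) = 0 := by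
      rw [hs, rev_last', if_neg Fin.last_pos.ne']
    have S : HS C h (0 : V →ₗ[K] V) (s 0) (s (Fin.last (k + 1))) :=
      ⟨H, nd, fun x y => by simp [H.zero_left, H.zero_right], rfl, e0, e1, e2⟩
    have hnW : Module.finrank K S.W = k := by have := S.finrank_W; omega
    have hmem : ∀ i, s (mi i) ∈ S.W := fun i => by
      rw [S.mem_W, hs, hs, rev_mi, if_neg (zero_ne_mi _), if_neg (last_ne_mi _)]; simp
    let t : Fin k → S.W := fun i => ⟨s (mi i), hmem i⟩
    have ht : Frame S.h1 t := fun i j => by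
      rw [S.h1_def]; change h (s (mi i)) (s (mi j)) = _; rw [hs, rev_mi]; simp only [mi_inj]
    have hstep := S.fib_sum' hn (l := 1) one_ne_zero (fun e => if TT h s e then 1 else 0)
      (fun e => if TT S.h1 t e then 1 else 0) (by
        intro T hT
        have : TT h s (S.bld 1 T) ↔ TT S.h1 t T.1.1 := by
          have f1 : h (s 0) (s (Fin.last (k + 1))) = 1 := S.vv'
          have f2 : ∀ i, h (s 0) (s (mi i)) = 0 := fun i => S.vW (t i)
          have f3 : ∀ (x : S.W), h x (s 0) = 0 := fun x => S.Wv x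
          have f4 : ∀ (x : S.W) i, h x (s (mi i)) = S.h1 x (t i) := fun x i => rfl
          unfold TT HS.bld
          simp only [forall_mi, e3_zero, e3_mi, e3_last, rev_zero', rev_last', rev_mi, mi_le,
            H.add_left, H.sub_left, H.smul_left, e0, e1, e2, f1, f2, f3, f4, mul_zero, mul_one,
            one_mul, one_smul, map_one, inv_one, add_zero, zero_add, sub_zero, mi_inj,
            zero_ne_mi, mi_ne_zero, mi_ne_last, last_ne_mi, if_true, if_false, implies_true,
            true_and, and_true, (Fin.last_pos).ne, (Fin.last_pos).ne']
          constructor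
          · rintro ⟨_, h2⟩ i; exact (h2 i).1
          · intro h2
            refine ⟨⟨fun i hi => absurd (Fin.le_zero_iff.1 hi) (mi_ne_zero i), fun hi => ?_⟩,
              fun i => ⟨h2 i, fun hi => ?_⟩⟩
            · exact absurd hi (by simp)
            · exact absurd (Fin.last_le_iff.1 hi) (mi_ne_last i)
        simp only [this])
    have ih' := ih S.W S.h1 t S.H1 S.nd1 hnW ht
    rw [NN] at ih'
    rw [bb_two, ← ih', ← hstep, NN]
    refine Finset.sum_congr rfl fun e _ => ?_
    rw [one_smul]
    by_cases h1 : Frame h e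
    · by_cases h2 : TT h s e
      · have h3 : e 0 = s 0 ∧ Frame h e := ⟨TT_zero C H hn hs h2, h1⟩
        simp only [h1, h2, h3, and_self, if_true]
      · simp [h2]
    · simp [h1]

end
end

noncomputable section
set_option linter.unusedSectionVars false
/-! part 8 -/
section
variable {K : Type} [Field K] [Fintype K] (C : Ctx K)
variable {V : Type} [AddCommGroup V] [Module K V] [Fintype V] {h : V → V → K}

def Fl {n : ℕ} (h : V → V → K) (e : Fin n → V) (m : ℕ) (x : V) : Prop :=
  ∀ i : Fin n, m ≤ i → h x (e i.rev) = 0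

theorem Fl_step {n : ℕ} (H : IsHerm C h) (hn : Module.finrank K V = n) {e : Fin n → V}
    (he : Frame h e) {X : V →ₗ[K] V} (hX : UpF h X e) {m : ℕ} {x : V} (hx : Fl h e (m + 1) x) :
    Fl h e m (X x) := by
  intro i hi
  rw [frame_expand C H hn he x, map_sum, H.sum_left]
  refine Finset.sum_eq_zero fun j _ => ?_
  rw [map_smul, H.smul_left]
  by_cases hj : m + 1 ≤ (j : ℕ)
  · rw [hx j hj, zero_mul]
  · rw [hX i j (by rw [Fin.le_def]; omega), mul_zero]

theorem Fl_mono {n : ℕ} {e : Fin n → V} {m m' : ℕ} (hm : m ≤ m') {x : V} (hx : Fl h e m x) :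
    Fl h e m' x := fun i hi => hx i (hm.trans hi)

theorem UpF_Fl {n : ℕ} {e : Fin n → V} {X : V →ₗ[K] V} :
    UpF h X e ↔ ∀ j : Fin n, Fl h e j (X (e j)) :=
  ⟨fun hh j i hi => hh i j hi, fun hh i j hi => hh j i hi⟩

theorem Fl_self {n : ℕ} {e : Fin n → V} (he : Frame h e) (j : Fin n) : Fl h e (j + 1) (e j) := by
  intro i hi
  rw [he, if_neg]
  intro e1
  have := Fin.rev_inj.1 e1
  omega

theorem UpF_nilp {n : ℕ} (H : IsHerm C h) (hn : Module.finrank K V = n) {e : Fin n → V}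
    (he : Frame h e) {X : V →ₗ[K] V} (hX : UpF h X e) : X ^ n = 0 := by
  have h1 : ∀ m ≤ n, ∀ x, Fl h e (n - m) ((X ^ m) x) := by
    intro m
    induction m with
    | zero => intro _ x i hi; exact absurd i.2 (by omega)
    | succ m ih =>
      intro hm x
      rw [pow_succ']
      refine Fl_step C H hn he hX ?_
      rw [show n - (m + 1) + 1 = n - m by omega]
      exact ih (by omega) x
  ext x
  have h2 := h1 n le_rfl x
  rw [frame_expand C H hn he ((X ^ n) x)]
  exact Finset.sum_eq_zero fun i _ => by rw [h2 i (by omega), zero_smul]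

theorem UpF_trans {n : ℕ} (H : IsHerm C h) (hn : Module.finrank K V = n) {e : Fin n → V}
    (he : Frame h e) {X Z D : V →ₗ[K] V} (hX : UpF h X e) (c a d : K)
    (hD : ∀ x, D x = c • x + a • X x) (hinj : Function.Injective D)
    (hZ : ∀ x, Z (D x) = d • X x) : UpF h Z e := by
  rw [UpF_Fl]
  intro j
  have hmaps : ∀ x : {x // Fl h e (j + 1) x}, Fl h e (j + 1) (D x.1) := by
    rintro ⟨x, hx⟩ i hi
    have h2 := Fl_mono (Nat.le_succ _) (Fl_step C H hn he hX hx)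
    rw [hD, H.add_left, H.smul_left, H.smul_left, hx i hi, h2 i hi]; simp
  let D' : {x // Fl h e (j + 1) x} → {x // Fl h e (j + 1) x} := fun x => ⟨D x.1, hmaps x⟩
  have hi' : Function.Injective D' := fun x y hxy => Subtype.ext (hinj (congrArg Subtype.val hxy))
  obtain ⟨⟨y, hy⟩, hy2⟩ := (Finite.surjective_of_injective hi') ⟨e j, Fl_self he j⟩
  have hy3 : D y = e j := congrArg Subtype.val hy2
  rw [← hy3, hZ]
  intro i hi
  rw [H.smul_left, Fl_step C H hn he hX hy i hi, mul_zero]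

theorem cayley {n : ℕ} (H : IsHerm C h) (hn : Module.finrank K V = n)
    {N : V →ₗ[K] V} (hN : ∀ x y, h (N x) y + h x (N y) + h (N x) (N y) = 0)
    (hnil : IsNilpotent N) {κ : K} (hκ : κ - C.σ κ ≠ 0) :
    ∃ A : V →ₗ[K] V, SAdj h A ∧ IsNilpotent A ∧ LinearMap.ker A = LinearMap.ker N ∧
      ∀ e : Fin n → V, Frame h e → ((UpF h A e ↔ UpF h N e) ∧
        (UpF h N e → sdF h N e = (κ - C.σ κ) * sdF h A e)) := by
  set δ := κ - C.σ κ with hδ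
  have hu : IsUnit (algebraMap K (Module.End K V) δ + κ • N) := by
    refine IsNilpotent.isUnit_add_left_of_commute (hnil.smul κ) ?_ ?_
    · exact (isUnit_iff_ne_zero.2 hκ).map _
    · exact (Algebra.commutes δ _).symm
  obtain ⟨D, hD⟩ := hu
  have hDx : ∀ x, D.1 x = δ • x + κ • N x := fun x => by rw [hD]; simp [Module.algebraMap_end_apply]
  have hcomm : Commute N D.1 := by
    rw [hD]
    exact Commute.add_right (Algebra.commutes δ N).symm ((Commute.refl N).smul_right κ)
  have hcomm' : Commute N (D⁻¹).1 := hcomm.units_inv_right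
  have hDi : ∀ x, D.1 ((D⁻¹).1 x) = x := fun x => by
    rw [← Module.End.mul_apply, Units.mul_inv]; rfl
  have hiD : ∀ x, (D⁻¹).1 (D.1 x) = x := fun x => by
    rw [← Module.End.mul_apply, Units.inv_mul]; rfl
  have hAD : ∀ x, (N * (D⁻¹).1) (D.1 x) = N x := fun x => by
    rw [Module.End.mul_apply, hiD]
  refine ⟨N * (D⁻¹).1, ?_, ?_, ?_, ?_⟩
  · intro x y
    rw [← hDi x, ← hDi y, hAD, hAD]
    generalize (D⁻¹).1 x = x'
    generalize (D⁻¹).1 y = y'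
    rw [hDx, hDx, H.add_left, H.add_right, H.smul_left, H.smul_right, H.smul_left, H.smul_right]
    have h1 := hN x' y'
    have h2 : C.σ δ = - δ := by rw [hδ, map_sub, C.invol]; ring
    rw [h2]
    linear_combination (-δ) * h1 + h (N x') (N y') * hδ
  · exact hcomm'.isNilpotent_mul_right hnil
  · ext x
    rw [LinearMap.mem_ker, LinearMap.mem_ker, hcomm'.eq, Module.End.mul_apply]
    constructor
    · intro e; rw [← hDi (N x), e, map_zero]
    · intro e; rw [e, map_zero]
  · intro e he
    have hA1 : ∀ x, (N * (D⁻¹).1) x = (D⁻¹).1 (N x) := fun x => by rw [hcomm'.eq]; rfl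
    have hκA : ∀ x, x - κ • (N * (D⁻¹).1) x = δ • (D⁻¹).1 x := by
      intro x
      conv_lhs => rw [← hDi x]
      rw [hAD, hDx]; abel
    have up : UpF h (N * (D⁻¹).1) e ↔ UpF h N e := by
      constructor
      · intro hu
        refine UpF_trans C H hn he hu (D := δ • (D⁻¹).1) 1 (-κ) δ ?_ ?_ ?_
        · intro x
          rw [LinearMap.smul_apply, ← hκA, one_smul, neg_smul, sub_eq_add_neg]
        · intro x y hxy
          have := smul_right_injective V hκ hxy
          rw [← hDi x, this, hDi]
        · intro x
          rw [LinearMap.smul_apply, map_smul]; rfl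
      · intro hu
        refine UpF_trans C H hn he hu (D := D.1) δ κ 1 hDx ?_ ?_
        · intro x y hxy
          rw [← hiD x, hxy, hiD]
        · intro x; rw [hAD, one_smul]
    refine ⟨up, fun hu => ?_⟩
    have hAu := up.2 hu
    rw [sdF, sdF, Finset.mul_sum]
    refine Finset.sum_congr rfl fun i _ => ?_
    rw [Finset.mul_sum]
    refine Finset.sum_congr rfl fun j _ => ?_
    split_ifs with hij
    · have h1 : N (e j) = δ • (N * (D⁻¹).1) (e j) + κ • (N * (D⁻¹).1) (N (e j)) := by
        rw [← map_smul, ← map_smul, ← map_add, ← hDx, hAD]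
      have h2 : Fl h e (i + 1) (N (e j)) := by
        rw [← hij.1]; exact UpF_Fl.1 hu j
      have h3 := Fl_step C H hn he hAu h2 i le_rfl
      rw [h1, H.add_left, H.smul_left, H.smul_left, h3]; ring
    · rw [mul_zero]

theorem link_nil {n : ℕ} (H : IsHerm C h) (nd : NonDeg h) (hn : Module.finrank K V = n)
    {N : V →ₗ[K] V} (hN : ∀ x y, h (N x) y + h x (N y) + h (N x) (N y) = 0)
    (hnil : IsNilpotent N) {κ : K} (hκ : κ - C.σ κ ≠ 0) (χ : K → ℂ)
    (hχ : ∀ z, C.ψ z = χ ((κ - C.σ κ) * z)) :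
    ∑ e : Fin n → V, (if Frame h e ∧ UpF h N e then χ (sdF h N e) else 0) =
      bb C n * cc C n (Module.finrank K (LinearMap.ker N)) := by
  obtain ⟨A, hA, ⟨M, hM⟩, hk, hall⟩ := cayley C H hn hN hnil hκ
  rw [← hk, ← (PAZ C n).1 V h A M H nd hA hM hn, ff]
  refine Finset.sum_congr rfl fun e _ => ?_
  rw [FG]
  by_cases he : Frame h e
  · obtain ⟨h1, h2⟩ := hall e he
    by_cases hu : UpF h N e
    · rw [if_pos ⟨he, hu⟩, if_pos ⟨he, h1.2 hu⟩, h2 hu, hχ]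
    · rw [if_neg (fun hh => hu hh.2), if_neg (fun hh => hu (h1.1 hh.2))]
  · rw [if_neg (fun hh => he hh.1), if_neg (fun hh => he hh.1)]

theorem link_not {n : ℕ} (H : IsHerm C h) (hn : Module.finrank K V = n)
    {N : V →ₗ[K] V} (hnil : ¬ IsNilpotent N) (χ : K → ℂ) :
    ∑ e : Fin n → V, (if Frame h e ∧ UpF h N e then χ (sdF h N e) else 0) = 0 := by
  refine Finset.sum_eq_zero fun e _ => if_neg ?_
  rintro ⟨he, hu⟩
  exact hnil ⟨n, UpF_nilp C H hn he hu⟩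

end
end

noncomputable section
set_option linter.unusedSectionVars false
/-! part 9 -/
section

theorem rank_map_hom {K L : Type} [Field K] [Field L] (ι : K →+* L) {n : ℕ}
    (M : Matrix (Fin n) (Fin n) K) : (M.map ι).rank = M.rank := by
  obtain ⟨l, l', d, hM⟩ := Matrix.Pivot.exists_list_transvec_mul_diagonal_mul_list_transvec M
  have hu : ∀ l : List (Matrix.TransvectionStruct (Fin n) K),
      IsUnit (l.map Matrix.TransvectionStruct.toMatrix).prod.det := fun l => by
    rw [Matrix.TransvectionStruct.det_toMatrix_prod]; exact isUnit_one
  have hmap : ∀ X : Matrix (Fin n) (Fin n) K, X.map ι = ι.mapMatrix X := fun _ => rfl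
  have hu' : ∀ l : List (Matrix.TransvectionStruct (Fin n) K),
      IsUnit (ι.mapMatrix (l.map Matrix.TransvectionStruct.toMatrix).prod).det := fun l => by
    rw [← RingHom.map_det]; exact (hu l).map ι
  rw [hM, hmap, map_mul, map_mul, Matrix.rank_mul_eq_left_of_isUnit_det _ _ (hu' l'),
    Matrix.rank_mul_eq_right_of_isUnit_det _ _ (hu' l),
    Matrix.rank_mul_eq_left_of_isUnit_det _ _ (hu l'),
    Matrix.rank_mul_eq_right_of_isUnit_det _ _ (hu l)]
  have : ι.mapMatrix (Matrix.diagonal d) = Matrix.diagonal (fun i => ι (d i)) := by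
    rw [RingHom.mapMatrix_apply, Matrix.diagonal_map (map_zero ι)]
  rw [this, Matrix.rank_diagonal, Matrix.rank_diagonal]
  exact Fintype.card_congr (Equiv.subtypeEquivRight fun i => by simp)

theorem Partn.supp_fin (mu : Partn) (k : ℕ) :
    (Function.support fun i => mu.parts i - k).Finite :=
  mu.parts_finite.subset fun i hi => by
    simp only [Function.mem_support, Set.mem_setOf_eq] at *; omega

theorem Partn.sum_len (mu : Partn) :
    ∑ᶠ i, (mu.parts i - 0) = ∑ᶠ i, (mu.parts i - 1) + mu.len := by
  have h1 : mu.len = ∑ᶠ i, (if mu.parts i ≠ 0 then 1 else 0) := by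
    rw [Partn.len, Set.ncard_eq_toFinset_card _ mu.parts_finite, Finset.card_eq_sum_ones,
      ← finsum_mem_coe_finset, finsum_mem_def]
    refine finsum_congr fun i => ?_
    simp [Set.indicator_apply]
  rw [h1, ← finsum_add_distrib (mu.supp_fin 1)]
  · refine finsum_congr fun i => ?_
    split_ifs <;> omega
  · refine mu.parts_finite.subset fun i hi => ?_
    simp only [Function.mem_support, Set.mem_setOf_eq] at *
    intro h0; simp [h0] at hi

theorem unip_nil {n : ℕ} {K : Type} [Field K] {M : Matrix (Fin n) (Fin n) K} {mu : Partn}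
    (hM : unipOfType M mu) : IsNilpotent (M - 1) ∧ n = (M - 1).rank + mu.len := by
  constructor
  · refine ⟨mu.parts 1, ?_⟩
    have hr : ((M - 1) ^ mu.parts 1).rank = 0 → (M - 1) ^ mu.parts 1 = 0 := by
      intro h0
      rw [Matrix.rank, Submodule.finrank_eq_zero, LinearMap.range_eq_bot] at h0
      ext i j
      have h1 := congrFun (congrArg (fun f => f (Pi.single j 1)) h0) i
      simpa using h1
    apply hr
    rw [hM]
    refine finsum_eq_zero_of_forall_eq_zero fun i => ?_
    rcases Nat.eq_zero_or_pos i with rfl | hi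
    · rw [mu.parts_zero]; simp
    · have := mu.parts_antitone (le_refl 1) hi; omega
  · have h0 := hM 0
    have h1 := hM 1
    rw [pow_zero, Matrix.rank_one, mu.sum_len] at h0
    rw [pow_one] at h1
    rw [h1, ← h0]; simp

theorem rank_restrict {K V : Type} [Field K] [AddCommGroup V] [Module K V] [FiniteDimensional K V]
    (f : V →ₗ[K] V) (p : Submodule K V) : Module.finrank K (p.map f) +
      Module.finrank K (p ⊓ LinearMap.ker f : Submodule K V) = Module.finrank K p := by
  have h1 := (f.domRestrict p).finrank_range_add_finrank_ker
  rw [LinearMap.range_domRestrict, LinearMap.ker_domRestrict] at h1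
  rw [← h1, ← Submodule.map_comap_subtype, Submodule.finrank_map_subtype_eq]

theorem rank_pow_convex {n : ℕ} {K : Type} [Field K] (X : Matrix (Fin n) (Fin n) K) (k : ℕ) :
    (X ^ (k + 1)).rank + (X ^ (k + 1)).rank ≤ (X ^ k).rank + (X ^ (k + 2)).rank := by
  have hs : ∀ j, LinearMap.range (X ^ (j + 1)).mulVecLin =
      (LinearMap.range (X ^ j).mulVecLin).map X.mulVecLin := fun j => by
    rw [pow_succ', Matrix.mulVecLin_mul, LinearMap.range_comp]
  have h1 := rank_restrict X.mulVecLin (LinearMap.range (X ^ k).mulVecLin)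
  have h2 := rank_restrict X.mulVecLin (LinearMap.range (X ^ (k + 1)).mulVecLin)
  rw [← hs] at h1 h2
  have h3 : LinearMap.range (X ^ (k + 1)).mulVecLin ≤ LinearMap.range (X ^ k).mulVecLin := by
    rw [pow_succ, Matrix.mulVecLin_mul]; exact LinearMap.range_comp_le_range _ _
  have h4 := Submodule.finrank_mono (inf_le_inf_right (LinearMap.ker X.mulVecLin) h3)
  simp only [Matrix.rank]
  rw [show k + 2 = k + 1 + 1 from rfl]
  omega

theorem exists_type {n : ℕ} {K : Type} [Field K] {M : Matrix (Fin n) (Fin n) K}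
    (hM : IsNilpotent (M - 1)) : ∃ mu, unipOfType M mu := by
  obtain ⟨m, hm⟩ := hM
  set r : ℕ → ℕ := fun k => ((M - 1) ^ k).rank with hr
  have hconv : ∀ k, r (k + 1) + r (k + 1) ≤ r k + r (k + 2) := fun k => rank_pow_convex _ k
  have hdec : ∀ k, r (k + 1) ≤ r k := fun k => by
    simp only [hr]; rw [pow_succ]; exact Matrix.rank_mul_le_left _ _
  have hr0 : ∀ k, m ≤ k → r k = 0 := fun k hk => by
    simp only [hr]; rw [pow_eq_zero_of_le hk hm, Matrix.rank_zero]
  obtain ⟨d, hd⟩ : ∃ d : ℕ → ℕ, ∀ k, r k = r (k + 1) + d k :=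
    ⟨fun k => r k - r (k + 1), fun k => by have := hdec k; show _ = _ + (_ - _); omega⟩
  have hda : Antitone d := antitone_nat_of_succ_le fun k => by
    have := hconv k; have := hd k; have := hd (k + 1); rw [show k + 1 + 1 = k + 2 from rfl] at *; omega
  have hsum : ∀ k, r k = ∑ j ∈ Finset.Ico k m, d j := by
    have : ∀ t k, m ≤ k + t → r k = ∑ j ∈ Finset.Ico k m, d j := by
      intro t
      induction t with
      | zero => intro k hk; rw [hr0 k (by omega), Finset.Ico_eq_empty (by omega)]; rfl
      | succ t ih =>
        intro k hk
        by_cases hkm : k < m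
        · rw [hd k, ih (k + 1) (by omega), Finset.sum_eq_sum_Ico_succ_bot hkm]; ring
        · rw [hr0 k (by omega), Finset.Ico_eq_empty (by omega)]; rfl
    exact fun k => this m k (by omega)
  have hparts : ∀ i k, 1 ≤ i → ((Finset.range m).filter fun j => i ≤ d j).card - k =
      ((Finset.Ico k m).filter fun j => i ≤ d j).card := by
    intro i k hi
    have hex : ∃ c, c ≤ m ∧ ∀ j, j < m → (i ≤ d j ↔ j < c) := by
      by_cases hall : ∀ j, j < m → i ≤ d j
      · exact ⟨m, le_rfl, fun j hj => ⟨fun _ => hj, fun _ => hall j hj⟩⟩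
      · push Not at hall
        have hs := Nat.find_spec hall
        refine ⟨Nat.find hall, hs.1.le, fun j hj => ?_⟩
        constructor
        · intro hij
          by_contra hc
          have := hda (not_lt.1 hc)
          omega
        · intro hjc
          have := Nat.find_min hall hjc
          push Not at this
          exact this hj
    obtain ⟨c, hcm, hc⟩ := hex
    have e1 : (Finset.range m).filter (fun j => i ≤ d j) = Finset.range c := by
      ext j; simp only [Finset.mem_filter, Finset.mem_range]
      exact ⟨fun hj => (hc j hj.1).1 hj.2, fun hj => ⟨by omega, (hc j (by omega)).2 hj⟩⟩
    have e2 : (Finset.Ico k m).filter (fun j => i ≤ d j) = Finset.Ico k c := by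
      ext j; simp only [Finset.mem_filter, Finset.mem_Ico]
      exact ⟨fun hj => ⟨hj.1.1, (hc j hj.1.2).1 hj.2⟩,
        fun hj => ⟨⟨hj.1, by omega⟩, (hc j (by omega)).2 hj.2⟩⟩
    rw [e1, e2]; simp
  have hd0 : ∀ j, d j ≤ d 0 := fun j => hda (Nat.zero_le _)
  have hzero : ∀ i, d 0 < i → ((Finset.range m).filter fun j => i ≤ d j).card = 0 := by
    intro i hi
    rw [Finset.card_eq_zero, Finset.filter_eq_empty_iff]
    intro j _
    have := hd0 j; omega
  let mu : Partn :=
    { parts := fun i => if i = 0 then 0 else ((Finset.range m).filter fun j => i ≤ d j).card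
      parts_zero := by simp
      parts_antitone := by
        intro i j hi hij
        rw [if_neg (by omega), if_neg (by omega)]
        apply Finset.card_le_card
        intro x; simp only [Finset.mem_filter]; exact fun hx => ⟨hx.1, hij.trans hx.2⟩
      parts_finite := (Set.finite_le_nat (d 0)).subset fun i hi => by
        simp only [Set.mem_setOf_eq] at *
        by_contra hc
        apply hi
        rw [hzero i (by omega)]; simp }
  refine ⟨mu, fun k => ?_⟩
  change r k = _
  rw [hsum, finsum_eq_sum_of_support_subset (s := Finset.Ico 1 (d 0 + 1))]
  · symm
    rw [Finset.sum_congr rfl (g := fun i => ((Finset.Ico k m).filter fun j => i ≤ d j).card)]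
    · simp only [Finset.card_filter]
      rw [Finset.sum_comm]
      refine Finset.sum_congr rfl fun j _ => ?_
      rw [← Finset.card_filter]
      have : (Finset.Ico 1 (d 0 + 1)).filter (fun i => i ≤ d j) = Finset.Ico 1 (d j + 1) := by
        ext i; simp only [Finset.mem_filter, Finset.mem_Ico]
        have := hd0 j; omega
      rw [this]; simp
    · intro i hi
      rw [Finset.mem_Ico] at hi
      rw [← hparts i k hi.1]
      change (if i = 0 then 0 else _) - k = _
      rw [if_neg (by omega)]
  · intro i hi
    rw [Function.mem_support] at hi
    change (if i = 0 then 0 else _) - k ≠ 0 at hi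
    rw [Finset.coe_Ico, Set.mem_Ico]
    by_contra hc
    apply hi
    split_ifs with h0
    · simp
    · rw [hzero i (by omega)]; simp
end
end

noncomputable section
set_option linter.unusedSectionVars false

/-! part 10 -/
section fld
open Polynomial
theorem count_roots {L : Type} [Field L] [IsAlgClosed L] (P : L[X]) (hs : P.Separable) (S : Subfield L)
    [Fintype S] (hS : ∀ x, P.eval x = 0 → x ∈ S) :
    (Finset.univ.filter fun x : S => P.eval (x : L) = 0).card = P.natDegree := by
  have h0 : P ≠ 0 := hs.ne_zero
  have h1 : P.roots.card = P.natDegree := (IsAlgClosed.splits P).natDegree_eq_card_roots.symm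
  rw [← h1, ← Multiset.toFinset_card_of_nodup (nodup_roots hs)]
  refine Finset.card_bij (fun x _ => (x : L)) ?_ ?_ ?_
  · intro x hx
    rw [Multiset.mem_toFinset, mem_roots h0]
    exact (Finset.mem_filter.1 hx).2
  · intro x _ y _ h
    exact Subtype.ext h
  · intro x hx
    rw [Multiset.mem_toFinset, mem_roots h0] at hx
    exact ⟨⟨x, hS x hx⟩, Finset.mem_filter.2 ⟨Finset.mem_univ _, hx⟩, rfl⟩

variable (p : ℕ) [hp : Fact p.Prime] (r : ℕ)

theorem frobPow_apply (x : Fbar p) : frobPow p r x = x ^ p ^ r := by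
  simp [frobPow, iterateFrobenius_def]

instance charFbar : CharP (Fbar p) p :=
  charP_of_injective_algebraMap (algebraMap (ZMod p) (Fbar p)).injective p

def KK : Subfield (Fbar p) := RingHom.eqLocusField (frobPow p (2 * r)) (RingHom.id _)

theorem mem_KK {x : Fbar p} : x ∈ KK p r ↔ x ^ p ^ (2 * r) = x := by
  rw [← frobPow_apply]; rfl

theorem mem_KK' {x : Fbar p} : x ∈ KK p r ↔ (x ^ p ^ r) ^ p ^ r = x := by
  rw [mem_KK, ← pow_mul, ← pow_add, two_mul]

theorem mem_KKf {x : Fbar p} : x ∈ KK p r ↔ frobPow p r (frobPow p r x) = x := by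
  rw [mem_KK', frobPow_apply, frobPow_apply]

theorem castq {r : ℕ} (hr : 0 < r) : ((p ^ r : ℕ) : Fbar p) = 0 := by
  rw [CharP.cast_eq_zero_iff (Fbar p) p]; exact dvd_pow_self p hr.ne'

theorem q_ge {r : ℕ} (hr : 0 < r) : 2 ≤ p ^ r :=
  le_trans hp.out.two_le (Nat.le_self_pow hr.ne' p)

theorem sep1 {r : ℕ} (hr : 0 < r) : (X ^ p ^ r - X : (Fbar p)[X]).Separable := by
  rw [separable_def]
  have : derivative (X ^ p ^ r - X : (Fbar p)[X]) = -1 := by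
    simp [derivative_X_pow, castq p hr]
  rw [this]; exact isCoprime_one_right.neg_right

theorem deg1 {r : ℕ} (hr : 0 < r) : (X ^ p ^ r - X : (Fbar p)[X]).natDegree = p ^ r := by
  have := q_ge p hr
  rw [natDegree_sub_eq_left_of_natDegree_lt] <;> simp
  omega

theorem sep2 {r : ℕ} (hr : 0 < r) (s : Fbar p) : (X ^ p ^ r + X - C s : (Fbar p)[X]).Separable := by
  rw [separable_def]
  have : derivative (X ^ p ^ r + X - C s : (Fbar p)[X]) = 1 := by
    simp [derivative_X_pow, castq p hr]
  rw [this]; exact isCoprime_one_right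

theorem deg2 {r : ℕ} (hr : 0 < r) (s : Fbar p) :
    (X ^ p ^ r + X - C s : (Fbar p)[X]).natDegree = p ^ r := by
  have := q_ge p hr
  rw [natDegree_sub_C, natDegree_add_eq_left_of_natDegree_lt] <;> simp
  omega

theorem sep3 {r : ℕ} (hr : 0 < r) {s : Fbar p} (hs : s ≠ 0) :
    (X ^ (p ^ r + 1) - C s : (Fbar p)[X]).Separable := by
  apply separable_X_pow_sub_C s _ hs
  have := castq p hr
  push_cast at this ⊢
  rw [this]; simp

variable {r}

theorem finKK' (hr : Fact (0 < r)) : Finite (KK p r) := by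
  have hr2 : 0 < 2 * r := by have := hr.out; omega
  have h0 : (X ^ p ^ (2 * r) - X : (Fbar p)[X]) ≠ 0 := (sep1 p hr2).ne_zero
  have : (KK p r : Set (Fbar p)) ⊆ ((X ^ p ^ (2 * r) - X : (Fbar p)[X]).roots.toFinset : Set _) := by
    intro x hx
    rw [Finset.mem_coe, Multiset.mem_toFinset, mem_roots h0, IsRoot.def]
    have := (mem_KK p r).1 hx
    simp [this]
  exact (Finset.finite_toSet _).subset this

instance ftKK [hr : Fact (0 < r)] : Fintype (KK p r) := @Fintype.ofFinite _ (finKK' p hr)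

variable [hr : Fact (0 < r)]

theorem card_KK : Fintype.card (KK p r) = (p ^ r) ^ 2 := by
  have hr2 : 0 < 2 * r := by have := hr.out; omega
  have h := count_roots (X ^ p ^ (2 * r) - X : (Fbar p)[X]) (sep1 p hr2) (KK p r) (by
    intro x hx
    rw [mem_KK]
    simpa [sub_eq_zero] using hx)
  rw [deg1 p hr2, Finset.filter_true_of_mem, Finset.card_univ] at h
  · rw [h, ← pow_mul, mul_comm]
  · intro x _
    have := (mem_KK p r).1 x.2
    simp [this]

def sg : KK p r →+* KK p r where
  toFun x := ⟨frobPow p r x, by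
    rw [mem_KKf, (mem_KKf p r).1 x.2]⟩
  map_one' := Subtype.ext (by simp)
  map_mul' _ _ := Subtype.ext (by simp)
  map_zero' := Subtype.ext (by simp)
  map_add' _ _ := Subtype.ext (by simp)

theorem sg_coe (x : KK p r) : (sg p x : Fbar p) = frobPow p r x := rfl
theorem sg_coe' (x : KK p r) : (sg p x : Fbar p) = (x : Fbar p) ^ p ^ r := frobPow_apply p r x
theorem sg_sg (x : KK p r) : sg p (sg p x) = x := Subtype.ext ((mem_KKf p r).1 x.2)

theorem card_fix : (Finset.univ.filter fun t : KK p r => sg p t = t).card = p ^ r := by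
  have h := count_roots (X ^ p ^ r - X : (Fbar p)[X]) (sep1 p hr.out) (KK p r) (by
    intro x hx
    rw [mem_KK']
    have : x ^ p ^ r = x := by simpa [sub_eq_zero] using hx
    rw [this, this])
  rw [deg1 p hr.out] at h
  rw [← h]
  congr 1
  refine Finset.filter_congr fun x _ => ?_
  rw [← Subtype.coe_inj, sg_coe']
  simp [sub_eq_zero]

theorem tr_fib (s : KK p r) (hs : sg p s = s) :
    (Finset.univ.filter fun x : KK p r => x + sg p x = s).card = p ^ r := by
  have hs' : frobPow p r (s : Fbar p) = s := by rw [← sg_coe, hs]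
  have h := count_roots (X ^ p ^ r + X - C (s : Fbar p) : (Fbar p)[X]) (sep2 p hr.out s) (KK p r) (by
    intro x hx
    rw [mem_KKf]
    have h1 : frobPow p r x + x = s := by rw [frobPow_apply]; simpa [sub_eq_zero] using hx
    have h2 := congrArg (frobPow p r) h1
    rw [map_add, hs'] at h2
    linear_combination h2 - h1)
  rw [deg2 p hr.out] at h
  rw [← h]
  congr 1
  refine Finset.filter_congr fun x _ => ?_
  rw [← Subtype.coe_inj, Subfield.coe_add, sg_coe', add_comm]
  simp [sub_eq_zero]

theorem nm_fib (s : KK p r) (hs : sg p s = s) (h0 : s ≠ 0) :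
    (Finset.univ.filter fun x : KK p r => x * sg p x = s).card = p ^ r + 1 := by
  have hs' : frobPow p r (s : Fbar p) = s := by rw [← sg_coe, hs]
  have h0' : (s : Fbar p) ≠ 0 := fun h => h0 (Subtype.ext h)
  have h := count_roots (X ^ (p ^ r + 1) - C (s : Fbar p) : (Fbar p)[X]) (sep3 p hr.out h0') (KK p r) (by
    intro x hx
    rw [mem_KKf]
    have h1 : frobPow p r x * x = s := by
      rw [frobPow_apply, ← pow_succ]; simpa [sub_eq_zero] using hx
    have h2 := congrArg (frobPow p r) h1
    rw [map_mul, hs'] at h2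
    have hx0 : frobPow p r x ≠ 0 := fun h => h0' (by rw [← h1, h, zero_mul])
    apply mul_left_cancel₀ hx0
    linear_combination h2 - h1)
  rw [natDegree_X_pow_sub_C] at h
  rw [← h]
  congr 1
  refine Finset.filter_congr fun x _ => ?_
  rw [← Subtype.coe_inj, Subfield.coe_mul, sg_coe', mul_comm, ← pow_succ]
  simp [sub_eq_zero]

theorem exists_kap : ∃ κ : KK p r, κ - sg p κ ≠ 0 := by
  by_contra hh
  push Not at hh
  have h1 := card_fix p (r := r)
  rw [Finset.filter_true_of_mem, Finset.card_univ, card_KK] at h1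
  · have := q_ge p hr.out
    nlinarith
  · intro x _
    exact (sub_eq_zero.1 (hh x)).symm

def kap : KK p r := Classical.choose (exists_kap p (r := r))
theorem kap_ne : (kap p : KK p r) - sg p (kap p) ≠ 0 := Classical.choose_spec (exists_kap p (r := r))

def CC (ψ0 : Fbar p → ℂ) (hψ0_zero : ψ0 0 = 1)
    (hψ0_add : ∀ a b : Fbar p, a ^ p ^ (2 * r) = a → b ^ p ^ (2 * r) = b →
      ψ0 (a + b) = ψ0 a * ψ0 b)
    (hψ0_skew : ∃ a : Fbar p, a ^ p ^ r = -a ∧ ψ0 a ≠ 1) : Ctx (KK p r) where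
  σ := sg p
  invol := sg_sg p
  q := p ^ r
  hq := q_ge p hr.out
  card := card_KK p
  ψ z := ψ0 (((kap p - sg p (kap p)) * z : KK p r) : Fbar p)
  ψzero := by simp [hψ0_zero]
  ψadd a b := by
    rw [mul_add, Subfield.coe_add]
    exact hψ0_add _ _ ((mem_KK p r).1 (Subtype.prop _)) ((mem_KK p r).1 (Subtype.prop _))
  ψnt := by
    obtain ⟨a, ha, h1⟩ := hψ0_skew
    have haf : frobPow p r a = -a := by rw [frobPow_apply, ha]
    have hK : a ∈ KK p r := by rw [mem_KKf, haf, map_neg, haf, neg_neg]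
    have hs : sg p (⟨a, hK⟩ : KK p r) = - ⟨a, hK⟩ := Subtype.ext haf
    refine ⟨⟨a, hK⟩ / (kap p - sg p (kap p)), ?_, ?_⟩
    · rw [map_div₀, map_sub, sg_sg, hs, ← neg_sub (kap p) (sg p (kap p)), neg_div_neg_eq]
    · rw [mul_div_cancel₀ _ (kap_ne p)]; exact h1
  cardFix := by convert card_fix p (r := r)
  trFib s hs := by convert tr_fib p s hs
  nmFib s hs h0 := by convert nm_fib p s hs h0
end fld

end

noncomputable section
set_option linter.unusedSectionVars false

/-! part 11 -/
section lnk
variable (p : ℕ) [hp : Fact p.Prime] {r : ℕ} [hr : Fact (0 < r)] {n : ℕ}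

def hh (x y : Fin n → KK p r) : KK p r := ∑ i, x i * sg p (y i.rev)

def st (A : Matrix (Fin n) (Fin n) (KK p r)) : Matrix (Fin n) (Fin n) (KK p r) := atrans (A.map (sg p))

theorem st_apply (A : Matrix (Fin n) (Fin n) (KK p r)) (i j : Fin n) :
    st p A i j = sg p (A j.rev i.rev) := rfl

def colM (e : Fin n → Fin n → KK p r) : Matrix (Fin n) (Fin n) (KK p r) := Matrix.of fun i j => e j i

theorem st_mul_apply (x : Fin n → KK p r) (e : Fin n → Fin n → KK p r) (i : Fin n) :
    (st p (colM p e)).mulVec x i = hh p x (e i.rev) := by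
  simp only [Matrix.mulVec, dotProduct, hh, st_apply, colM, Matrix.of_apply]
  exact Finset.sum_congr rfl fun _ _ => mul_comm _ _

theorem st_mul_col (B : Matrix (Fin n) (Fin n) (KK p r)) (e : Fin n → Fin n → KK p r) (i j : Fin n) :
    (st p (colM p e) * (B * colM p e)) i j = hh p (B.mulVec (e j)) (e i.rev) := by
  rw [← st_mul_apply]; rfl

theorem st_mul_col' (e : Fin n → Fin n → KK p r) (i j : Fin n) :
    (st p (colM p e) * colM p e) i j = hh p (e j) (e i.rev) := by
  rw [← st_mul_apply]; rfl

theorem frame_iff (e : Fin n → Fin n → KK p r) : Frame (hh p) e ↔ st p (colM p e) * colM p e = 1 := by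
  constructor
  · intro h
    ext1 i j
    rw [st_mul_col', h, Matrix.one_apply]
    simp [Fin.rev_inj]
  · intro h i j
    have := congrFun (congrFun h j.rev) i
    rw [st_mul_col', Matrix.one_apply, Fin.rev_rev] at this
    rw [this]
    simp only [Fin.rev_eq_iff]

theorem hh_std (x : Fin n → KK p r) (i : Fin n) : hh p x (Pi.single i.rev 1) = x i := by
  rw [hh, Finset.sum_eq_single i]
  · simp
  · intro j _ hj
    have : j.rev ≠ i.rev := fun h => hj (Fin.rev_inj.1 h)
    simp [Pi.single_apply, this]
  · simp

def stdF : Fin n → Fin n → KK p r := fun i => Pi.single i 1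

theorem frame_std : Frame (hh p) (stdF p (r := r) (n := n)) := by
  intro i j
  have := hh_std p (stdF p (r := r) i) j.rev
  rw [Fin.rev_rev] at this
  rw [show stdF p (r := r) j = Pi.single j 1 from rfl, this, stdF, Pi.single_apply]
  simp only [Fin.rev_eq_iff]

variable (C : Ctx (KK p r)) (hC : C.σ = sg p)
include hC
theorem hh_herm : IsHerm C (hh p (n := n)) where
  add_left x y z := by simp [hh, add_mul, Finset.sum_add_distrib]
  smul_left a x y := by simp [hh, Finset.mul_sum, mul_assoc]
  symm x y := by
    rw [hC, hh, hh, map_sum]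
    refine Fintype.sum_equiv Fin.revPerm _ _ fun i => ?_
    simp [sg_sg, mul_comm]
omit hC

theorem hh_nd : NonDeg (hh p (r := r) (n := n)) := by
  intro x hx
  funext i
  have := hx (Pi.single i.rev 1)
  rwa [hh_std] at this

/-! the group -/
theorem mem_U (A : (Matrix (Fin n) (Fin n) (Fbar p))ˣ) : A ∈ Uprime p r n ↔
    atrans ((A : Matrix (Fin n) (Fin n) (Fbar p)).map (frobPow p r)) =
      ((A⁻¹ : (Matrix (Fin n) (Fin n) (Fbar p))ˣ) : Matrix (Fin n) (Fin n) (Fbar p)) := by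
  constructor
  · intro h
    have h1 : unitaryFrob p r n A = A := h
    conv_rhs => rw [← h1]
    rfl
  · intro h
    have h1 : (unitaryFrob p r n A)⁻¹ = A⁻¹ := Units.ext h
    exact inv_injective h1

theorem U_ent (u : Uprime p r n) (i j : Fin n) : matOf u⁻¹ i j = frobPow p r (matOf u j.rev i.rev) := by
  have := (mem_U p u.1).1 u.2
  exact (congrFun (congrFun this i) j).symm

theorem U_mem (u : Uprime p r n) (i j : Fin n) : matOf u i j ∈ KK p r := by
  rw [mem_KKf, ← Fin.rev_rev i, ← Fin.rev_rev j, ← U_ent]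
  have := U_ent p u⁻¹ i j
  rw [inv_inv] at this
  rw [Fin.rev_rev, Fin.rev_rev, this]

def km (u : Uprime p r n) : Matrix (Fin n) (Fin n) (KK p r) := Matrix.of fun i j => ⟨matOf u i j, U_mem p u i j⟩

theorem km_coe (u : Uprime p r n) (i j : Fin n) : (km p u i j : Fbar p) = matOf u i j := rfl
theorem km_map (u : Uprime p r n) : (km p u).map (KK p r).subtype = matOf u := rfl

theorem map_inj {A B : Matrix (Fin n) (Fin n) (KK p r)}
    (h : A.map (KK p r).subtype = B.map (KK p r).subtype) : A = B := by
  ext1 i j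
  exact Subtype.ext (congrFun (congrFun h i) j)

theorem km_mul (u v : Uprime p r n) : km p (u * v) = km p u * km p v := by
  apply map_inj
  rw [Matrix.map_mul, km_map, km_map, km_map]; rfl

theorem km_one : km p (1 : Uprime p r n) = 1 := by
  apply map_inj
  rw [km_map, Matrix.map_one _ (map_zero _) (map_one _)]; rfl

theorem km_inv (u : Uprime p r n) : km p u⁻¹ = st p (km p u) := by
  ext1 i j
  exact Subtype.ext (U_ent p u i j)

def mkU (A : Matrix (Fin n) (Fin n) (KK p r)) (hA : st p A * A = 1) : Uprime p r n :=
  ⟨⟨A.map (KK p r).subtype, (st p A).map (KK p r).subtype,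
    by rw [← Matrix.map_mul, mul_eq_one_comm.1 hA, Matrix.map_one _ (map_zero _) (map_one _)],
    by rw [← Matrix.map_mul, hA, Matrix.map_one _ (map_zero _) (map_one _)]⟩, by
      rw [mem_U]; rfl⟩

def UE : Uprime p r n ≃ {e : Fin n → Fin n → KK p r // Frame (hh p) e} where
  toFun u := ⟨fun j i => km p u i j, by
    rw [frame_iff]
    change st p (km p u) * km p u = 1
    rw [← km_inv, ← km_mul, inv_mul_cancel, km_one]⟩
  invFun e := mkU p (colM p e.1) ((frame_iff p e.1).1 e.2)
  left_inv u := Subtype.ext (Units.ext rfl)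
  right_inv e := Subtype.ext rfl

instance finU : Finite (Uprime p r n) := Finite.of_equiv _ (UE p).symm

theorem sumU (G : (Fin n → Fin n → KK p r) → ℂ) :
    ∑ᶠ u : Uprime p r n, G (fun j i => km p u i j) = ∑ e, if Frame (hh p) e then G e else 0 := by
  have h1 : ∑ᶠ u : Uprime p r n, G (fun j i => km p u i j) =
      ∑ᶠ e : {e : Fin n → Fin n → KK p r // Frame (hh p) e}, G e.1 :=
    finsum_comp_equiv (UE p) (f := fun e => G e.1)
  rw [h1, finsum_eq_sum_of_fintype, ← Finset.sum_filter]
  exact (Finset.sum_subtype _ (by simp) _).symm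

variable (g u : Uprime p r n)

theorem conj_ent (i j : Fin n) : km p (u⁻¹ * g * u) i j =
    hh p ((km p g).mulVec (fun k => km p u k j)) (fun k => km p u k i.rev) := by
  rw [mul_assoc, km_mul, km_mul, km_inv]
  exact st_mul_col p (km p g) (fun j i => km p u i j) i j

def NNg : (Fin n → KK p r) →ₗ[KK p r] (Fin n → KK p r) := (km p g - 1).mulVecLin

theorem NNg_apply (x) : NNg p g x = (km p g).mulVec x - x := by
  simp [NNg, Matrix.sub_mulVec]

include hC
theorem conj_N (i j : Fin n) : hh p (NNg p g (fun k => km p u k j)) (fun k => km p u k i.rev) =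
    km p (u⁻¹ * g * u) i j - if i = j then 1 else 0 := by
  rw [conj_ent, NNg_apply, (hh_herm p C hC).sub_left]
  have := ((UE p) u).2 j i.rev
  rw [show hh p (fun k => km p u k j) (fun k => km p u k i.rev) = _ from this]
  simp [Fin.rev_inj]

theorem conj_up : u⁻¹ * g * u ∈ unitri (Uprime p r n) ↔ UpF (hh p) (NNg p g) (fun j i => km p u i j) := by
  constructor
  · rintro ⟨h1, h2⟩ i j hij
    change hh p (NNg p g (fun k => km p u k j)) (fun k => km p u k i.rev) = 0
    rw [conj_N p C hC, sub_eq_zero]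
    apply Subtype.ext
    rw [km_coe]
    rcases hij.lt_or_eq with h | h
    · rw [h1 i j h, if_neg h.ne']; rfl
    · rw [h, h2, if_pos rfl]; rfl
  · intro h
    have h' : ∀ i j, j ≤ i → km p (u⁻¹ * g * u) i j = if i = j then 1 else 0 := fun i j hij => by
      have := h i j hij
      change hh p (NNg p g (fun k => km p u k j)) (fun k => km p u k i.rev) = 0 at this
      rwa [conj_N p C hC, sub_eq_zero] at this
    constructor
    · intro i j hij
      rw [← km_coe, h' i j hij.le, if_neg hij.ne']; rfl
    · intro i
      rw [← km_coe, h' i i le_rfl, if_pos rfl]; rfl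

theorem conj_sd : sdSumU p r n (cumSet Partn.empty) (u⁻¹ * g * u) =
    (sdF (hh p) (NNg p g) (fun j i => km p u i j) : KK p r) := by
  rw [sdSumU, sdF]
  push_cast
  refine Finset.sum_congr rfl fun i _ => Finset.sum_congr rfl fun j _ => ?_
  have hcum : (j : ℕ) = i + 1 → (j : ℕ) ∉ cumSet Partn.empty := by
    rintro h ⟨k, _, hk⟩
    simp [Partn.cumul, Partn.empty] at hk
    omega
  by_cases h : (j : ℕ) = i + 1 ∧ (j : ℕ) ≤ n / 2
  · rw [if_pos ⟨h.1, h.2, hcum h.1⟩, if_pos h]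
    change _ = ((hh p (NNg p g (fun k => km p u k j)) (fun k => km p u k i.rev) : KK p r) : Fbar p)
    have hne : i ≠ j := fun hh => by rw [hh] at h; omega
    rw [conj_N p C hC, if_neg hne, sub_zero]; rfl
  · rw [if_neg (fun h' => h ⟨h'.1, h'.2.1⟩), if_neg h]; rfl

theorem g_pres (x y : Fin n → KK p r) : hh p ((km p g).mulVec x) ((km p g).mulVec y) = hh p x y := by
  have H := hh_herm p C hC (n := n)
  have key : ∀ i j, hh p ((km p g).mulVec (Pi.single j 1)) ((km p g).mulVec (Pi.single i 1)) =
      hh p (Pi.single j (1 : KK p r)) (Pi.single i 1) := by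
    intro i j
    have h1 := ((UE p) g).2 j i
    have h2 := frame_std p (r := r) j i
    rw [Matrix.mulVec_single_one, Matrix.mulVec_single_one]
    exact h1.trans h2.symm
  have hm : ∀ x : Fin n → KK p r, (km p g).mulVec x = ∑ j, x j • (km p g).mulVec (Pi.single j 1) := by
    intro x
    rw [Matrix.mulVec_eq_sum]
    refine Finset.sum_congr rfl fun j _ => ?_
    rw [Matrix.mulVec_single_one, op_smul_eq_smul]; rfl
  have hs : ∀ x : Fin n → KK p r, x = ∑ j, x j • Pi.single j (1 : KK p r) := by
    intro x
    funext i
    simp [Finset.sum_apply, Pi.single_apply]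
  rw [hm x, hm y]
  conv_rhs => rw [hs x, hs y]
  simp only [H.sum_left, H.sum_right, H.smul_left, H.smul_right, key]

theorem N_unit (x y : Fin n → KK p r) : hh p (NNg p g x) y + hh p x (NNg p g y) +
    hh p (NNg p g x) (NNg p g y) = 0 := by
  have H := hh_herm p C hC (n := n)
  simp only [NNg_apply, H.sub_left, H.sub_right, g_pres p C hC]
  ring

theorem card_unitri : (Nat.card (unitri (Uprime p r n)) : ℂ) = bb C n := by
  rw [← NN_eq C n (Fin n → KK p r) (hh p) (stdF p) (hh_herm p C hC) (hh_nd p) (by simp) (frame_std p),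
    NN, ← sumU]
  haveI : Fintype (Uprime p r n) := Fintype.ofFinite _
  rw [finsum_eq_sum_of_fintype, ← Finset.sum_filter, Finset.sum_const, nsmul_one, Nat.card_eq_fintype_card]
  congr 1
  rw [Fintype.card_subtype]
  congr 1
  refine Finset.filter_congr fun u _ => ?_
  have ht : TT (hh p) (stdF p) (fun j i => km p u i j) ↔
      ∀ i j, j ≤ i → km p u i j = if i = j then 1 else 0 := by
    refine forall_congr' fun i => forall_congr' fun j => imp_congr_right fun _ => ?_
    rw [stdF, hh_std]
  rw [ht]
  constructor
  · rintro ⟨h1, h2⟩ i j hij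
    apply Subtype.ext
    rw [km_coe]
    rcases hij.lt_or_eq with h | h
    · rw [h1 i j h, if_neg h.ne']; rfl
    · rw [h, h2, if_pos rfl]; rfl
  · intro h'
    constructor
    · intro i j hij
      rw [← km_coe, h' i j hij.le, if_neg hij.ne']; rfl
    · intro i
      rw [← km_coe, h' i i le_rfl, if_pos rfl]; rfl

theorem Gam_eq (ψ0 : Fbar p → ℂ) : GammaDGG p r n ψ0 Partn.empty g = (bb C n)⁻¹ *
    ∑ e : Fin n → Fin n → KK p r, (if Frame (hh p) e ∧ UpF (hh p) (NNg p g) e then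
      (fun z : KK p r => ψ0 z) (sdF (hh p) (NNg p g) e) else 0) := by
  rw [GammaDGG, indChar, card_unitri p C hC]
  congr 1
  simp only [ite_and]
  rw [← sumU]
  refine finsum_congr fun u => ?_
  rw [conj_sd p C hC]
  exact if_congr (conj_up p C hC g u) rfl rfl

omit hC
theorem N_map : (km p g - 1).map (KK p r).subtype = matOf g - 1 := by
  rw [Matrix.map_sub _ (map_sub _), km_map, Matrix.map_one _ (map_zero _) (map_one _)]

theorem N_nil : IsNilpotent (NNg p g) ↔ IsNilpotent (matOf g - 1) := by
  have h1 : ∀ k, NNg p g ^ k = ((km p g - 1) ^ k).mulVecLin := fun k => by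
    rw [NNg, ← Matrix.toLin'_apply', ← Matrix.toLin'_apply', Matrix.toLin'_pow]
  have h2 : ∀ k, ((km p g - 1) ^ k).map (KK p r).subtype = (matOf g - 1) ^ k := fun k => by
    rw [Matrix.map_pow, N_map]
  refine exists_congr fun k => ?_
  rw [h1, ← h2]
  constructor
  · intro h
    rw [← Matrix.toLin'_apply', LinearEquiv.map_eq_zero_iff] at h
    rw [h, Matrix.map_zero _ (map_zero _)]
  · intro h
    have : (km p g - 1) ^ k = 0 := map_inj p (by rw [h, Matrix.map_zero _ (map_zero _)])
    rw [this, Matrix.mulVecLin_zero]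

theorem N_ker : (matOf g - 1).rank + Module.finrank (KK p r) (LinearMap.ker (NNg p g)) = n := by
  rw [← N_map, rank_map_hom]
  have := (NNg p g).finrank_range_add_finrank_ker
  rw [Module.finrank_fin_fun] at this
  exact this

end lnk

theorem GG_main
    (p : ℕ) [Fact p.Prime] (fexp : ℕ) (hf : 0 < fexp) (n : ℕ)
    (ψ0 : Fbar p → ℂ)
    (hψ0_zero : ψ0 0 = 1)
    (hψ0_add : ∀ a b : Fbar p, a ^ p ^ (2 * fexp) = a → b ^ p ^ (2 * fexp) = b →
      ψ0 (a + b) = ψ0 a * ψ0 b)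
    (hψ0_skew : ∃ a : Fbar p, a ^ p ^ fexp = -a ∧ ψ0 a ≠ 1)
    (g : ↥(Uprime p fexp n)) :
    ((∀ mu : Partn, ¬ unipOfType (matOf g) mu) →
        GammaDGG p fexp n ψ0 Partn.empty g = 0) ∧
      ∀ mu : Partn, unipOfType (matOf g) mu →
        GammaDGG p fexp n ψ0 Partn.empty g =
          (-1 : ℂ) ^ (n / 2 + mu.len) *
            ∏ i ∈ Finset.range mu.len, ((-((p : ℂ) ^ fexp)) ^ (i + 1) - 1) := by
  haveI : Fact (0 < fexp) := ⟨hf⟩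
  let C := CC p ψ0 hψ0_zero hψ0_add hψ0_skew
  have hC : C.σ = sg p := rfl
  have hb : bb C n ≠ 0 := bb_ne C n
  rw [Gam_eq p C hC]
  constructor
  · intro hmu
    have hnot : ¬ IsNilpotent (NNg p g) := by
      intro hnil
      obtain ⟨mu, h⟩ := exists_type ((N_nil p g).1 hnil)
      exact hmu mu h
    have hl := link_not C (n := n) (hh_herm p C hC) (by simp) hnot (fun z : KK p fexp => ψ0 z)
    rw [show (∑ e : Fin n → Fin n → KK p fexp, _) = _ from (by convert hl), mul_zero]
  · intro mu hmu
    obtain ⟨h1, h2⟩ := unip_nil hmu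
    have h3 := N_ker p g
    have h4 : Module.finrank (KK p fexp) (LinearMap.ker (NNg p g)) = mu.len := by omega
    have hl := link_nil C (n := n) (hh_herm p C hC) (hh_nd p) (by simp) (N_unit p C hC g)
      ((N_nil p g).2 h1) (κ := kap p) (kap_ne p) (fun z : KK p fexp => ψ0 z) (fun z => rfl)
    rw [show (∑ e : Fin n → Fin n → KK p fexp, _) = _ from (by convert hl), h4, inv_mul_cancel_left₀ hb, cc, pow_add, mul_assoc]
    congr 1
    have hQ : C.Q = -((p : ℂ) ^ fexp) := by
      rw [Ctx.Q]; change -(((p ^ fexp : ℕ)) : ℂ) = _; push_cast; rfl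
    have h5 : (-1 : ℂ) ^ mu.len = ∏ i ∈ Finset.range mu.len, (-1 : ℂ) := by simp
    rw [h5, ← Finset.prod_mul_distrib, hQ]
    exact Finset.prod_congr rfl fun i _ => by ring

end

/-- Corollary `UGGFormula`.  The Gelfand–Graev character `Γ_(n)` of
`U(n, F_{q²})` vanishes on non-unipotent classes, and on a unipotent class of type
`μ ⊢ n` takes the value `(-1)^{⌊n/2⌋ - ℓ(μ)} ∏_{i=1}^{ℓ(μ)} ((-q)^i - 1)`
(the sign `(-1)^{⌊n/2⌋ - ℓ(μ)}` is recorded as `(-1)^{⌊n/2⌋ + ℓ(μ)}`, which is equal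
to it and avoids truncated subtraction, since `ℓ(μ)` may exceed `⌊n/2⌋`). -/
theorem gelfandGraev_values_unitary
    (p : ℕ) [Fact p.Prime] (fexp : ℕ) (hf : 0 < fexp) (n : ℕ)
    (ψ0 : Fbar p → ℂ)
    (hψ0_zero : ψ0 0 = 1)
    (hψ0_add : ∀ a b : Fbar p, a ^ p ^ (2 * fexp) = a → b ^ p ^ (2 * fexp) = b →
      ψ0 (a + b) = ψ0 a * ψ0 b)
    (hψ0_nt : ∃ t : Fbar p, t ^ p ^ (2 * fexp) = t ∧ ψ0 t ≠ 1)
    (hψ0_skew : ∃ a : Fbar p, a ^ p ^ fexp = -a ∧ ψ0 a ≠ 1)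
    (g : ↥(Uprime p fexp n)) :
    ((∀ mu : Partn, ¬ unipOfType (matOf g) mu) →
        GammaDGG p fexp n ψ0 Partn.empty g = 0) ∧
      ∀ mu : Partn, unipOfType (matOf g) mu →
        GammaDGG p fexp n ψ0 Partn.empty g =
          (-1 : ℂ) ^ (n / 2 + mu.len) *
            ∏ i ∈ Finset.range mu.len, ((-((p : ℂ) ^ fexp)) ^ (i + 1) - 1) := by
  exact GG_main p fexp hf n ψ0 hψ0_zero hψ0_add hψ0_skew g

end GGU
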